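/- arXiv:2007.04918 — 2 statements merged into one kernel-verified Lean document; each statement's English description precedes it below -/
import Mathlib

section
/- Fix r with 1 < r < 3 and b with 0 < b < 2/(3+r). Let u be an admissible smooth solution of the 2D Zakharov–Kuznetsov equation on [2,∞) with sup_{t≥2} (‖u(t,·)‖_{L²(ℝ²)} + ‖∂_x u(t,·)‖_{L²(ℝ²)} + ‖∂_y u(t,·)‖_{L²(ℝ²)}) < ∞. For t ≥ 2 set Ω(t) = {(x,y) ∈ ℝ² : |x| < t^b and |y| < t^{b r}}. Then liminf_{t→∞} ∫_{Ω(t)} ( u(t,x,y)² + (∂_x u(t,x,y))² + (∂_y u(t,x,y))² ) dx dy = 0. -/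
open MeasureTheory Filter

noncomputable section

/-- Partial derivative in time of a function `u(t,x,y)`. -/
def pt2 (u : ℝ → ℝ → ℝ → ℝ) : ℝ → ℝ → ℝ → ℝ := fun t x y => deriv (fun s => u s x y) t

/-- Partial derivative in the first space variable of a function `u(t,x,y)`. -/
def px2 (u : ℝ → ℝ → ℝ → ℝ) : ℝ → ℝ → ℝ → ℝ := fun t x y => deriv (fun a => u t a y) x

/-- Partial derivative in the second space variable of a function `u(t,x,y)`. -/
def py2 (u : ℝ → ℝ → ℝ → ℝ) : ℝ → ℝ → ℝ → ℝ := fun t x y => deriv (fun c => u t x c) y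

/-- Iterated partial derivatives of `u(t,x,y)`, indexed by a list of directions
(`0` = t, `1` = x, `2` = y). -/
def D2 (u : ℝ → ℝ → ℝ → ℝ) : List (Fin 3) → (ℝ → ℝ → ℝ → ℝ)
  | [] => u
  | i :: l => if i = 0 then pt2 (D2 u l) else if i = 1 then px2 (D2 u l) else py2 (D2 u l)

/-- An admissible smooth solution of the 2D Zakharov–Kuznetsov equation
`∂ₜu + ∂ₓ(∂ₓ²u + ∂ᵧ²u) + u ∂ₓu = 0` on `[2,∞)`: it is `C^∞`, solves the equation
pointwise for `t ≥ 2`, and all iterated partial derivatives decay in space faster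
than any polynomial, locally uniformly in time. -/
structure IsAdmissibleZK2 (u : ℝ → ℝ → ℝ → ℝ) : Prop where
  smooth : ContDiff ℝ (⊤ : ℕ∞) (fun p : ℝ × ℝ × ℝ => u p.1 p.2.1 p.2.2)
  eqn : ∀ t x y : ℝ, 2 ≤ t →
    pt2 u t x y
      + px2 (fun t' x' y' => px2 (px2 u) t' x' y' + py2 (py2 u) t' x' y') t x y
      + u t x y * px2 u t x y = 0
  decay : ∀ (l : List (Fin 3)) (N : ℕ) (a b : ℝ), 2 ≤ a →
    ∃ C : ℝ, ∀ t x y : ℝ, t ∈ Set.Icc a b →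
      (1 + |x| + |y|) ^ N * |D2 u l t x y| ≤ C
/-- `f'` is the partial derivative of `f` in the first variable. -/
def HasPartialX (f f' : ℝ × ℝ → ℝ) : Prop :=
  ∀ p : ℝ × ℝ, HasDerivAt (fun a => f (a, p.2)) (f' p) p.1

/-- `f'` is the partial derivative of `f` in the second variable. -/
def HasPartialY (f f' : ℝ × ℝ → ℝ) : Prop :=
  ∀ p : ℝ × ℝ, HasDerivAt (fun a => f (p.1, a)) (f' p) p.2

namespace HasPartialX

variable {f f' g g' : ℝ × ℝ → ℝ}

theorem add (hf : HasPartialX f f') (hg : HasPartialX g g') :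
    HasPartialX (fun p => f p + g p) (fun p => f' p + g' p) :=
  fun p => (hf p).add (hg p)

theorem mul (hf : HasPartialX f f') (hg : HasPartialX g g') :
    HasPartialX (fun p => f p * g p) (fun p => f' p * g p + f p * g' p) :=
  fun p => (hf p).mul (hg p)

theorem const_mul (c : ℝ) (hf : HasPartialX f f') :
    HasPartialX (fun p => c * f p) (fun p => c * f' p) :=
  fun p => (hf p).const_mul c

end HasPartialX

namespace HasPartialY

variable {f f' g g' : ℝ × ℝ → ℝ}

theorem add (hf : HasPartialY f f') (hg : HasPartialY g g') :
    HasPartialY (fun p => f p + g p) (fun p => f' p + g' p) :=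
  fun p => (hf p).add (hg p)

theorem mul (hf : HasPartialY f f') (hg : HasPartialY g g') :
    HasPartialY (fun p => f p * g p) (fun p => f' p * g p + f p * g' p) :=
  fun p => (hf p).mul (hg p)

theorem const_mul (c : ℝ) (hf : HasPartialY f f') :
    HasPartialY (fun p => c * f p) (fun p => c * f' p) :=
  fun p => (hf p).const_mul c

theorem swap (hf : HasPartialY f f') : HasPartialX (f ∘ Prod.swap) (f' ∘ Prod.swap) :=
  fun p => hf p.swap

end HasPartialY

/-- `f` vanishes outside the square of half-width `R`. -/
def VanishesOutside (R : ℝ) (f : ℝ × ℝ → ℝ) : Prop :=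
  ∀ p : ℝ × ℝ, R < ‖p‖ → f p = 0

theorem VanishesOutside.hasCompactSupport {R : ℝ} {f : ℝ × ℝ → ℝ} (h : VanishesOutside R f) :
    HasCompactSupport f :=
  HasCompactSupport.intro (isCompact_closedBall (0 : ℝ × ℝ) R) fun p hp => h p (by simpa using hp)

theorem VanishesOutside.integrable {R : ℝ} {f : ℝ × ℝ → ℝ} (h : VanishesOutside R f)
    (hf : Continuous f) : Integrable f :=
  hf.integrable_of_hasCompactSupport h.hasCompactSupport

theorem VanishesOutside.slice_integrable {R : ℝ} {f : ℝ × ℝ → ℝ} (h : VanishesOutside R f)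
    (hf : Continuous f) (y : ℝ) : Integrable fun x => f (x, y) :=
  (by fun_prop : Continuous fun x => f (x, y)).integrable_of_hasCompactSupport <|
    HasCompactSupport.intro (isCompact_closedBall (0 : ℝ) R) fun x hx => h _ <| by
      have : R < ‖x‖ := by simpa using hx
      exact this.trans_le (norm_fst_le (x, y))

theorem VanishesOutside.swap {R : ℝ} {f : ℝ × ℝ → ℝ} (h : VanishesOutside R f) :
    VanishesOutside R (f ∘ Prod.swap) := fun p hp => h _ <| by
  rwa [Prod.norm_def, Prod.fst_swap, Prod.snd_swap, max_comm, ← Prod.norm_def]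

theorem HasPartialX.vanishesOutside {R : ℝ} {f f' : ℝ × ℝ → ℝ} (h : HasPartialX f f')
    (hs : VanishesOutside R f) : VanishesOutside R f' := fun p hp => by
  have hc : Continuous fun a : ℝ => ‖(a, p.2)‖ := by fun_prop
  have h1 : (fun a => f (a, p.2)) =ᶠ[nhds p.1] fun _ => 0 := by
    filter_upwards [hc.continuousAt.eventually (lt_mem_nhds (b := ‖(p.1, p.2)‖) hp)] with a ha
    exact hs _ ha
  exact ((hasDerivAt_const p.1 (0 : ℝ)).congr_of_eventuallyEq h1).unique (h p) |>.symm

theorem HasPartialY.vanishesOutside {R : ℝ} {f f' : ℝ × ℝ → ℝ} (h : HasPartialY f f')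
    (hs : VanishesOutside R f) : VanishesOutside R f' :=
  (h.swap.vanishesOutside hs.swap).swap

theorem HasPartialX.integral_eq_zero {R : ℝ} {f f' : ℝ × ℝ → ℝ} (h : HasPartialX f f')
    (hf : Continuous f) (hf' : Continuous f') (hs : VanishesOutside R f) :
    ∫ p, f' p = 0 := by
  have hs' := h.vanishesOutside hs
  rw [Measure.volume_eq_prod, integral_prod_symm _ (hs'.integrable hf')]
  exact integral_eq_zero_of_ae <| Eventually.of_forall fun y =>
    integral_eq_zero_of_hasDerivAt_of_integrable (f := fun x => f (x, y))
      (fun x => h (x, y)) (hs'.slice_integrable hf' y) (hs.slice_integrable hf y)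

theorem HasPartialY.integral_eq_zero {R : ℝ} {f f' : ℝ × ℝ → ℝ} (h : HasPartialY f f')
    (hf : Continuous f) (hf' : Continuous f') (hs : VanishesOutside R f) :
    ∫ p, f' p = 0 := by
  rw [← h.swap.integral_eq_zero (hf.comp continuous_swap) (hf'.comp continuous_swap) hs.swap,
    Measure.volume_eq_prod]
  exact (integral_prod_swap f').symm

/-- A function on the plane together with the spatial derivatives that enter the
Zakharov–Kuznetsov equation. -/
structure ZKJet (u ux uy uxx uxy uyy uxxx uxyy : ℝ × ℝ → ℝ) : Prop where
  c : Continuous u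
  cx : Continuous ux
  cy : Continuous uy
  cxx : Continuous uxx
  cxy : Continuous uxy
  cyy : Continuous uyy
  cxxx : Continuous uxxx
  cxyy : Continuous uxyy
  dx : HasPartialX u ux
  dy : HasPartialY u uy
  dxx : HasPartialX ux uxx
  dyx : HasPartialX uy uxy
  dxy : HasPartialY ux uxy
  dyy : HasPartialY uy uyy
  dxxx : HasPartialX uxx uxxx
  dyyx : HasPartialX uyy uxyy
  dxyy : HasPartialY uxy uxyy

/-- The virial identity: the flow of the density `A u - u²` against a compactly supported
weight `w`, after integration by parts. -/
theorem virial_identity {R : ℝ}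
    {u ux uy uxx uxy uyy uxxx uxyy w wx wy wxx wxy wyy wxxx wxyy : ℝ × ℝ → ℝ}
    (hu : ZKJet u ux uy uxx uxy uyy uxxx uxyy)
    (hw : ZKJet w wx wy wxx wxy wyy wxxx wxyy) (hs : VanishesOutside R w) (A : ℝ) :
    ∫ p, (A - 2 * u p) * w p * (-(uxxx p + uxyy p + u p * ux p)) =
      (∫ p, (A * (u p * (wxxx p + wxyy p)) + A / 2 * (u p ^ 2 * wx p)
        - u p ^ 2 * (wxxx p + wxyy p) + (3 * ux p ^ 2 + uy p ^ 2) * wx p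
        + 2 * (wy p * (ux p * uy p)))) - 2 / 3 * ∫ p, u p ^ 3 * wx p := by
  obtain ⟨c, cx, cy, cxx, cxy, cyy, cxxx, cxyy, dx, dy, dxx, dyx, dxy, dyy, dxxx, dyyx, dxyy⟩ := hu
  obtain ⟨d, ex, ey, exx, exy, -, exxx, exyy, fx, fy, fxx, fyx, fxy, -, fxxx, -, fxyy⟩ := hw
  have sx := fx.vanishesOutside hs
  have sy := fy.vanishesOutside hs
  have sxx := fxx.vanishesOutside sx
  have sxy := fyx.vanishesOutside sy
  have sxxx := fxxx.vanishesOutside sxx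
  have sxyy := fxyy.vanishesOutside sxy
  have hX := ((fx.mul (((dxxx.const_mul (-A)).add (dyyx.const_mul (-A))).add
    (((((dx.mul dx).const_mul (-(A / 2))).add ((dx.mul dxxx).const_mul 2)).add
    ((dxx.mul dxx).const_mul (-1))).add (((dyx.mul dyx).const_mul (-1)).add
    ((dx.mul (dx.mul dx)).const_mul (2 / 3)))))).add
    (fxx.mul ((dxx.const_mul A).add ((dx.mul dxx).const_mul (-2))))).add
    ((fxxx.mul ((dx.const_mul (-A)).add (dx.mul dx))).add
    (fyx.mul ((dx.mul dyx).const_mul (-2))))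
  have hY := (((fxy.mul dyy).const_mul A).add ((fxyy.mul dy).const_mul (-A))).add
    (((fy.mul (dy.mul dxyy)).const_mul 2).add (fxyy.mul (dy.mul dy)))
  have zX := hX.integral_eq_zero (R := R) (by fun_prop) (by fun_prop)
    fun p hp => by simp [hs p hp, sx p hp, sy p hp, sxx p hp]
  have zY := hY.integral_eq_zero (R := R) (by fun_prop) (by fun_prop)
    fun p hp => by simp [hs p hp, sx p hp, sxy p hp]
  have iX := (hX.vanishesOutside (R := R)
    fun p hp => by simp [hs p hp, sx p hp, sy p hp, sxx p hp]).integrable (by fun_prop)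
  have iY := (hY.vanishesOutside (R := R)
    fun p hp => by simp [hs p hp, sx p hp, sxy p hp]).integrable (by fun_prop)
  have z := integral_add iX iY
  rw [zX, zY, add_zero] at z
  rw [← integral_const_mul, ← integral_sub, ← sub_eq_zero, ← integral_sub, ← z]
  · refine integral_congr_ae (Eventually.of_forall fun p => ?_)
    ring
  · refine VanishesOutside.integrable (R := R) (fun p hp => ?_) (by fun_prop)
    simp [hs p hp]
  · refine VanishesOutside.integrable (R := R) (fun p hp => ?_) (by fun_prop)
    simp [sx p hp, sy p hp, sxxx p hp, sxyy p hp]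
  · refine VanishesOutside.integrable (R := R) (fun p hp => ?_) (by fun_prop)
    simp [sx p hp, sy p hp, sxxx p hp, sxyy p hp]
  · refine VanishesOutside.integrable (R := R) (fun p hp => ?_) (by fun_prop)
    simp [sx p hp]

theorem abs_integral_mul_le_sqrt_mul_sqrt {α : Type*} [MeasurableSpace α] {μ : Measure α}
    {f g : α → ℝ} (hf : AEStronglyMeasurable f μ) (hg : AEStronglyMeasurable g μ)
    (hf2 : Integrable (fun a => f a ^ 2) μ) (hg2 : Integrable (fun a => g a ^ 2) μ) :
    |∫ a, f a * g a ∂μ| ≤ √(∫ a, f a ^ 2 ∂μ) * √(∫ a, g a ^ 2 ∂μ) := by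
  have h := integral_mul_le_Lp_mul_Lq_of_nonneg (μ := μ) (f := fun a => |f a|)
    (g := fun a => |g a|) Real.HolderConjugate.two_two
    (Eventually.of_forall fun _ => abs_nonneg _) (Eventually.of_forall fun _ => abs_nonneg _)
    (by simpa using ((memLp_two_iff_integrable_sq hf).2 hf2).norm)
    (by simpa using ((memLp_two_iff_integrable_sq hg).2 hg2).norm)
  simp only [Real.rpow_ofNat, sq_abs, ← Real.sqrt_eq_rpow] at h
  refine (abs_integral_le_integral_abs).trans ?_
  simpa only [abs_mul] using h

theorem norm_fderiv_le_partials {v vx vy : ℝ × ℝ → ℝ} (hv : ContDiff ℝ 1 v)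
    (hx : HasPartialX v vx) (hy : HasPartialY v vy) (p : ℝ × ℝ) :
    ‖fderiv ℝ v p‖ ≤ |vx p| + |vy p| := by
  have hd : HasFDerivAt v (fderiv ℝ v p) (p.1, p.2) :=
    (hv.differentiable one_ne_zero p).hasFDerivAt
  have ex : fderiv ℝ v p (1, 0) = vx p :=
    (hd.comp_hasDerivAt p.1 ((hasDerivAt_id p.1).prodMk (hasDerivAt_const p.1 p.2))).unique (hx p)
  have ey : fderiv ℝ v p (0, 1) = vy p :=
    (hd.comp_hasDerivAt p.2 ((hasDerivAt_const p.2 p.1).prodMk (hasDerivAt_id p.2))).unique (hy p)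
  refine ContinuousLinearMap.opNorm_le_bound _ (by positivity) fun z => ?_
  have hz : z = z.1 • ((1, 0) : ℝ × ℝ) + z.2 • ((0, 1) : ℝ × ℝ) := by ext <;> simp
  have h1 : |z.1| ≤ ‖z‖ := norm_fst_le z
  have h2 : |z.2| ≤ ‖z‖ := norm_snd_le z
  calc ‖fderiv ℝ v p z‖ = |z.1 * vx p + z.2 * vy p| := by
        conv_lhs => rw [hz, map_add, map_smul, map_smul, ex, ey]
        simp
    _ ≤ |z.1| * |vx p| + |z.2| * |vy p| := by
        rw [← abs_mul, ← abs_mul]; exact abs_add_le _ _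
    _ ≤ ‖z‖ * |vx p| + ‖z‖ * |vy p| := by gcongr
    _ = (|vx p| + |vy p|) * ‖z‖ := by ring

/-- The Gagliardo–Nirenberg–Sobolev inequality `‖v‖_{L²} ≤ C ‖∇v‖_{L¹}` in the plane. -/
theorem exists_sqrt_integral_sq_le_integral_partials :
    ∃ C : ℝ, 0 ≤ C ∧ ∀ (R : ℝ) (v vx vy : ℝ × ℝ → ℝ), ContDiff ℝ 1 v → VanishesOutside R v →
      Continuous vx → Continuous vy → HasPartialX v vx → HasPartialY v vy →
      √(∫ p, v p ^ 2) ≤ C * ∫ p, (|vx p| + |vy p|) := by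
  refine ⟨eLpNormLESNormFDerivOneConst (volume : Measure (ℝ × ℝ)) ((2 : NNReal) : ℝ),
    NNReal.coe_nonneg _, fun R v vx vy hv hs cx cy hx hy => ?_⟩
  have hfr : ((Module.finrank ℝ (ℝ × ℝ) : ℕ) : NNReal).HolderConjugate 2 := by
    rw [Module.finrank_prod, Module.finrank_self]
    norm_num
    exact NNReal.HolderConjugate.two_two
  have h := eLpNorm_le_eLpNorm_fderiv_one (volume : Measure (ℝ × ℝ)) hv hs.hasCompactSupport hfr
  have i1 : Integrable fun p => |vx p| + |vy p| :=
    (((hx.vanishesOutside hs).integrable cx).abs).add (((hy.vanishesOutside hs).integrable cy).abs)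
  have h1 : eLpNorm (fderiv ℝ v) 1 volume ≤ ENNReal.ofReal (∫ p, (|vx p| + |vy p|)) := by
    refine (eLpNorm_mono_real (norm_fderiv_le_partials hv hx hy)).trans ?_
    rw [eLpNorm_one_eq_lintegral_enorm, ← ofReal_integral_norm_eq_lintegral_enorm i1]
    refine ENNReal.ofReal_le_ofReal (le_of_eq ?_)
    refine integral_congr_ae (Eventually.of_forall fun p => ?_)
    exact Real.norm_of_nonneg (by positivity)
  have h2 : ENNReal.ofReal (√(∫ p, v p ^ 2)) ≤ eLpNorm v ((2 : NNReal) : ENNReal) volume := by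
    have hm : MemLp v 2 volume := hv.continuous.memLp_of_hasCompactSupport hs.hasCompactSupport
    rw [show ((2 : NNReal) : ENNReal) = 2 from rfl, hm.eLpNorm_eq_integral_rpow_norm
      two_ne_zero ENNReal.ofNat_ne_top]
    simp [Real.sqrt_eq_rpow]
  have h3 := (h2.trans h).trans (mul_le_mul_right h1 _)
  rw [← ENNReal.ofReal_coe_nnreal, ← ENNReal.ofReal_mul (NNReal.coe_nonneg _)] at h3
  exact (ENNReal.ofReal_le_ofReal_iff (mul_nonneg (NNReal.coe_nonneg _)
    (integral_nonneg fun p => by positivity))).1 h3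

theorem exists_abs_integral_cube_mul_le :
    ∃ C : ℝ, 0 ≤ C ∧ ∀ (R K : ℝ) (u ux uy g gx gy : ℝ × ℝ → ℝ), ContDiff ℝ 1 u → ContDiff ℝ 1 g →
      VanishesOutside R g → Continuous ux → Continuous uy → Continuous gx → Continuous gy →
      HasPartialX u ux → HasPartialY u uy → HasPartialX g gx → HasPartialY g gy →
      Integrable (fun p => u p ^ 2) → √(∫ p, u p ^ 2) ≤ K →
      |∫ p, u p ^ 3 * g p| ≤ C * K * ∫ p, (2 * |u p| * (|ux p| + |uy p|) * |g p|
        + u p ^ 2 * (|gx p| + |gy p|)) := by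
  obtain ⟨C, hC, h⟩ := exists_sqrt_integral_sq_le_integral_partials
  refine ⟨C, hC, fun R K u ux uy g gx gy hu hg hs cux cuy cgx cgy dux duy dgx dgy hi hK => ?_⟩
  have cu := hu.continuous
  have cg := hg.continuous
  have sx := dgx.vanishesOutside hs
  have sy := dgy.vanishesOutside hs
  have hv := h R _ _ _ ((hu.mul hu).mul hg) (fun p hp => by simp [hs p hp]) (by fun_prop)
    (by fun_prop) ((dux.mul dux).mul dgx) ((duy.mul duy).mul dgy)
  have hcs := abs_integral_mul_le_sqrt_mul_sqrt (μ := volume) (f := u)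
    (g := fun p => u p * u p * g p) cu.aestronglyMeasurable
    (by fun_prop : Continuous _).aestronglyMeasurable hi
    (VanishesOutside.integrable (R := R) (fun p hp => by simp [hs p hp]) (by fun_prop))
  have e : (fun p => u p ^ 3 * g p) = fun p => u p * (u p * u p * g p) := by
    funext p; ring
  have hK0 : 0 ≤ K := (Real.sqrt_nonneg _).trans hK
  rw [e]
  refine hcs.trans ((mul_le_mul hK hv (Real.sqrt_nonneg _) hK0).trans ?_)
  rw [← mul_assoc, mul_comm K C]
  refine mul_le_mul_of_nonneg_left (integral_mono ?_ ?_ fun p => ?_) (by positivity)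
  · exact VanishesOutside.integrable (R := R) (fun p hp => by simp [hs p hp, sx p hp, sy p hp])
      (by fun_prop)
  · exact VanishesOutside.integrable (R := R) (fun p hp => by simp [hs p hp, sx p hp, sy p hp])
      (by fun_prop)
  · have key : ∀ a b c d : ℝ, |(b * a + a * b) * c + a * a * d|
        ≤ 2 * |a| * |b| * |c| + a ^ 2 * |d| := fun a b c d => by
      refine (abs_add_le _ _).trans (le_of_eq ?_)
      rw [show (b * a + a * b) * c = 2 * a * b * c by ring]
      simp only [abs_mul, abs_two, abs_mul_abs_self]
      ring
    refine (add_le_add (key _ _ _ _) (key _ _ _ _)).trans (le_of_eq ?_)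
    ring

theorem eq_zero_of_hasDerivAt_of_vanishing {f f' : ℝ → ℝ} {R : ℝ} (hf : ∀ x, HasDerivAt f (f' x) x)
    (h : ∀ x, R < |x| → f x = 0) (x : ℝ) (hx : R < |x|) : f' x = 0 := by
  have h1 : f =ᶠ[nhds x] fun _ => 0 := by
    filter_upwards [continuous_abs.continuousAt.eventually (lt_mem_nhds hx)] with a ha
    exact h a ha
  exact ((hasDerivAt_const x (0 : ℝ)).congr_of_eventuallyEq h1).unique (hf x) |>.symm

theorem exists_bound_of_vanishing {f : ℝ → ℝ} {R : ℝ} (hf : Continuous f)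
    (h : ∀ x, R < |x| → f x = 0) : ∃ B, ∀ x, |f x| ≤ B :=
  HasCompactSupport.exists_bound_of_continuous
    (HasCompactSupport.intro (isCompact_closedBall (0 : ℝ) R) fun x hx => h x (by simpa using hx)) hf

theorem exists_cutoff : ∃ χ : ℝ → ℝ, ContDiff ℝ (⊤ : ℕ∞) χ ∧ (∀ x, 0 ≤ χ x) ∧
    (∀ x, |x| ≤ 1 → χ x = 1) ∧ ∀ x, 2 < |x| → χ x = 0 := by
  let f : ContDiffBump (0 : ℝ) := ⟨1, 2, one_pos, one_lt_two⟩
  refine ⟨f, f.contDiff, fun x => f.nonneg, fun x hx => f.one_of_mem_closedBall ?_,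
    fun x hx => f.zero_of_le_dist ?_⟩
  · simpa [f] using hx
  · simpa [f] using hx.le

theorem exists_bounded_primitive {χ : ℝ → ℝ} (hχ : ContDiff ℝ (⊤ : ℕ∞) χ)
    (hs : ∀ x, 2 < |x| → χ x = 0) :
    ∃ ψ : ℝ → ℝ, ContDiff ℝ (⊤ : ℕ∞) ψ ∧ (∀ x, HasDerivAt ψ (χ x) x) ∧ ∃ B, ∀ x, |ψ x| ≤ B := by
  have hd : ∀ x, HasDerivAt (fun x => ∫ s in (0 : ℝ)..x, χ s) (χ x) x := fun x =>
    intervalIntegral.integral_hasDerivAt_right (hχ.continuous.intervalIntegrable _ _)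
      (hχ.continuous.stronglyMeasurableAtFilter _ _) hχ.continuous.continuousAt
  have hi : Integrable χ := hχ.continuous.integrable_of_hasCompactSupport
    (HasCompactSupport.intro (isCompact_closedBall (0 : ℝ) 2) fun x hx => hs x (by simpa using hx))
  refine ⟨_, ?_, hd, ∫ s, |χ s|, fun x => ?_⟩
  · refine contDiff_infty_iff_deriv.2 ⟨fun x => (hd x).differentiableAt, ?_⟩
    rwa [show deriv (fun x => ∫ s in (0 : ℝ)..x, χ s) = χ from funext fun x => (hd x).deriv]
  · exact (intervalIntegral.norm_integral_le_integral_norm_uIoc).trans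
      (setIntegral_le_integral hi.norm (Eventually.of_forall fun _ => norm_nonneg _))

/-- A smooth bounded function on the line with its derivative, such that `x f'(x)` is bounded. -/
structure IsProfile (f f' : ℝ → ℝ) : Prop where
  smooth : ContDiff ℝ (⊤ : ℕ∞) f
  hasDerivAt : ∀ x, HasDerivAt f (f' x) x
  bounded : ∃ B, ∀ x, |f x| ≤ B
  bounded_scaling : ∃ B, ∀ x, |x * f' x| ≤ B

theorem isProfile_of_vanishing {f : ℝ → ℝ} (hf : ContDiff ℝ (⊤ : ℕ∞) f)
    (hs : ∀ x, 2 < |x| → f x = 0) : IsProfile f (deriv f) := by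
  have hd : ∀ x, HasDerivAt f (deriv f x) x := fun x =>
    (hf.differentiable (by simp) x).hasDerivAt
  have hc : Continuous (deriv f) := (contDiff_infty_iff_deriv.1 hf).2.continuous
  refine ⟨hf, hd, exists_bound_of_vanishing hf.continuous hs,
    exists_bound_of_vanishing (by fun_prop) (fun x hx => ?_) (R := 2)⟩
  rw [eq_zero_of_hasDerivAt_of_vanishing hd hs x hx, mul_zero]

/-- The function `t^e p(x t^{-b}) q(x t^{-m}) s(y t^{-n})`. -/
def scaled (b m n e : ℝ) (p q s : ℝ → ℝ) (t : ℝ) (z : ℝ × ℝ) : ℝ :=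
  t ^ e * (p (z.1 * t ^ (-b)) * q (z.1 * t ^ (-m)) * s (z.2 * t ^ (-n)))

section scaled

variable {b m n e : ℝ} {p p' q q' s s' : ℝ → ℝ}

theorem scaled_contDiff {k : WithTop ℕ∞} (hp : ContDiff ℝ k p) (hq : ContDiff ℝ k q)
    (hs : ContDiff ℝ k s) (t : ℝ) : ContDiff ℝ k (scaled b m n e p q s t) := by
  unfold scaled
  fun_prop

theorem scaled_continuous (hp : Continuous p) (hq : Continuous q) (hs : Continuous s) (t : ℝ) :
    Continuous (scaled b m n e p q s t) := by
  unfold scaled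
  fun_prop

theorem scaled_hasPartialX (hp : ∀ x, HasDerivAt p (p' x) x) (hq : ∀ x, HasDerivAt q (q' x) x)
    {e₁ e₂ t : ℝ} (h₁ : e₁ = e - b) (h₂ : e₂ = e - m) (ht : 0 < t) :
    HasPartialX (scaled b m n e p q s t)
      (fun z => scaled b m n e₁ p' q s t z + scaled b m n e₂ p q' s t z) := fun z => by
  have d : ∀ c : ℝ, HasDerivAt (fun a : ℝ => a * t ^ c) (t ^ c) z.1 := fun c => by
    simpa using (hasDerivAt_id z.1).mul_const (t ^ c)
  have hP := (hp (z.1 * t ^ (-b))).comp z.1 (d (-b))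
  have hQ := (hq (z.1 * t ^ (-m))).comp z.1 (d (-m))
  refine (((hP.mul hQ).mul_const (s (z.2 * t ^ (-n)))).const_mul (t ^ e)).congr_deriv ?_
  simp only [scaled, h₁, h₂, sub_eq_add_neg, Real.rpow_add ht, Function.comp]
  ring

theorem scaled_hasPartialY (hs : ∀ x, HasDerivAt s (s' x) x)
    {e₁ t : ℝ} (h₁ : e₁ = e - n) (ht : 0 < t) :
    HasPartialY (scaled b m n e p q s t) (scaled b m n e₁ p q s' t) := fun z => by
  have d : ∀ c : ℝ, HasDerivAt (fun a : ℝ => a * t ^ c) (t ^ c) z.2 := fun c => by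
    simpa using (hasDerivAt_id z.2).mul_const (t ^ c)
  have hS := (hs (z.2 * t ^ (-n))).comp z.2 (d (-n))
  refine ((hS.const_mul (p (z.1 * t ^ (-b)) * q (z.1 * t ^ (-m)))).const_mul
    (t ^ e)).congr_deriv ?_
  simp only [scaled, h₁, sub_eq_add_neg, Real.rpow_add ht]
  ring

/-- The time derivative of `scaled b m n e p q s`. -/
def scaledT (b m n e : ℝ) (p p' q q' s s' : ℝ → ℝ) (t : ℝ) (z : ℝ × ℝ) : ℝ :=
  (e * scaled b m n (e - 1) p q s t z + -b * scaled b m n (e - 1) (fun x => x * p' x) q s t z)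
    + (-m * scaled b m n (e - 1) p (fun x => x * q' x) s t z
    + -n * scaled b m n (e - 1) p q (fun x => x * s' x) t z)

theorem scaled_hasDerivAt_time (hp : ∀ x, HasDerivAt p (p' x) x)
    (hq : ∀ x, HasDerivAt q (q' x) x) (hs : ∀ x, HasDerivAt s (s' x) x) {t : ℝ} (ht : 0 < t)
    (z : ℝ × ℝ) : HasDerivAt (fun r => scaled b m n e p q s r z)
      (scaledT b m n e p p' q q' s s' t z) t := by
  have d : ∀ c : ℝ, HasDerivAt (fun r : ℝ => r ^ c) (c * t ^ (c - 1)) t := fun c =>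
    Real.hasDerivAt_rpow_const (Or.inl ht.ne')
  have hP := (hp (z.1 * t ^ (-b))).comp t ((d (-b)).const_mul z.1)
  have hQ := (hq (z.1 * t ^ (-m))).comp t ((d (-m)).const_mul z.1)
  have hS := (hs (z.2 * t ^ (-n))).comp t ((d (-n)).const_mul z.2)
  refine ((d e).mul ((hP.mul hQ).mul hS)).congr_deriv ?_
  simp only [scaledT, scaled, sub_eq_add_neg, Real.rpow_add ht, Function.comp, Pi.mul_apply]
  ring

/-- `f` is `O(t^e)` for `t ≥ 1` and supported in `|x| ≤ 2 t^m`, `|y| ≤ 2 t^n`. -/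
def IsTame (m n e : ℝ) (f : ℝ → ℝ × ℝ → ℝ) : Prop :=
  ∃ C : ℝ, 0 ≤ C ∧ ∀ t, 1 ≤ t → ∀ z : ℝ × ℝ, |f t z| ≤ C * t ^ e ∧
    (f t z ≠ 0 → |z.1| ≤ 2 * t ^ m ∧ |z.2| ≤ 2 * t ^ n)

theorem IsTame.add {f g : ℝ → ℝ × ℝ → ℝ} (hf : IsTame m n e f) (hg : IsTame m n e g) :
    IsTame m n e fun t z => f t z + g t z := by
  obtain ⟨C, hC, h⟩ := hf
  obtain ⟨D, hD, k⟩ := hg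
  refine ⟨C + D, add_nonneg hC hD, fun t ht z => ⟨?_, fun hne => ?_⟩⟩
  · rw [add_mul]
    exact (abs_add_le _ _).trans (add_le_add (h t ht z).1 (k t ht z).1)
  · by_cases h0 : f t z = 0
    · exact (k t ht z).2 fun h1 => hne (by simp [h0, h1])
    · exact (h t ht z).2 h0

theorem IsTame.const_mul {f : ℝ → ℝ × ℝ → ℝ} (hf : IsTame m n e f) (c : ℝ) :
    IsTame m n e fun t z => c * f t z := by
  obtain ⟨C, hC, h⟩ := hf
  refine ⟨|c| * C, by positivity, fun t ht z => ⟨?_, fun hne => ?_⟩⟩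
  · rw [abs_mul, mul_assoc]
    exact mul_le_mul_of_nonneg_left (h t ht z).1 (abs_nonneg c)
  · exact (h t ht z).2 (right_ne_zero_of_mul hne)

theorem IsTame.mono {f : ℝ → ℝ × ℝ → ℝ} (hf : IsTame m n e f) {e' : ℝ} (he : e ≤ e') :
    IsTame m n e' f := by
  obtain ⟨C, hC, h⟩ := hf
  refine ⟨C, hC, fun t ht z => ⟨(h t ht z).1.trans ?_, (h t ht z).2⟩⟩
  exact mul_le_mul_of_nonneg_left (Real.rpow_le_rpow_of_exponent_le ht he) hC

theorem scaled_isTame (hp : ∃ B, ∀ x, |p x| ≤ B) (hq : ∃ B, ∀ x, |q x| ≤ B)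
    (hs : ∃ B, ∀ x, |s x| ≤ B) (hq0 : ∀ x, 2 < |x| → q x = 0) (hs0 : ∀ x, 2 < |x| → s x = 0) :
    IsTame m n e (scaled b m n e p q s) := by
  obtain ⟨B, hB⟩ := hp
  obtain ⟨B', hB'⟩ := hq
  obtain ⟨B'', hB''⟩ := hs
  have b0 := (abs_nonneg _).trans (hB 0)
  have b0' := (abs_nonneg _).trans (hB' 0)
  have b0'' := (abs_nonneg _).trans (hB'' 0)
  have box : ∀ x c t : ℝ, 1 ≤ t → |x * t ^ (-c)| ≤ 2 → |x| ≤ 2 * t ^ c := fun x c t ht h => by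
    have hpos : 0 < t ^ c := Real.rpow_pos_of_pos (by linarith) c
    rwa [Real.rpow_neg (by linarith), ← div_eq_mul_inv, abs_div, abs_of_pos hpos,
      div_le_iff₀ hpos] at h
  refine ⟨B * B' * B'', by positivity, fun t ht z => ⟨?_, fun hne => ⟨?_, ?_⟩⟩⟩
  · have : 0 ≤ t ^ e := Real.rpow_nonneg (by linarith) e
    rw [scaled, abs_mul, abs_of_nonneg this, mul_comm, abs_mul, abs_mul]
    gcongr
    exacts [hB _, hB' _, hB'' _]
  · refine box _ _ _ ht (not_lt.1 fun h => hne ?_)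
    simp [scaled, hq0 _ h]
  · refine box _ _ _ ht (not_lt.1 fun h => hne ?_)
    simp [scaled, hs0 _ h]

theorem IsTame.vanishesOutside {f : ℝ → ℝ × ℝ → ℝ} (hf : IsTame m n e f) {t : ℝ} (ht : 1 ≤ t) :
    VanishesOutside (max (2 * t ^ m) (2 * t ^ n)) (f t) := fun z hz => by
  obtain ⟨C, -, h⟩ := hf
  by_contra hne
  obtain ⟨h1, h2⟩ := (h t ht z).2 hne
  exact hz.not_ge (max_le_max h1 h2)

theorem IsTame.exists_sqrt_integral_sq_le {f : ℝ → ℝ × ℝ → ℝ} (hf : IsTame m n e f) :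
    ∃ C, ∀ t, 1 ≤ t → √(∫ z, f t z ^ 2) ≤ C * t ^ (e + (m + n) / 2) := by
  obtain ⟨C, hC, h⟩ := hf
  refine ⟨4 * C, fun t ht => ?_⟩
  have t0 : 0 < t := by linarith
  have tm := Real.rpow_pos_of_pos t0 m
  have tn := Real.rpow_pos_of_pos t0 n
  set K : Set (ℝ × ℝ) := Set.Icc (-(2 * t ^ m)) (2 * t ^ m) ×ˢ Set.Icc (-(2 * t ^ n)) (2 * t ^ n)
  have hK : MeasurableSet K := measurableSet_Icc.prod measurableSet_Icc
  have hvol : volume.real K = 16 * (t ^ m * t ^ n) := by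
    rw [Measure.volume_eq_prod, measureReal_prod_prod, Real.volume_real_Icc_of_le (by linarith),
      Real.volume_real_Icc_of_le (by linarith)]
    ring
  have hfin : volume K ≠ ⊤ :=
    (isCompact_Icc.prod isCompact_Icc : IsCompact K).measure_lt_top.ne
  have hle : ∫ z, f t z ^ 2 ≤ ∫ z, K.indicator (fun _ => (C * t ^ e) ^ 2) z := by
    refine integral_mono_of_nonneg (Eventually.of_forall fun z => sq_nonneg _)
      ((integrable_indicator_iff hK).2 (integrableOn_const hfin)) (Eventually.of_forall fun z => ?_)
    by_cases h0 : f t z = 0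
    · simp only [h0]
      refine (by norm_num : (0 : ℝ) ^ 2 ≤ 0).trans (Set.indicator_nonneg (fun _ _ => ?_) z)
      positivity
    · have hz := (h t ht z).2 h0
      have hzK : z ∈ K := Set.mk_mem_prod (Set.mem_Icc.2 (abs_le.1 hz.1))
        (Set.mem_Icc.2 (abs_le.1 hz.2))
      rw [Set.indicator_of_mem hzK]
      exact sq_le_sq' (abs_le.1 (h t ht z).1).1 (abs_le.1 (h t ht z).1).2
  rw [integral_indicator hK, setIntegral_const, hvol, smul_eq_mul] at hle
  refine (Real.sqrt_le_sqrt hle).trans (Real.sqrt_le_iff.2 ⟨by positivity, le_of_eq ?_⟩)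
  have e2 : (t ^ ((m + n) / 2)) ^ 2 = t ^ m * t ^ n := by
    rw [← Real.rpow_natCast, ← Real.rpow_mul t0.le, ← Real.rpow_add t0]
    norm_num
  rw [Real.rpow_add t0, ← e2]
  ring

end scaled

/-- The weights of the virial argument: for `t ≥ 1` the weight `w` is compactly supported in space,
its `x`-derivative is a nonnegative main part `P`, bounded below by `t⁻¹` on
`{|x| ≤ t^b, |y| ≤ t^n}`, plus a remainder `N`, and all errors are `O(t^{-1-d})`. -/
structure IsVirialWeight (b n d C : ℝ) (w wt wx wy wxx wxy wyy wxxx wxyy P N : ℝ → ℝ × ℝ → ℝ) :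
    Prop where
  jet : ∀ t, 1 ≤ t → ZKJet (w t) (wx t) (wy t) (wxx t) (wxy t) (wyy t) (wxxx t) (wxyy t)
  hasDerivAt : ∀ t, 1 ≤ t → ∀ z, HasDerivAt (fun s => w s z) (wt t z) t
  continuous_wt : ∀ t, 1 ≤ t → Continuous (wt t)
  contDiff_wx : ∀ t, 1 ≤ t → ContDiff ℝ 1 (wx t)
  continuous_P : ∀ t, 1 ≤ t → Continuous (P t)
  vanishes : ∀ t, 1 ≤ t → ∃ R, VanishesOutside R (w t) ∧ VanishesOutside R (wt t)
    ∧ VanishesOutside R (P t)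
  wx_eq : ∀ t z, wx t z = P t z + N t z
  P_nonneg : ∀ t, 1 ≤ t → ∀ z, 0 ≤ P t z
  P_ge : ∀ t, 1 ≤ t → ∀ z : ℝ × ℝ, |z.1| ≤ t ^ b → |z.2| ≤ t ^ n → t⁻¹ ≤ P t z
  w_le : ∀ t, 1 ≤ t → ∀ z, |w t z| ≤ C
  N_le : ∀ t, 1 ≤ t → ∀ z, |N t z| ≤ C * t ^ (-1 - d)
  wt_le : ∀ t, 1 ≤ t → ∀ z, |wt t z| ≤ C * t ^ (-1 - d)
  wy_le : ∀ t, 1 ≤ t → ∀ z, |wy t z| ≤ C * t ^ (-1 - d)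
  wxx_le : ∀ t, 1 ≤ t → ∀ z, |wxx t z| ≤ C * t ^ (-1 - d)
  wxy_le : ∀ t, 1 ≤ t → ∀ z, |wxy t z| ≤ C * t ^ (-1 - d)
  lap_le : ∀ t, 1 ≤ t → ∀ z, |wxxx t z + wxyy t z| ≤ C * t ^ (-1 - d)
  w_l2 : ∀ t, 1 ≤ t → √(∫ z, w t z ^ 2) ≤ C
  lin_l2 : ∀ t, 1 ≤ t → √(∫ z, (wt t z + (wxxx t z + wxyy t z)) ^ 2) ≤ C * t ^ (-1 - d)

theorem exists_isVirialWeight {b m n : ℝ} (hb : 0 < b) (hbm : b < m) (hmn : m ≤ n)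
    (h4 : m + n < 4 * b) (h1 : b + (m + n) / 2 < 1) :
    ∃ d C : ℝ, 0 < d ∧ 0 ≤ C ∧ ∃ w wt wx wy wxx wxy wyy wxxx wxyy P N : ℝ → ℝ × ℝ → ℝ,
      IsVirialWeight b n d C w wt wx wy wxx wxy wyy wxxx wxyy P N := by
  obtain ⟨χ, cχ, χ0, χ1, hχ⟩ := exists_cutoff
  obtain ⟨ψ, cψ, dψ, bψ⟩ := exists_bounded_primitive cχ hχ
  have pχ := isProfile_of_vanishing cχ hχ
  have v1 := eq_zero_of_hasDerivAt_of_vanishing pχ.hasDerivAt hχ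
  have pχ1 := isProfile_of_vanishing (contDiff_infty_iff_deriv.1 cχ).2 v1
  have v2 := eq_zero_of_hasDerivAt_of_vanishing pχ1.hasDerivAt v1
  have pχ2 := isProfile_of_vanishing (contDiff_infty_iff_deriv.1 pχ1.smooth).2 v2
  have v3 := eq_zero_of_hasDerivAt_of_vanishing pχ2.hasDerivAt v2
  have pχ3 := isProfile_of_vanishing (contDiff_infty_iff_deriv.1 pχ2.smooth).2 v3
  set χ' := deriv χ
  set χ'' := deriv χ'
  set χ''' := deriv χ''
  have bθ : ∃ B, ∀ x, |x * χ x| ≤ B := exists_bound_of_vanishing (R := 2)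
    (continuous_id.mul cχ.continuous) fun x hx => by simp [hχ x hx]
  have vθ : ∀ x, 2 < |x| → x * χ' x = 0 := fun x hx => by rw [v1 x hx, mul_zero]
  have kψ := cψ.continuous
  have kχ := cχ.continuous
  have k1 := pχ1.smooth.continuous
  have k2 := pχ2.smooth.continuous
  have k3 := pχ3.smooth.continuous
  let S := scaled b m n
  let w := S (b - 1) ψ χ χ
  let wt := scaledT b m n (b - 1) ψ χ χ χ' χ χ'
  let P := S (-1) χ χ χ
  let N := S (b - 1 - m) ψ χ' χ
  let wx := fun t z => P t z + N t z
  let wy := S (b - 1 - n) ψ χ χ'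
  let wxx := fun t z => (S (-1 - b) χ' χ χ t z + S (-1 - m) χ χ' χ t z)
    + (S (b - 1 - m - b) χ χ' χ t z + S (b - 1 - m - m) ψ χ'' χ t z)
  let wxy := fun t z => S (-1 - n) χ χ χ' t z + S (b - 1 - m - n) ψ χ' χ' t z
  let wyy := S (b - 1 - n - n) ψ χ χ''
  let wxxx := fun t z => ((S (-1 - b - b) χ'' χ χ t z + S (-1 - b - m) χ' χ' χ t z)
      + (S (-1 - m - b) χ' χ' χ t z + S (-1 - m - m) χ χ'' χ t z))
    + ((S (b - 1 - m - b - b) χ' χ' χ t z + S (b - 1 - m - b - m) χ χ'' χ t z)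
      + (S (b - 1 - m - m - b) χ χ'' χ t z + S (b - 1 - m - m - m) ψ χ''' χ t z))
  let wxyy := fun t z => S (-1 - n - n) χ χ χ'' t z + S (b - 1 - m - n - n) ψ χ' χ'' t z
  obtain ⟨d, hd, hd1, hd2, hd3, hd4⟩ : ∃ d : ℝ, 0 < d ∧ d ≤ b ∧ d ≤ m - b
      ∧ d ≤ 1 - b - (m + n) / 2 ∧ d ≤ 2 * b - (m + n) / 2 := by
    refine ⟨min (min b (m - b)) (min (1 - b - (m + n) / 2) (2 * b - (m + n) / 2)), ?_, ?_⟩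
    · simp only [lt_min_iff]
      refine ⟨⟨hb, ?_⟩, ?_, ?_⟩ <;> linarith
    · simp
  have tame : ∀ {e p q s}, (∃ B, ∀ x, |p x| ≤ B) → (∃ B, ∀ x, |q x| ≤ B) → (∃ B, ∀ x, |s x| ≤ B) →
      (∀ x, 2 < |x| → q x = 0) → (∀ x, 2 < |x| → s x = 0) → ∀ e', e ≤ e' → IsTame m n e' (S e p q s) :=
    fun h1 h2 h3 h4 h5 _ he => (scaled_isTame h1 h2 h3 h4 h5).mono he
  have tw : IsTame m n (b - 1) w := tame bψ pχ.bounded pχ.bounded hχ hχ _ le_rfl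
  have tP : IsTame m n (-1) P := tame pχ.bounded pχ.bounded pχ.bounded hχ hχ _ le_rfl
  have tN : IsTame m n (-1 - d) N :=
    tame bψ pχ1.bounded pχ.bounded v1 hχ _ (by linarith)
  have twt : IsTame m n (b - 1 - 1) wt :=
    (((tame bψ pχ.bounded pχ.bounded hχ hχ _ le_rfl).const_mul _).add
      ((tame bθ pχ.bounded pχ.bounded hχ hχ _ le_rfl).const_mul _)).add
    (((tame bψ pχ.bounded_scaling pχ.bounded vθ hχ _ le_rfl).const_mul _).add
      ((tame bψ pχ.bounded pχ.bounded_scaling hχ vθ _ le_rfl).const_mul _))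
  have twy : IsTame m n (-1 - d) wy :=
    tame bψ pχ.bounded pχ1.bounded hχ v1 _ (by linarith)
  have twxx : IsTame m n (-1 - d) wxx :=
    ((tame pχ1.bounded pχ.bounded pχ.bounded hχ hχ _ (by linarith)).add
      (tame pχ.bounded pχ1.bounded pχ.bounded v1 hχ _ (by linarith))).add
    ((tame pχ.bounded pχ1.bounded pχ.bounded v1 hχ _ (by linarith)).add
      (tame bψ pχ2.bounded pχ.bounded v2 hχ _ (by linarith)))
  have twxy : IsTame m n (-1 - d) wxy :=
    (tame pχ.bounded pχ.bounded pχ1.bounded hχ v1 _ (by linarith)).add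
      (tame bψ pχ1.bounded pχ1.bounded v1 v1 _ (by linarith))
  have twxxx : IsTame m n (-1 - 2 * b) wxxx :=
    (((tame pχ2.bounded pχ.bounded pχ.bounded hχ hχ _ (by linarith)).add
      (tame pχ1.bounded pχ1.bounded pχ.bounded v1 hχ _ (by linarith))).add
    ((tame pχ1.bounded pχ1.bounded pχ.bounded v1 hχ _ (by linarith)).add
      (tame pχ.bounded pχ2.bounded pχ.bounded v2 hχ _ (by linarith)))).add
    (((tame pχ1.bounded pχ1.bounded pχ.bounded v1 hχ _ (by linarith)).add
      (tame pχ.bounded pχ2.bounded pχ.bounded v2 hχ _ (by linarith))).add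
    ((tame pχ.bounded pχ2.bounded pχ.bounded v2 hχ _ (by linarith)).add
      (tame bψ pχ3.bounded pχ.bounded v3 hχ _ (by linarith))))
  have twxyy : IsTame m n (-1 - 2 * b) wxyy :=
    (tame pχ.bounded pχ.bounded pχ2.bounded hχ v2 _ (by linarith)).add
      (tame bψ pχ1.bounded pχ2.bounded v1 v2 _ (by linarith))
  have tlap := twxxx.add twxyy
  have e1 : -1 - d - (m + n) / 2 ≤ -1 - d := by linarith
  have tlap' := tlap.mono (show -1 - 2 * b ≤ -1 - d - (m + n) / 2 by linarith)
  have twt' := twt.mono (show b - 1 - 1 ≤ -1 - d - (m + n) / 2 by linarith)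
  obtain ⟨C₁, -, H₁⟩ := tw.mono (show b - 1 ≤ 0 by linarith)
  obtain ⟨C₂, -, H₂⟩ := tN
  obtain ⟨C₃, -, H₃⟩ := twt'.mono e1
  obtain ⟨C₄, -, H₄⟩ := twy
  obtain ⟨C₅, -, H₅⟩ := twxx
  obtain ⟨C₆, -, H₆⟩ := twxy
  obtain ⟨C₇, -, H₇⟩ := tlap'.mono e1
  obtain ⟨C₈, H₈⟩ := (tw.mono (show b - 1 ≤ -((m + n) / 2) by linarith)).exists_sqrt_integral_sq_le
  obtain ⟨C₉, H₉⟩ := (twt'.add tlap').exists_sqrt_integral_sq_le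
  obtain ⟨C, hC0, hC⟩ : ∃ C : ℝ, 0 ≤ C ∧ ∀ c ∈ [C₁, C₂, C₃, C₄, C₅, C₆, C₇, C₈, C₉], c ≤ C := by
    refine ⟨|C₁| + |C₂| + |C₃| + |C₄| + |C₅| + |C₆| + |C₇| + |C₈| + |C₉|, by positivity, ?_⟩
    simp only [List.mem_cons, List.not_mem_nil, or_false, forall_eq_or_imp, forall_eq]
    have k := @le_abs_self ℝ _ _
    have k' := @abs_nonneg ℝ _ _ _
    refine ⟨?_, ?_, ?_, ?_, ?_, ?_, ?_, ?_, ?_⟩ <;>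
    linarith [k C₁, k C₂, k C₃, k C₄, k C₅, k C₆, k C₇, k C₈, k C₉, k' C₁, k' C₂, k' C₃, k' C₄, k' C₅,
      k' C₆, k' C₇, k' C₈, k' C₉]
  simp only [List.mem_cons, List.not_mem_nil, or_false, forall_eq_or_imp, forall_eq] at hC
  obtain ⟨hC₁, hC₂, hC₃, hC₄, hC₅, hC₆, hC₇, hC₈, hC₉⟩ := hC
  have up : ∀ {c t x : ℝ}, c ≤ C → 1 ≤ t → x ≤ c * t ^ (-1 - d) → x ≤ C * t ^ (-1 - d) :=
    fun hc ht hx => hx.trans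
      (mul_le_mul_of_nonneg_right hc (Real.rpow_nonneg (by linarith) _))
  refine ⟨d, C, hd, hC0, w, wt, wx, wy, wxx, wxy, wyy, wxxx, wxyy, P, N, ?_⟩
  have dχ := pχ.hasDerivAt
  have dχ1 := pχ1.hasDerivAt
  have dχ2 := pχ2.hasDerivAt
  refine
    { jet := fun t ht => ?_
      hasDerivAt := fun t ht z => scaled_hasDerivAt_time dψ dχ dχ (by linarith) z
      continuous_wt := fun t ht => ?_
      contDiff_wx := fun t ht => ?_
      continuous_P := fun t ht => scaled_continuous kχ kχ kχ t
      vanishes := fun t ht =>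
        ⟨_, tw.vanishesOutside ht, twt.vanishesOutside ht, tP.vanishesOutside ht⟩
      wx_eq := fun t z => rfl
      P_nonneg := fun t ht z => mul_nonneg (Real.rpow_nonneg (by linarith) _)
        (mul_nonneg (mul_nonneg (χ0 _) (χ0 _)) (χ0 _))
      P_ge := fun t ht z hz1 hz2 => ?_
      w_le := fun t ht z => by simpa using ((H₁ t ht z).1.trans (by simpa using hC₁))
      N_le := fun t ht z => up hC₂ ht (H₂ t ht z).1
      wt_le := fun t ht z => up hC₃ ht (H₃ t ht z).1
      wy_le := fun t ht z => up hC₄ ht (H₄ t ht z).1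
      wxx_le := fun t ht z => up hC₅ ht (H₅ t ht z).1
      wxy_le := fun t ht z => up hC₆ ht (H₆ t ht z).1
      lap_le := fun t ht z => up hC₇ ht (H₇ t ht z).1
      w_l2 := fun t ht => (H₈ t ht).trans (by simpa using hC₈)
      lin_l2 := fun t ht => up hC₉ ht (by simpa using H₉ t ht) }
  · have t0 : 0 < t := by linarith
    have cont : ∀ {e p q s}, Continuous p → Continuous q → Continuous s → Continuous (S e p q s t) :=
      fun h1 h2 h3 => scaled_continuous h1 h2 h3 t
    have X : ∀ {e p p' q q' s}, (∀ x, HasDerivAt p (p' x) x) → (∀ x, HasDerivAt q (q' x) x) →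
        ∀ e₁ e₂, e₁ = e - b → e₂ = e - m → HasPartialX (S e p q s t)
        (fun z => S e₁ p' q s t z + S e₂ p q' s t z) :=
      fun h1 h2 _ _ h3 h4 => scaled_hasPartialX h1 h2 h3 h4 t0
    have Y : ∀ {e p q s s'}, (∀ x, HasDerivAt s (s' x) x) → ∀ e₁, e₁ = e - n →
        HasPartialY (S e p q s t) (S e₁ p q s' t) :=
      fun h1 _ h2 => scaled_hasPartialY h1 h2 t0
    exact
      { c := cont kψ kχ kχ
        cx := (cont kχ kχ kχ).add (cont kψ k1 kχ)
        cy := cont kψ kχ k1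
        cxx := ((cont k1 kχ kχ).add (cont kχ k1 kχ)).add ((cont kχ k1 kχ).add (cont kψ k2 kχ))
        cxy := (cont kχ kχ k1).add (cont kψ k1 k1)
        cyy := cont kψ kχ k2
        cxxx := (((cont k2 kχ kχ).add (cont k1 k1 kχ)).add
          ((cont k1 k1 kχ).add (cont kχ k2 kχ))).add
          (((cont k1 k1 kχ).add (cont kχ k2 kχ)).add ((cont kχ k2 kχ).add (cont kψ k3 kχ)))
        cxyy := (cont kχ kχ k2).add (cont kψ k1 k2)
        dx := X dψ dχ _ _ (by ring) (by ring)
        dy := Y dχ _ (by ring)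
        dxx := (X dχ dχ _ _ (by ring) (by ring)).add (X dψ dχ1 _ _ (by ring) (by ring))
        dyx := X dψ dχ _ _ (by ring) (by ring)
        dxy := (Y dχ _ (by ring)).add (Y dχ _ (by ring))
        dyy := Y dχ1 _ (by ring)
        dxxx := ((X dχ1 dχ _ _ (by ring) (by ring)).add (X dχ dχ1 _ _ (by ring) (by ring))).add
          ((X dχ dχ1 _ _ (by ring) (by ring)).add (X dψ dχ2 _ _ (by ring) (by ring)))
        dyyx := X dψ dχ _ _ (by ring) (by ring)
        dxyy := (Y dχ1 _ (by ring)).add (Y dχ1 _ (by ring)) }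
  · exact ((continuous_const.mul (scaled_continuous kψ kχ kχ t)).add
      (continuous_const.mul (scaled_continuous (continuous_id.mul kχ) kχ kχ t))).add
      ((continuous_const.mul (scaled_continuous kψ (continuous_id.mul k1) kχ t)).add
      (continuous_const.mul (scaled_continuous kψ kχ (continuous_id.mul k1) t)))
  · have le1 : (1 : WithTop ℕ∞) ≤ ((⊤ : ℕ∞) : WithTop ℕ∞) := by exact_mod_cast le_top
    exact (scaled_contDiff (cχ.of_le le1) (cχ.of_le le1) (cχ.of_le le1) t).add
      (scaled_contDiff (cψ.of_le le1) (pχ1.smooth.of_le le1) (cχ.of_le le1) t)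
  · have t0 : 0 < t := by linarith
    have one : ∀ {x c c' : ℝ}, c' ≤ c → |x| ≤ t ^ c' → χ (x * t ^ (-c)) = 1 := fun hc hx => by
      refine χ1 _ ?_
      rw [abs_mul, Real.rpow_neg t0.le, abs_inv, abs_of_pos (Real.rpow_pos_of_pos t0 _),
        ← div_eq_mul_inv]
      exact div_le_one_of_le₀ (hx.trans (Real.rpow_le_rpow_of_exponent_le ht hc))
        (Real.rpow_nonneg t0.le _)
    refine le_of_eq ?_
    change t⁻¹ = t ^ (-1 : ℝ) * (χ (z.1 * t ^ (-b)) * χ (z.1 * t ^ (-m)) * χ (z.2 * t ^ (-n)))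
    rw [one le_rfl hz1, one hbm.le hz1, one le_rfl hz2, Real.rpow_neg_one]
    ring

theorem virial_pointwise {L e u a b P N wx wy l wt wxx wxy : ℝ} (hL : 0 ≤ L) (hx : wx = P + N)
    (hP : 0 ≤ P) (hN : |N| ≤ e) (hy : |wy| ≤ e) (hl : |l| ≤ e) (ht : |wt| ≤ e) (hxx : |wxx| ≤ e)
    (hxy : |wxy| ≤ e) :
    1 / 2 * ((u ^ 2 + a ^ 2 + b ^ 2) * P)
        - (7 + 4 * L + 4 * L ^ 2) * e * (u ^ 2 + a ^ 2 + b ^ 2) ≤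
      ((2 + 8 * L ^ 2) / 2 * (u ^ 2 * wx) - u ^ 2 * l + (3 * a ^ 2 + b ^ 2) * wx
        + 2 * (wy * (a * b)) - u ^ 2 * wt)
      - L * (2 * |u| * (|a| + |b|) * |wx| + u ^ 2 * (|wxx| + |wxy|)) := by
  have he : 0 ≤ e := (abs_nonneg _).trans hN
  have hwx : |wx| ≤ P + e := by
    rw [hx]
    exact (abs_add_le _ _).trans (add_le_add (abs_of_nonneg hP).le hN)
  obtain ⟨N1, N2⟩ := abs_le.1 hN
  obtain ⟨l1, l2⟩ := abs_le.1 hl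
  obtain ⟨t1, t2⟩ := abs_le.1 ht
  have hab : -(e * (a ^ 2 + b ^ 2)) ≤ 2 * (wy * (a * b)) := by
    have h1 : |wy * (a * b)| ≤ e * ((a ^ 2 + b ^ 2) / 2) := by
      rw [abs_mul]
      refine mul_le_mul hy ?_ (abs_nonneg _) he
      rw [abs_le]
      constructor <;> nlinarith [sq_nonneg (a + b), sq_nonneg (a - b)]
    linarith [(abs_le.1 h1).1]
  have hcross : |u| * (|a| + |b|) ≤ u ^ 2 + a ^ 2 + b ^ 2 := by
    rw [← sq_abs u, ← sq_abs a, ← sq_abs b]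
    nlinarith [sq_nonneg (|u| - |a|), sq_nonneg (|u| - |b|), sq_nonneg |a|, sq_nonneg |b|]
  have hcrossP : 2 * L * (|u| * (|a| + |b|)) ≤ 4 * L ^ 2 * u ^ 2 + (a ^ 2 + b ^ 2) / 2 := by
    rw [← sq_abs u, ← sq_abs a, ← sq_abs b]
    nlinarith [sq_nonneg (2 * L * |u| - |a|), sq_nonneg (2 * L * |u| - |b|)]
  have h0 : 0 ≤ |u| * (|a| + |b|) := by positivity
  have g1 : L * (2 * |u| * (|a| + |b|) * |wx|) ≤
      (4 * L ^ 2 * u ^ 2 + (a ^ 2 + b ^ 2) / 2) * P + 2 * L * e * (u ^ 2 + a ^ 2 + b ^ 2) :=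
    calc L * (2 * |u| * (|a| + |b|) * |wx|) = 2 * L * (|u| * (|a| + |b|)) * |wx| := by ring
      _ ≤ 2 * L * (|u| * (|a| + |b|)) * (P + e) := by gcongr
      _ = 2 * L * (|u| * (|a| + |b|)) * P + 2 * L * e * (|u| * (|a| + |b|)) := by ring
      _ ≤ _ := by gcongr
  have g2 : L * (u ^ 2 * (|wxx| + |wxy|)) ≤ L * (u ^ 2 * (e + e)) := by gcongr
  have g3 : -(e * u ^ 2) ≤ u ^ 2 * N := by
    linarith [mul_le_mul_of_nonneg_left N1 (sq_nonneg u)]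
  have g3' : -(L ^ 2 * (e * u ^ 2)) ≤ L ^ 2 * (u ^ 2 * N) := by
    linarith [mul_le_mul_of_nonneg_left g3 (sq_nonneg L)]
  have g4 : -(e * (3 * a ^ 2 + b ^ 2)) ≤ (3 * a ^ 2 + b ^ 2) * N := by
    linarith [mul_le_mul_of_nonneg_left N1 (show 0 ≤ 3 * a ^ 2 + b ^ 2 by positivity)]
  have g5 : u ^ 2 * l ≤ e * u ^ 2 := by
    linarith [mul_le_mul_of_nonneg_left l2 (sq_nonneg u)]
  have g6 : u ^ 2 * wt ≤ e * u ^ 2 := by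
    linarith [mul_le_mul_of_nonneg_left t2 (sq_nonneg u)]
  have n1 : 0 ≤ e * u ^ 2 := by positivity
  have n2 : 0 ≤ e * a ^ 2 := by positivity
  have n3 : 0 ≤ e * b ^ 2 := by positivity
  have n4 : 0 ≤ L * (e * a ^ 2) := by positivity
  have n5 : 0 ≤ L * (e * b ^ 2) := by positivity
  have n6 : 0 ≤ L ^ 2 * (e * a ^ 2) := by positivity
  have n7 : 0 ≤ L ^ 2 * (e * b ^ 2) := by positivity
  have n8 : 0 ≤ u ^ 2 * P := by positivity
  have n9 : 0 ≤ a ^ 2 * P := by positivity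
  have n10 : 0 ≤ L ^ 2 * (e * u ^ 2) := by positivity
  subst hx
  linarith

theorem exists_virial_lower_bound (M : ℝ) :
    ∃ A C : ℝ, 0 ≤ A ∧ 0 ≤ C ∧ ∀ (R e : ℝ)
      (u ux uy uxx uxy uyy uxxx uxyy w wt wx wy wxx wxy wyy wxxx wxyy P N : ℝ × ℝ → ℝ),
      ZKJet u ux uy uxx uxy uyy uxxx uxyy → ZKJet w wx wy wxx wxy wyy wxxx wxyy →
      ContDiff ℝ 1 u → ContDiff ℝ 1 wx → Continuous wt → Continuous P →
      VanishesOutside R w → VanishesOutside R wt → VanishesOutside R P →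
      (∀ p, wx p = P p + N p) → (∀ p, 0 ≤ P p) → (∀ p, |N p| ≤ e) → (∀ p, |wt p| ≤ e) →
      (∀ p, |wy p| ≤ e) → (∀ p, |wxx p| ≤ e) → (∀ p, |wxy p| ≤ e) →
      (∀ p, |wxxx p + wxyy p| ≤ e) → √(∫ p, (wt p + (wxxx p + wxyy p)) ^ 2) ≤ e →
      Integrable (fun p => u p ^ 2) → Integrable (fun p => ux p ^ 2) →
      Integrable (fun p => uy p ^ 2) →
      √(∫ p, u p ^ 2) ≤ M → ∫ p, (u p ^ 2 + ux p ^ 2 + uy p ^ 2) ≤ 3 * M ^ 2 →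
      1 / 2 * (∫ p, (u p ^ 2 + ux p ^ 2 + uy p ^ 2) * P p) - C * e ≤
        (∫ p, (A - 2 * u p) * w p * (-(uxxx p + uxyy p + u p * ux p)))
          + ∫ p, (A * u p - u p ^ 2) * wt p := by
  obtain ⟨G, hG, hcube⟩ := exists_abs_integral_cube_mul_le
  set L := 2 / 3 * (G * |M|) with hLdef
  have hL : 0 ≤ L := by positivity
  refine ⟨2 + 8 * L ^ 2, (2 + 8 * L ^ 2) * |M| + (7 + 4 * L + 4 * L ^ 2) * (3 * M ^ 2),
    by positivity, by positivity, ?_⟩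
  intro R e u ux uy uxx uxy uyy uxxx uxyy w wt wx wy wxx wxy wyy wxxx wxyy P N hu hw du dwx cwt cP
    vw vwt vP hwx hP hN hwt hwy hwxx hwxy hlap hlin iu iux iuy hM hS
  have hcub := hcube R |M| u ux uy wx wxx wxy du dwx (hw.dx.vanishesOutside vw) hu.cx hu.cy hw.cxx
    hw.cxy hu.dx hu.dy hw.dxx hw.dxy iu (hM.trans (le_abs_self M))
  have hlin' := abs_integral_mul_le_sqrt_mul_sqrt (μ := volume) (f := u)
    (g := fun p => wt p + (wxxx p + wxyy p))
  rw [virial_identity hu hw vw]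
  have he : 0 ≤ e := (abs_nonneg _).trans (hN 0)
  obtain ⟨c, cx, cy, cxx, cxy, cyy, cxxx, cxyy, -⟩ := hu
  obtain ⟨d, ex, ey, exx, exy, -, exxx, exyy, fx, fy, fxx, fyx, fxy, -, fxxx, -, fxyy⟩ := hw
  have sx := fx.vanishesOutside vw
  have sy := fy.vanishesOutside vw
  have sxx := fxx.vanishesOutside sx
  have sxy := fyx.vanishesOutside sy
  have sxxx := fxxx.vanishesOutside sxx
  have sxyy := fxyy.vanishesOutside sxy
  have hlin'' : |∫ p, u p * (wt p + (wxxx p + wxyy p))| ≤ |M| * e :=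
    (hlin' c.aestronglyMeasurable (by fun_prop : Continuous _).aestronglyMeasurable iu
      (VanishesOutside.integrable (R := R)
        (fun p hp => by simp [vwt p hp, sxxx p hp, sxyy p hp]) (by fun_prop))).trans
    (mul_le_mul (hM.trans (le_abs_self M)) hlin (Real.sqrt_nonneg _) (abs_nonneg M))
  have iSP : Integrable fun p => (u p ^ 2 + ux p ^ 2 + uy p ^ 2) * P p :=
    VanishesOutside.integrable (R := R) (fun p hp => by simp [vP p hp]) (by fun_prop)
  have iS : Integrable fun p => u p ^ 2 + ux p ^ 2 + uy p ^ 2 := (iu.add iux).add iuy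
  have iQ : Integrable fun p => (2 + 8 * L ^ 2) / 2 * (u p ^ 2 * wx p)
      - u p ^ 2 * (wxxx p + wxyy p) + (3 * ux p ^ 2 + uy p ^ 2) * wx p
      + 2 * (wy p * (ux p * uy p)) - u p ^ 2 * wt p :=
    VanishesOutside.integrable (R := R) (fun p hp => by
      simp [vwt p hp, sx p hp, sy p hp, sxxx p hp, sxyy p hp]) (by fun_prop)
  have iG : Integrable fun p => 2 * |u p| * (|ux p| + |uy p|) * |wx p|
      + u p ^ 2 * (|wxx p| + |wxy p|) :=
    VanishesOutside.integrable (R := R) (fun p hp => by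
      simp [sx p hp, sxx p hp, sxy p hp]) (by fun_prop)
  have iU : Integrable fun p => u p * (wt p + (wxxx p + wxyy p)) :=
    VanishesOutside.integrable (R := R)
      (fun p hp => by simp [vwt p hp, sxxx p hp, sxyy p hp]) (by fun_prop)
  have split : (∫ p, ((2 + 8 * L ^ 2) * (u p * (wxxx p + wxyy p))
        + (2 + 8 * L ^ 2) / 2 * (u p ^ 2 * wx p)
        - u p ^ 2 * (wxxx p + wxyy p) + (3 * ux p ^ 2 + uy p ^ 2) * wx p
        + 2 * (wy p * (ux p * uy p)))) + ∫ p, ((2 + 8 * L ^ 2) * u p - u p ^ 2) * wt p =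
      (2 + 8 * L ^ 2) * (∫ p, u p * (wt p + (wxxx p + wxyy p)))
      + ∫ p, ((2 + 8 * L ^ 2) / 2 * (u p ^ 2 * wx p)
      - u p ^ 2 * (wxxx p + wxyy p) + (3 * ux p ^ 2 + uy p ^ 2) * wx p
      + 2 * (wy p * (ux p * uy p)) - u p ^ 2 * wt p) := by
    rw [← integral_const_mul, ← integral_add (iU.const_mul _) iQ, ← integral_add]
    · refine integral_congr_ae (Eventually.of_forall fun p => ?_)
      ring
    · exact VanishesOutside.integrable (R := R)
        (fun p hp => by simp [sx p hp, sy p hp, sxxx p hp, sxyy p hp]) (by fun_prop)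
    · exact VanishesOutside.integrable (R := R) (fun p hp => by simp [vwt p hp]) (by fun_prop)
  have hpt := integral_mono ((iSP.const_mul (1 / 2)).sub
    (iS.const_mul ((7 + 4 * L + 4 * L ^ 2) * e))) (iQ.sub (iG.const_mul L))
    fun p => virial_pointwise hL (hwx p) (hP p) (hN p) (hwy p) (hlap p) (hwt p) (hwxx p) (hwxy p)
      (u := u p) (a := ux p) (b := uy p)
  rw [integral_sub' (iSP.const_mul (1 / 2)) (iS.const_mul _), integral_sub' iQ (iG.const_mul L),
    integral_const_mul, integral_const_mul, integral_const_mul] at hpt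
  have hSe := mul_le_mul_of_nonneg_left hS
    (show 0 ≤ (7 + 4 * L + 4 * L ^ 2) * e by positivity)
  have hA := mul_le_mul_of_nonneg_left (abs_le.1 hlin'').1
    (show 0 ≤ 2 + 8 * L ^ 2 by positivity)
  have hc := mul_le_mul_of_nonneg_left ((le_abs_self _).trans hcub) (show (0 : ℝ) ≤ 2 / 3 by norm_num)
  rw [← mul_assoc, ← hLdef] at hc
  linarith

theorem not_bounded_of_deriv_ge_inv {F F' : ℝ → ℝ} {T c C d B : ℝ} (hT : 0 < T) (hc : 0 < c)
    (hC : 0 ≤ C) (hd : 0 < d) (hF : ∀ t, T ≤ t → HasDerivAt F (F' t) t)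
    (hF' : ∀ t, T ≤ t → c * t⁻¹ - C * t ^ (-1 - d) ≤ F' t) : ¬∀ t, T ≤ t → F t ≤ B := by
  intro hB
  set H : ℝ → ℝ := fun t => F t - c * Real.log t - C / d * t ^ (-d) with hH
  have hder : ∀ t, T ≤ t → HasDerivAt H (F' t - c * t⁻¹ - C / d * (-d * t ^ (-d - 1))) t :=
    fun t ht =>
    ((hF t ht).sub ((Real.hasDerivAt_log (by linarith)).const_mul c)).sub
      ((Real.hasDerivAt_rpow_const (Or.inl (by linarith))).const_mul (C / d))
  have hmono : MonotoneOn H (Set.Ici T) := by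
    refine monotoneOn_of_deriv_nonneg (convex_Ici T)
      (fun t ht => (hder t ht).continuousAt.continuousWithinAt)
      (fun t ht => (hder t (interior_subset ht)).differentiableAt.differentiableWithinAt)
      fun t ht => ?_
    have ht' : T ≤ t := interior_subset ht
    rw [(hder t ht').deriv]
    have h1 := hF' t ht'
    have h2 : C / d * (-d * t ^ (-d - 1)) = -(C * t ^ (-1 - d)) := by
      rw [show -d - 1 = -1 - d by ring]
      field_simp
    linarith
  obtain ⟨t, ht1, ht2⟩ := ((Real.tendsto_log_atTop.eventually_gt_atTop ((B - H T) / c)).and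
    (eventually_ge_atTop T)).exists
  have h1 := hmono (Set.mem_Ici.2 le_rfl) (Set.mem_Ici.2 ht2) ht2
  have h2 : 0 ≤ C / d * t ^ (-d) :=
    mul_nonneg (div_nonneg hC hd.le) (Real.rpow_nonneg (by linarith) _)
  have h3 : (B - H T) < Real.log t * c := (div_lt_iff₀ hc).1 ht1
  have h4 : H t = F t - c * Real.log t - C / d * t ^ (-d) := rfl
  linarith [hB t ht2]

/-- Joint smoothness in time and space of a curried function. -/
def IsSmooth2 (v : ℝ → ℝ → ℝ → ℝ) : Prop :=
  ContDiff ℝ (⊤ : ℕ∞) (fun p : ℝ × ℝ × ℝ => v p.1 p.2.1 p.2.2)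

namespace IsSmooth2

variable {v : ℝ → ℝ → ℝ → ℝ}

theorem hasFDerivAt (h : IsSmooth2 v) (p : ℝ × ℝ × ℝ) :
    HasFDerivAt (fun p : ℝ × ℝ × ℝ => v p.1 p.2.1 p.2.2)
      (fderiv ℝ (fun p : ℝ × ℝ × ℝ => v p.1 p.2.1 p.2.2) p) p :=
  (ContDiff.differentiable h (by simp) p).hasFDerivAt

theorem hasDerivAt_fderiv_t (h : IsSmooth2 v) (t x y : ℝ) : HasDerivAt (fun s => v s x y)
    (fderiv ℝ (fun p : ℝ × ℝ × ℝ => v p.1 p.2.1 p.2.2) (t, x, y) (1, 0, 0)) t :=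
  HasFDerivAt.comp_hasDerivAt (f := fun s : ℝ => (s, x, y)) t (h.hasFDerivAt (t, x, y))
    ((hasDerivAt_id t).prodMk ((hasDerivAt_const t x).prodMk (hasDerivAt_const t y)))

theorem hasDerivAt_fderiv_x (h : IsSmooth2 v) (t x y : ℝ) : HasDerivAt (fun a => v t a y)
    (fderiv ℝ (fun p : ℝ × ℝ × ℝ => v p.1 p.2.1 p.2.2) (t, x, y) (0, 1, 0)) x :=
  HasFDerivAt.comp_hasDerivAt (f := fun s : ℝ => (t, s, y)) x (h.hasFDerivAt (t, x, y))
    ((hasDerivAt_const x t).prodMk ((hasDerivAt_id x).prodMk (hasDerivAt_const x y)))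

theorem hasDerivAt_fderiv_y (h : IsSmooth2 v) (t x y : ℝ) : HasDerivAt (fun a => v t x a)
    (fderiv ℝ (fun p : ℝ × ℝ × ℝ => v p.1 p.2.1 p.2.2) (t, x, y) (0, 0, 1)) y :=
  HasFDerivAt.comp_hasDerivAt (f := fun s : ℝ => (t, x, s)) y (h.hasFDerivAt (t, x, y))
    ((hasDerivAt_const y t).prodMk ((hasDerivAt_const y x).prodMk (hasDerivAt_id y)))

theorem pt2_eq (h : IsSmooth2 v) (p : ℝ × ℝ × ℝ) : pt2 v p.1 p.2.1 p.2.2 =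
    fderiv ℝ (fun p : ℝ × ℝ × ℝ => v p.1 p.2.1 p.2.2) p (1, 0, 0) :=
  (h.hasDerivAt_fderiv_t _ _ _).deriv

theorem px2_eq (h : IsSmooth2 v) (p : ℝ × ℝ × ℝ) : px2 v p.1 p.2.1 p.2.2 =
    fderiv ℝ (fun p : ℝ × ℝ × ℝ => v p.1 p.2.1 p.2.2) p (0, 1, 0) :=
  (h.hasDerivAt_fderiv_x _ _ _).deriv

theorem py2_eq (h : IsSmooth2 v) (p : ℝ × ℝ × ℝ) : py2 v p.1 p.2.1 p.2.2 =
    fderiv ℝ (fun p : ℝ × ℝ × ℝ => v p.1 p.2.1 p.2.2) p (0, 0, 1) :=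
  (h.hasDerivAt_fderiv_y _ _ _).deriv

theorem fderiv_apply (h : IsSmooth2 v) (e : ℝ × ℝ × ℝ) : ContDiff ℝ (⊤ : ℕ∞)
    (fun p => fderiv ℝ (fun p : ℝ × ℝ × ℝ => v p.1 p.2.1 p.2.2) p e) :=
  (ContDiff.fderiv_right (m := ((⊤ : ℕ∞) : WithTop ℕ∞)) h (by simp)).clm_apply contDiff_const

theorem pt2 (h : IsSmooth2 v) : IsSmooth2 (pt2 v) := by
  rw [IsSmooth2, funext h.pt2_eq]
  exact h.fderiv_apply (1, 0, 0)

theorem px2 (h : IsSmooth2 v) : IsSmooth2 (px2 v) := by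
  rw [IsSmooth2, funext h.px2_eq]
  exact h.fderiv_apply (0, 1, 0)

theorem py2 (h : IsSmooth2 v) : IsSmooth2 (py2 v) := by
  rw [IsSmooth2, funext h.py2_eq]
  exact h.fderiv_apply (0, 0, 1)

theorem slice (h : IsSmooth2 v) (t : ℝ) :
    ContDiff ℝ (⊤ : ℕ∞) (fun p : ℝ × ℝ => v t p.1 p.2) :=
  ContDiff.comp h (contDiff_const.prodMk contDiff_id)

theorem hasDerivAt_t (h : IsSmooth2 v) (t x y : ℝ) :
    HasDerivAt (fun s => v s x y) (_root_.pt2 v t x y) t :=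
  (h.hasDerivAt_fderiv_t t x y).differentiableAt.hasDerivAt

theorem hasPartialX (h : IsSmooth2 v) (t : ℝ) :
    HasPartialX (fun p => v t p.1 p.2) (fun p => _root_.px2 v t p.1 p.2) :=
  fun p => (h.hasDerivAt_fderiv_x t p.1 p.2).differentiableAt.hasDerivAt

theorem hasPartialY (h : IsSmooth2 v) (t : ℝ) :
    HasPartialY (fun p => v t p.1 p.2) (fun p => _root_.py2 v t p.1 p.2) :=
  fun p => (h.hasDerivAt_fderiv_y t p.1 p.2).differentiableAt.hasDerivAt

theorem px2_py2_comm (h : IsSmooth2 v) : _root_.px2 (_root_.py2 v) = _root_.py2 (_root_.px2 v) := by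
  funext t x y
  have hs : IsSymmSndFDerivAt ℝ (fun p : ℝ × ℝ × ℝ => v p.1 p.2.1 p.2.2) (t, x, y) :=
    (ContDiff.contDiffAt h).isSymmSndFDerivAt (by
      rw [minSmoothness_of_isRCLikeNormedField]
      exact WithTop.coe_le_coe.2 le_top)
  have hd : DifferentiableAt ℝ (fderiv ℝ (fun p : ℝ × ℝ × ℝ => v p.1 p.2.1 p.2.2)) (t, x, y) :=
    (ContDiff.fderiv_right (m := ((⊤ : ℕ∞) : WithTop ℕ∞)) h (by simp)).differentiable
      (by simp) _
  have key : ∀ e e' : ℝ × ℝ × ℝ,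
      fderiv ℝ (fun p => fderiv ℝ (fun p : ℝ × ℝ × ℝ => v p.1 p.2.1 p.2.2) p e) (t, x, y) e' =
      fderiv ℝ (fderiv ℝ (fun p : ℝ × ℝ × ℝ => v p.1 p.2.1 p.2.2)) (t, x, y) e' e := fun e e' => by
    rw [fderiv_clm_apply hd (differentiableAt_const e)]
    simp
  rw [h.py2.px2_eq (t, x, y), h.px2.py2_eq (t, x, y), funext h.py2_eq, funext h.px2_eq, key, key]
  exact hs _ _

theorem jet (h : IsSmooth2 v) (t : ℝ) :
    ZKJet (fun p => v t p.1 p.2) (fun p => _root_.px2 v t p.1 p.2)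
      (fun p => _root_.py2 v t p.1 p.2) (fun p => _root_.px2 (_root_.px2 v) t p.1 p.2)
      (fun p => _root_.px2 (_root_.py2 v) t p.1 p.2) (fun p => _root_.py2 (_root_.py2 v) t p.1 p.2)
      (fun p => _root_.px2 (_root_.px2 (_root_.px2 v)) t p.1 p.2)
      (fun p => _root_.px2 (_root_.py2 (_root_.py2 v)) t p.1 p.2) where
  c := (h.slice t).continuous
  cx := (h.px2.slice t).continuous
  cy := (h.py2.slice t).continuous
  cxx := (h.px2.px2.slice t).continuous
  cxy := (h.py2.px2.slice t).continuous
  cyy := (h.py2.py2.slice t).continuous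
  cxxx := (h.px2.px2.px2.slice t).continuous
  cxyy := (h.py2.py2.px2.slice t).continuous
  dx := h.hasPartialX t
  dy := h.hasPartialY t
  dxx := h.px2.hasPartialX t
  dyx := h.py2.hasPartialX t
  dxy := by rw [h.px2_py2_comm]; exact h.px2.hasPartialY t
  dyy := h.py2.hasPartialY t
  dxxx := h.px2.px2.hasPartialX t
  dyyx := h.py2.py2.hasPartialX t
  dxyy := by rw [h.py2.px2_py2_comm]; exact h.py2.px2.hasPartialY t

end IsSmooth2

namespace IsAdmissibleZK2

variable {u : ℝ → ℝ → ℝ → ℝ}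

theorem pt2_eq (hu : IsAdmissibleZK2 u) {t : ℝ} (ht : 2 ≤ t) (x y : ℝ) :
    pt2 u t x y = -(px2 (px2 (px2 u)) t x y + px2 (py2 (py2 u)) t x y
      + u t x y * px2 u t x y) := by
  have hs : IsSmooth2 u := hu.smooth
  have e := hu.eqn t x y ht
  have hd : px2 (fun t' x' y' => px2 (px2 u) t' x' y' + py2 (py2 u) t' x' y') t x y =
      px2 (px2 (px2 u)) t x y + px2 (py2 (py2 u)) t x y :=
    ((hs.px2.px2.hasPartialX t (x, y)).add (hs.py2.py2.hasPartialX t (x, y))).deriv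
  rw [hd] at e
  linarith

theorem exists_bound (hu : IsAdmissibleZK2 u) (l : List (Fin 3)) {a : ℝ} (b : ℝ) (ha : 2 ≤ a) :
    ∃ K, 0 ≤ K ∧ ∀ t ∈ Set.Icc a b, ∀ p : ℝ × ℝ,
      |D2 u l t p.1 p.2| ≤ K * (1 + ‖p‖) ^ (-3 : ℝ) := by
  obtain ⟨K, hK⟩ := hu.decay l 3 a b ha
  refine ⟨|K|, abs_nonneg K, fun t ht p => ?_⟩
  have hp : (0 : ℝ) < 1 + ‖p‖ := by positivity
  have hle : 1 + ‖p‖ ≤ 1 + |p.1| + |p.2| := by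
    have : ‖p‖ ≤ |p.1| + |p.2| := max_le (by simp) (by simp)
    linarith
  rw [Real.rpow_neg hp.le, ← div_eq_mul_inv, le_div_iff₀ (Real.rpow_pos_of_pos hp _), mul_comm,
    show (3 : ℝ) = (3 : ℕ) by norm_num, Real.rpow_natCast]
  calc (1 + ‖p‖) ^ 3 * |D2 u l t p.1 p.2|
      ≤ (1 + |p.1| + |p.2|) ^ 3 * |D2 u l t p.1 p.2| := by gcongr
    _ ≤ |K| := (hK t p.1 p.2 ht).trans (le_abs_self K)

end IsAdmissibleZK2

theorem integrable_bracket : Integrable fun p : ℝ × ℝ => (1 + ‖p‖) ^ (-3 : ℝ) :=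
  integrable_one_add_norm (by norm_num)

theorem bracket_le_one (p : ℝ × ℝ) : (1 + ‖p‖) ^ (-3 : ℝ) ≤ 1 :=
  Real.rpow_le_one_of_one_le_of_nonpos (by linarith [norm_nonneg p]) (by norm_num)

theorem bracket_nonneg (p : ℝ × ℝ) : 0 ≤ (1 + ‖p‖) ^ (-3 : ℝ) := by positivity

theorem integrable_sq_of_le_bracket {f : ℝ × ℝ → ℝ} {K : ℝ} (hf : Continuous f)
    (h : ∀ p, |f p| ≤ K * (1 + ‖p‖) ^ (-3 : ℝ)) : Integrable fun p => f p ^ 2 := by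
  refine (integrable_bracket.const_mul (K * K)).mono' (by fun_prop : Continuous _).aestronglyMeasurable
    (Eventually.of_forall fun p => ?_)
  have hK : 0 ≤ K * (1 + ‖p‖) ^ (-3 : ℝ) := (abs_nonneg _).trans (h p)
  rw [Real.norm_eq_abs, abs_pow, sq]
  refine (mul_le_mul (h p) (h p) (abs_nonneg _) hK).trans ?_
  calc K * (1 + ‖p‖) ^ (-3 : ℝ) * (K * (1 + ‖p‖) ^ (-3 : ℝ))
      = K * K * (1 + ‖p‖) ^ (-3 : ℝ) * (1 + ‖p‖) ^ (-3 : ℝ) := by ring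
    _ ≤ K * K * (1 + ‖p‖) ^ (-3 : ℝ) * 1 := by
        gcongr
        · exact mul_nonneg (mul_self_nonneg K) (bracket_nonneg p)
        · exact bracket_le_one p
    _ = _ := mul_one _

theorem hasDerivAt_virial {u : ℝ → ℝ → ℝ → ℝ} (hu : IsAdmissibleZK2 u)
    {w wt : ℝ → ℝ × ℝ → ℝ} {C : ℝ} (A : ℝ) (hw : ∀ t, 1 ≤ t → ∀ z, HasDerivAt (w · z) (wt t z) t)
    (cw : ∀ t, 1 ≤ t → Continuous (w t)) (cwt : ∀ t, 1 ≤ t → Continuous (wt t))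
    (vw : ∀ t, 1 ≤ t → ∃ R, VanishesOutside R (w t) ∧ VanishesOutside R (wt t))
    (bw : ∀ t, 1 ≤ t → ∀ z, |w t z| ≤ C) (bwt : ∀ t, 1 ≤ t → ∀ z, |wt t z| ≤ C)
    {t : ℝ} (ht : 2 < t) :
    HasDerivAt (fun s => ∫ p : ℝ × ℝ, (A * u s p.1 p.2 - u s p.1 p.2 ^ 2) * w s p)
      ((∫ p : ℝ × ℝ, (A - 2 * u t p.1 p.2) * w t p * pt2 u t p.1 p.2)
        + ∫ p : ℝ × ℝ, (A * u t p.1 p.2 - u t p.1 p.2 ^ 2) * wt t p) t := by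
  have hs : IsSmooth2 u := hu.smooth
  have cu : ∀ s, Continuous fun p : ℝ × ℝ => u s p.1 p.2 := fun s => (hs.slice s).continuous
  have cut : ∀ s, Continuous fun p : ℝ × ℝ => pt2 u s p.1 p.2 := fun s =>
    (hs.pt2.slice s).continuous
  obtain ⟨K₀, hK₀, k₀⟩ := hu.exists_bound [] (t + 1) le_rfl
  obtain ⟨K₁, hK₁, k₁⟩ := hu.exists_bound [0] (t + 1) le_rfl
  have hC : 0 ≤ C := (abs_nonneg _).trans (bw 1 le_rfl 0)
  have hnhds : Set.Ioo 2 (t + 1) ∈ nhds t := Ioo_mem_nhds ht (by linarith)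
  have cont1 : ∀ s, 1 ≤ s → Continuous fun p : ℝ × ℝ =>
      (A * u s p.1 p.2 - u s p.1 p.2 ^ 2) * w s p := fun s h1 => by
    have := cu s; have := cw s h1; fun_prop
  have cont2 : ∀ s, 1 ≤ s → Continuous fun p : ℝ × ℝ =>
      (A - 2 * u s p.1 p.2) * w s p * pt2 u s p.1 p.2 := fun s h1 => by
    have := cu s; have := cut s; have := cw s h1; fun_prop
  have cont3 : ∀ s, 1 ≤ s → Continuous fun p : ℝ × ℝ =>
      (A * u s p.1 p.2 - u s p.1 p.2 ^ 2) * wt s p := fun s h1 => by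
    have := cu s; have := cwt s h1; fun_prop
  have ht1 : 1 ≤ t := by linarith
  obtain ⟨R, vR, vRt⟩ := vw t ht1
  rw [← integral_add (VanishesOutside.integrable (R := R) (fun p hp => by simp [vR p hp])
      (cont2 t ht1)) (VanishesOutside.integrable (R := R) (fun p hp => by simp [vRt p hp])
      (cont3 t ht1))]
  refine (hasDerivAt_integral_of_dominated_loc_of_deriv_le (s := Set.Ioo 2 (t + 1))
    (bound := fun p => ((|A| + 2 * K₀) * C * K₁ + (|A| + K₀) * K₀ * C) * (1 + ‖p‖) ^ (-3 : ℝ))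
    (F' := fun s p => (A - 2 * u s p.1 p.2) * w s p * pt2 u s p.1 p.2
      + (A * u s p.1 p.2 - u s p.1 p.2 ^ 2) * wt s p)
    hnhds ?_ ?_ ?_ ?_ ?_ ?_).2
  · filter_upwards [hnhds] with s hs'
    exact (cont1 s (by linarith [hs'.1])).aestronglyMeasurable
  · exact VanishesOutside.integrable (R := R) (fun p hp => by simp [vR p hp]) (cont1 t ht1)
  · exact ((cont2 t ht1).add (cont3 t ht1)).aestronglyMeasurable
  · refine Eventually.of_forall fun p s hs' => ?_
    have h1 : 1 ≤ s := by linarith [hs'.1]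
    have hmem : s ∈ Set.Icc 2 (t + 1) := ⟨hs'.1.le, hs'.2.le⟩
    have b0 : |u s p.1 p.2| ≤ K₀ * (1 + ‖p‖) ^ (-3 : ℝ) := k₀ s hmem p
    have b1 : |pt2 u s p.1 p.2| ≤ K₁ * (1 + ‖p‖) ^ (-3 : ℝ) := k₁ s hmem p
    have b0' : |u s p.1 p.2| ≤ K₀ := b0.trans (mul_le_of_le_one_right hK₀ (bracket_le_one p))
    have g0 := bracket_nonneg p
    have i1 : |A - 2 * u s p.1 p.2| ≤ |A| + 2 * K₀ := by
      refine (abs_sub _ _).trans ?_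
      rw [abs_mul, abs_two]
      linarith
    have i2 : |A * u s p.1 p.2 - u s p.1 p.2 ^ 2| ≤ (|A| + K₀) * (K₀ * (1 + ‖p‖) ^ (-3 : ℝ)) := by
      rw [show A * u s p.1 p.2 - u s p.1 p.2 ^ 2 = (A - u s p.1 p.2) * u s p.1 p.2 by ring, abs_mul]
      refine mul_le_mul ((abs_sub _ _).trans (by linarith)) b0 (abs_nonneg _) (by positivity)
    calc ‖(A - 2 * u s p.1 p.2) * w s p * pt2 u s p.1 p.2
          + (A * u s p.1 p.2 - u s p.1 p.2 ^ 2) * wt s p‖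
        ≤ |A - 2 * u s p.1 p.2| * |w s p| * |pt2 u s p.1 p.2|
          + |A * u s p.1 p.2 - u s p.1 p.2 ^ 2| * |wt s p| := by
          rw [← abs_mul, ← abs_mul, ← abs_mul]
          exact abs_add_le _ _
      _ ≤ (|A| + 2 * K₀) * C * (K₁ * (1 + ‖p‖) ^ (-3 : ℝ))
          + (|A| + K₀) * (K₀ * (1 + ‖p‖) ^ (-3 : ℝ)) * C := by
          gcongr
          exacts [bw s h1 p, bwt s h1 p]
      _ = _ := by ring
  · exact integrable_bracket.const_mul _
  · refine Eventually.of_forall fun p s hs' => ?_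
    have du := hs.hasDerivAt_t s p.1 p.2
    refine (((du.const_mul A).sub (du.pow 2)).mul (hw s (by linarith [hs'.1]) p)).congr_deriv ?_
    simp only [Pi.sub_apply, Pi.pow_apply]
    push_cast
    ring


theorem IsVirialWeight.inv_mul_setIntegral_le {b n d C : ℝ} {w wt wx wy wxx wxy wyy wxxx wxyy P N : ℝ → ℝ × ℝ → ℝ}
    (hw : IsVirialWeight b n d C w wt wx wy wxx wxy wyy wxxx wxyy P N) {t : ℝ} (ht : 1 ≤ t)
    {S : ℝ × ℝ → ℝ} (cS : Continuous S) (hS : ∀ p, 0 ≤ S p) (iS : Integrable S) :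
    t⁻¹ * ∫ p in {q : ℝ × ℝ | |q.1| < t ^ b ∧ |q.2| < t ^ n}, S p ≤ ∫ p, S p * P t p := by
  obtain ⟨R, -, -, vP⟩ := hw.vanishes t ht
  have cP := hw.continuous_P t ht
  have iSP : Integrable fun p => S p * P t p :=
    VanishesOutside.integrable (R := R) (fun p hp => by simp [vP p hp]) (by fun_prop)
  have hmeas : MeasurableSet {q : ℝ × ℝ | |q.1| < t ^ b ∧ |q.2| < t ^ n} :=
    (measurableSet_lt measurable_fst.abs measurable_const).inter
      (measurableSet_lt measurable_snd.abs measurable_const)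
  rw [← integral_const_mul]
  refine (setIntegral_mono_on (iS.const_mul _).integrableOn iSP.integrableOn hmeas
    fun p hp => ?_).trans (setIntegral_le_integral iSP
      (Eventually.of_forall fun p => mul_nonneg (hS p) (hw.P_nonneg t ht p)))
  rw [mul_comm]
  exact mul_le_mul_of_nonneg_left (hw.P_ge t ht p hp.1.le hp.2.le) (hS p)

theorem liminf_eq_zero_of_frequently_lt {G : ℝ → ℝ} {B : ℝ} (h0 : ∀ t, 0 ≤ G t)
    (hB : ∀ᶠ t in atTop, G t ≤ B) (hG : ∀ c, 0 < c → ∃ᶠ t in atTop, G t < c) :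
    liminf G atTop = 0 := by
  refine le_antisymm (le_of_forall_pos_le_add fun c hc => ?_) ?_
  · rw [zero_add]
    exact liminf_le_of_frequently_le ((hG c hc).mono fun _ => le_of_lt)
      (isBoundedUnder_of ⟨0, h0⟩)
  · exact le_liminf_of_le (IsBoundedUnder.isCoboundedUnder_ge ⟨B, hB⟩)
      (Eventually.of_forall h0)

theorem virial_le {A K C M : ℝ} {u w : ℝ × ℝ → ℝ} (cu : Continuous u) (cw : Continuous w) {R : ℝ}
    (vw : VanishesOutside R w) (hA : 0 ≤ A) (hC : ∀ p, |w p| ≤ C) (hw : √(∫ p, w p ^ 2) ≤ C)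
    (iu : Integrable fun p => u p ^ 2) (hM : √(∫ p, u p ^ 2) ≤ M) (hK : ∫ p, u p ^ 2 ≤ K) :
    ∫ p, (A * u p - u p ^ 2) * w p ≤ A * (M * C) + C * K := by
  have hC0 : 0 ≤ C := (abs_nonneg _).trans (hC 0)
  have i1 : Integrable fun p => u p * w p :=
    VanishesOutside.integrable (R := R) (fun p hp => by simp [vw p hp]) (by fun_prop)
  have i2 : Integrable fun p => w p ^ 2 :=
    VanishesOutside.integrable (R := R) (fun p hp => by simp [vw p hp]) (by fun_prop)
  have i3 : Integrable fun p => (A * u p - u p ^ 2) * w p :=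
    VanishesOutside.integrable (R := R) (fun p hp => by simp [vw p hp]) (by fun_prop)
  calc ∫ p, (A * u p - u p ^ 2) * w p
      ≤ ∫ p, (A * (u p * w p) + C * u p ^ 2) := by
        refine integral_mono i3 ((i1.const_mul A).add (iu.const_mul C)) fun p => ?_
        have := mul_le_mul_of_nonneg_left (abs_le.1 (hC p)).1 (sq_nonneg (u p))
        simp only
        linarith
    _ = A * (∫ p, u p * w p) + C * ∫ p, u p ^ 2 := by
        rw [integral_add (i1.const_mul A) (iu.const_mul C), integral_const_mul,
          integral_const_mul]
    _ ≤ A * (M * C) + C * K := by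
        have := (le_abs_self _).trans (abs_integral_mul_le_sqrt_mul_sqrt (μ := volume)
          cu.aestronglyMeasurable cw.aestronglyMeasurable iu i2)
        gcongr
        exact this.trans (mul_le_mul hM hw (Real.sqrt_nonneg _) ((Real.sqrt_nonneg _).trans hM))

/-- Local `H¹` decay for 2D ZK: for `1 < r < 3`,
`liminf_{t→∞} ∫_{Ω(t)} (u² + (∂ₓu)² + (∂ᵧu)²) dxdy = 0` where
`Ω(t) = {(x,y) : |x| < t^b, |y| < t^{br}}`. -/
theorem zk2_H1_liminf_decay
    (r b : ℝ) (hr₁ : 1 < r) (hr₂ : r < 3) (hb₁ : 0 < b) (hb₂ : b < 2/(3+r))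
    (u : ℝ → ℝ → ℝ → ℝ) (hu : IsAdmissibleZK2 u)
    (hH1 : ∃ C : ℝ, ∀ t : ℝ, 2 ≤ t →
      Real.sqrt (∫ p : ℝ × ℝ, (u t p.1 p.2)^2)
        + Real.sqrt (∫ p : ℝ × ℝ, (px2 u t p.1 p.2)^2)
        + Real.sqrt (∫ p : ℝ × ℝ, (py2 u t p.1 p.2)^2) ≤ C) :
    Filter.liminf
      (fun t : ℝ =>
        ∫ p in {q : ℝ × ℝ | |q.1| < t ^ b ∧ |q.2| < t ^ (b*r)},
          ((u t p.1 p.2)^2 + (px2 u t p.1 p.2)^2 + (py2 u t p.1 p.2)^2))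
      Filter.atTop = 0 := by
  rw [lt_div_iff₀ (by linarith)] at hb₂
  obtain ⟨m, hbm, hm⟩ : ∃ m, b < m ∧ m < min (b * r) (min (4 * b - b * r) (2 - 2 * b - b * r)) :=
    exists_between (lt_min (by nlinarith) (lt_min (by nlinarith) (by linarith)))
  rw [lt_min_iff, lt_min_iff] at hm
  obtain ⟨d, C, hd, hC, w, wt, wx, wy, wxx, wxy, wyy, wxxx, wxyy, P, N, hw⟩ :=
    exists_isVirialWeight hb₁ hbm hm.1.le (by linarith) (by linarith)
  obtain ⟨M, hM⟩ := hH1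
  obtain ⟨A, C', hA, hC', hlower⟩ := exists_virial_lower_bound M
  have hs : IsSmooth2 u := hu.smooth
  have cu : ∀ t, Continuous fun p : ℝ × ℝ => u t p.1 p.2 := fun t => (hs.slice t).continuous
  have cx : ∀ t, Continuous fun p : ℝ × ℝ => px2 u t p.1 p.2 := fun t => (hs.px2.slice t).continuous
  have cy : ∀ t, Continuous fun p : ℝ × ℝ => py2 u t p.1 p.2 := fun t => (hs.py2.slice t).continuous
  have isq : ∀ (l : List (Fin 3)) t, 2 ≤ t → (Continuous fun p : ℝ × ℝ => D2 u l t p.1 p.2) →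
      Integrable fun p : ℝ × ℝ => D2 u l t p.1 p.2 ^ 2 := fun l t ht hc => by
    obtain ⟨K, -, hK⟩ := hu.exists_bound l t ht
    exact integrable_sq_of_le_bracket hc (hK t ⟨le_rfl, le_rfl⟩)
  have iu : ∀ t, 2 ≤ t → Integrable fun p : ℝ × ℝ => u t p.1 p.2 ^ 2 :=
    fun t ht => isq [] t ht (cu t)
  have ix : ∀ t, 2 ≤ t → Integrable fun p : ℝ × ℝ => px2 u t p.1 p.2 ^ 2 :=
    fun t ht => isq [1] t ht (cx t)
  have iy : ∀ t, 2 ≤ t → Integrable fun p : ℝ × ℝ => py2 u t p.1 p.2 ^ 2 :=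
    fun t ht => isq [2] t ht (cy t)
  have hsq : ∀ t, 2 ≤ t → √(∫ p : ℝ × ℝ, u t p.1 p.2 ^ 2) ≤ M
      ∧ √(∫ p : ℝ × ℝ, px2 u t p.1 p.2 ^ 2) ≤ M ∧ √(∫ p : ℝ × ℝ, py2 u t p.1 p.2 ^ 2) ≤ M :=
    fun t ht => by
      have := hM t ht
      have h1 := Real.sqrt_nonneg (∫ p : ℝ × ℝ, u t p.1 p.2 ^ 2)
      have h2 := Real.sqrt_nonneg (∫ p : ℝ × ℝ, px2 u t p.1 p.2 ^ 2)
      have h3 := Real.sqrt_nonneg (∫ p : ℝ × ℝ, py2 u t p.1 p.2 ^ 2)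
      refine ⟨?_, ?_, ?_⟩ <;> linarith
  set S : ℝ → ℝ × ℝ → ℝ := fun t p => u t p.1 p.2 ^ 2 + px2 u t p.1 p.2 ^ 2 + py2 u t p.1 p.2 ^ 2
    with hSdef
  have S0 : ∀ t p, 0 ≤ S t p := fun t p => by positivity
  have cS : ∀ t, Continuous (S t) := fun t => (((cu t).pow 2).add ((cx t).pow 2)).add ((cy t).pow 2)
  have iS : ∀ t, 2 ≤ t → Integrable (S t) := fun t ht => ((iu t ht).add (ix t ht)).add (iy t ht)
  have hS : ∀ t, 2 ≤ t → ∫ p, S t p ≤ 3 * M ^ 2 := fun t ht => by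
    obtain ⟨h1, h2, h3⟩ := hsq t ht
    have e : ∫ p, S t p = (∫ p : ℝ × ℝ, u t p.1 p.2 ^ 2) + (∫ p : ℝ × ℝ, px2 u t p.1 p.2 ^ 2)
        + ∫ p : ℝ × ℝ, py2 u t p.1 p.2 ^ 2 := by
      rw [← integral_add (iu t ht) (ix t ht)]
      exact integral_add ((iu t ht).add (ix t ht)) (iy t ht)
    rw [e]
    linarith [(Real.sqrt_le_iff.1 h1).2, (Real.sqrt_le_iff.1 h2).2, (Real.sqrt_le_iff.1 h3).2]
  refine liminf_eq_zero_of_frequently_lt (B := 3 * M ^ 2) (fun t => integral_nonneg (S0 t)) ?_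
    fun c hc hcon => ?_
  · filter_upwards [eventually_ge_atTop 2] with t ht
    exact (setIntegral_le_integral (iS t ht) (Eventually.of_forall (S0 t))).trans (hS t ht)
  obtain ⟨T, hT⟩ := eventually_atTop.1 hcon
  have bwt : ∀ t, 1 ≤ t → ∀ z, |wt t z| ≤ C := fun t ht z => (hw.wt_le t ht z).trans
    (mul_le_of_le_one_right hC (Real.rpow_le_one_of_one_le_of_nonpos ht (by linarith)))
  refine not_bounded_of_deriv_ge_inv (T := max T 3) (c := c / 2) (C := C' * C) (d := d)
    (B := A * (M * C) + C * (M ^ 2)) (by positivity) (by positivity) (by positivity) hd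
    (fun t ht => hasDerivAt_virial hu A hw.hasDerivAt (fun s h => (hw.jet s h).c) hw.continuous_wt
      (fun s h => (hw.vanishes s h).imp fun _ h' => ⟨h'.1, h'.2.1⟩) hw.w_le bwt
      (by linarith [le_max_right T 3])) (fun t ht => ?_) fun t ht => ?_
  all_goals
    have ht2 : 2 ≤ t := by linarith [le_max_right T 3]
    have ht1 : 1 ≤ t := by linarith
    obtain ⟨R, vw, vwt, vP⟩ := hw.vanishes t ht1
  · have key := hlower R (C * t ^ (-1 - d)) _ _ _ _ _ _ _ _ _ _ _ _ _ _ _ _ _ _ _ (hs.jet t)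
      (hw.jet t ht1) ((hs.slice t).of_le (mod_cast le_top)) (hw.contDiff_wx t ht1)
      (hw.continuous_wt t ht1) (hw.continuous_P t ht1) vw vwt vP (hw.wx_eq t) (hw.P_nonneg t ht1)
      (hw.N_le t ht1) (hw.wt_le t ht1) (hw.wy_le t ht1) (hw.wxx_le t ht1) (hw.wxy_le t ht1)
      (hw.lap_le t ht1) (hw.lin_l2 t ht1) (iu t ht2) (ix t ht2) (iy t ht2) (hsq t ht2).1 (hS t ht2)
    simp only [hu.pt2_eq ht2]
    refine le_trans ?_ key
    have h1 := IsVirialWeight.inv_mul_setIntegral_le hw ht1 (cS t) (S0 t) (iS t ht2)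
    have h2 : c ≤ ∫ p in {q : ℝ × ℝ | |q.1| < t ^ b ∧ |q.2| < t ^ (b * r)}, S t p :=
      not_lt.1 (hT t (le_trans (le_max_left _ _) ht))
    have h3 := mul_le_mul_of_nonneg_left h2 (show 0 ≤ t⁻¹ by positivity)
    have h4 := h3.trans h1
    simp only [hSdef] at h4
    linarith
  · exact virial_le (cu t) (hw.jet t ht1).c vw hA (hw.w_le t ht1) (hw.w_l2 t ht1) (iu t ht2)
      (hsq t ht2).1 (Real.sqrt_le_iff.1 (hsq t ht2).1).2
end
end

section
/- Fix b > 0 and r₁, r₂ > 1 with r₁ + r₂ < 3, r₁ + 1 < 3 r₂, r₂ + 1 < 3 r₁, and b < 2/(3 + r₁ + r₂). Let u be an admissible smooth solution of the 3D Zakharov–Kuznetsov equation on [2,∞) with sup_{t≥2} (‖u(t,·)‖_{L²(ℝ³)} + ‖∇_{x,y,z} u(t,·)‖_{L²(ℝ³)}) < ∞. For t ≥ 2 set Ω(t) = {(x,y,z) ∈ ℝ³ : |x| < t^b, |y| < t^{b r₁}, |z| < t^{b r₂}}. Then liminf_{t→∞} ∫_{Ω(t)} ( u(t,x,y,z)²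 + |∇_{x,y,z} u(t,x,y,z)|² ) dx dy dz = 0. -/
open MeasureTheory Filter

noncomputable section

/-- Partial derivative in time of a function `u(t,x,y,z)`. -/
def pt3 (u : ℝ → ℝ → ℝ → ℝ → ℝ) : ℝ → ℝ → ℝ → ℝ → ℝ :=
  fun t x y z => deriv (fun s => u s x y z) t

/-- Partial derivative in `x` of a function `u(t,x,y,z)`. -/
def px3 (u : ℝ → ℝ → ℝ → ℝ → ℝ) : ℝ → ℝ → ℝ → ℝ → ℝ :=
  fun t x y z => deriv (fun a => u t a y z) x

/-- Partial derivative in `y` of a function `u(t,x,y,z)`. -/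
def py3 (u : ℝ → ℝ → ℝ → ℝ → ℝ) : ℝ → ℝ → ℝ → ℝ → ℝ :=
  fun t x y z => deriv (fun c => u t x c z) y

/-- Partial derivative in `z` of a function `u(t,x,y,z)`. -/
def pz3 (u : ℝ → ℝ → ℝ → ℝ → ℝ) : ℝ → ℝ → ℝ → ℝ → ℝ :=
  fun t x y z => deriv (fun c => u t x y c) z

/-- Iterated partial derivatives of `u(t,x,y,z)`, indexed by a list of directions
(`0` = t, `1` = x, `2` = y, `3` = z). -/
def D3 (u : ℝ → ℝ → ℝ → ℝ → ℝ) : List (Fin 4) → (ℝ → ℝ → ℝ → ℝ → ℝ)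
  | [] => u
  | i :: l =>
      if i = 0 then pt3 (D3 u l)
      else if i = 1 then px3 (D3 u l)
      else if i = 2 then py3 (D3 u l)
      else pz3 (D3 u l)

/-- An admissible smooth solution of the 3D Zakharov–Kuznetsov equation
`∂ₜu + ∂ₓ(∂ₓ²u + ∂ᵧ²u + ∂_z²u) + u ∂ₓu = 0` on `[2,∞)`: it is `C^∞`, solves the
equation pointwise for `t ≥ 2`, and all iterated partial derivatives decay in space
faster than any polynomial, locally uniformly in time. -/
structure IsAdmissibleZK3 (u : ℝ → ℝ → ℝ → ℝ → ℝ) : Prop where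
  smooth : ContDiff ℝ (⊤ : ℕ∞) (fun p : ℝ × ℝ × ℝ × ℝ => u p.1 p.2.1 p.2.2.1 p.2.2.2)
  eqn : ∀ t x y z : ℝ, 2 ≤ t →
    pt3 u t x y z
      + px3 (fun t' x' y' z' =>
          px3 (px3 u) t' x' y' z' + py3 (py3 u) t' x' y' z' + pz3 (pz3 u) t' x' y' z')
          t x y z
      + u t x y z * px3 u t x y z = 0
  decay : ∀ (l : List (Fin 4)) (N : ℕ) (a b : ℝ), 2 ≤ a →
    ∃ C : ℝ, ∀ t x y z : ℝ, t ∈ Set.Icc a b →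
      (1 + |x| + |y| + |z|) ^ N * |D3 u l t x y z| ≤ C


open scoped ContDiff

/-- Directional derivative of a function on `ℝ³` along the vector `v`. -/
def dirDeriv (v : ℝ × ℝ × ℝ) (f : ℝ × ℝ × ℝ → ℝ) : ℝ × ℝ × ℝ → ℝ :=
  fun p => fderiv ℝ f p v

/-- `∂ₓ` for functions on `ℝ³`. -/
abbrev dx (f : ℝ × ℝ × ℝ → ℝ) : ℝ × ℝ × ℝ → ℝ := dirDeriv (1, 0, 0) f

/-- `∂ᵧ` for functions on `ℝ³`. -/
abbrev dy (f : ℝ × ℝ × ℝ → ℝ) : ℝ × ℝ × ℝ → ℝ := dirDeriv (0, 1, 0) f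

/-- `∂_z` for functions on `ℝ³`. -/
abbrev dz (f : ℝ × ℝ × ℝ → ℝ) : ℝ × ℝ × ℝ → ℝ := dirDeriv (0, 0, 1) f

/-- The Laplacian of a function on `ℝ³`. -/
def lap3 (f : ℝ × ℝ × ℝ → ℝ) : ℝ × ℝ × ℝ → ℝ :=
  fun p => dx (dx f) p + dy (dy f) p + dz (dz f) p

instance isAddHaarMeasure_volume_real_prod :
    (volume : Measure (ℝ × ℝ)).IsAddHaarMeasure :=
  Measure.prod.instIsAddHaarMeasure _ _

instance isAddHaarMeasure_volume_real_prod_prod :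
    (volume : Measure (ℝ × ℝ × ℝ)).IsAddHaarMeasure :=
  Measure.prod.instIsAddHaarMeasure _ _

section Calculus

variable {f g : ℝ × ℝ × ℝ → ℝ} {v w : ℝ × ℝ × ℝ}

theorem ContDiff.dirDeriv (hf : ContDiff ℝ ∞ f) (v : ℝ × ℝ × ℝ) :
    ContDiff ℝ ∞ (dirDeriv v f) :=
  (hf.fderiv_right (m := ∞) (by simp)).clm_apply contDiff_const

theorem ContDiff.lap3 (hf : ContDiff ℝ ∞ f) : ContDiff ℝ ∞ (lap3 f) :=
  (((hf.dirDeriv _).dirDeriv _).add ((hf.dirDeriv _).dirDeriv _)).add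
    ((hf.dirDeriv _).dirDeriv _)

theorem HasCompactSupport.dirDeriv (hf : HasCompactSupport f) (v : ℝ × ℝ × ℝ) :
    HasCompactSupport (dirDeriv v f) :=
  hf.fderiv_apply (𝕜 := ℝ) v

theorem dirDeriv_add (hf : ContDiff ℝ ∞ f) (hg : ContDiff ℝ ∞ g) (p : ℝ × ℝ × ℝ) :
    dirDeriv v (fun q => f q + g q) p = dirDeriv v f p + dirDeriv v g p := by
  have h1 := (hf.differentiable (by simp)) p
  have h2 := (hg.differentiable (by simp)) p
  simp [dirDeriv, fderiv_fun_add h1 h2]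

theorem dirDeriv_sub (hf : ContDiff ℝ ∞ f) (hg : ContDiff ℝ ∞ g) (p : ℝ × ℝ × ℝ) :
    dirDeriv v (fun q => f q - g q) p = dirDeriv v f p - dirDeriv v g p := by
  have h1 := (hf.differentiable (by simp)) p
  have h2 := (hg.differentiable (by simp)) p
  simp [dirDeriv, fderiv_fun_sub h1 h2]

theorem dirDeriv_mul (hf : ContDiff ℝ ∞ f) (hg : ContDiff ℝ ∞ g) (p : ℝ × ℝ × ℝ) :
    dirDeriv v (fun q => f q * g q) p = dirDeriv v f p * g p + f p * dirDeriv v g p := by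
  have h1 := (hf.differentiable (by simp)) p
  have h2 := (hg.differentiable (by simp)) p
  simp [dirDeriv, fderiv_fun_mul h1 h2]
  ring

theorem dirDeriv_const (c : ℝ) (p : ℝ × ℝ × ℝ) : dirDeriv v (fun _ => c) p = 0 := by
  simp [dirDeriv]

theorem dirDeriv_comm (hf : ContDiff ℝ ∞ f) (v w : ℝ × ℝ × ℝ) (p : ℝ × ℝ × ℝ) :
    dirDeriv v (dirDeriv w f) p = dirDeriv w (dirDeriv v f) p := by
  have hd : DifferentiableAt ℝ (fderiv ℝ f) p :=
    (hf.fderiv_right (m := ∞) (by simp)).differentiable (by simp) p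
  have key : ∀ a b : ℝ × ℝ × ℝ,
      dirDeriv a (dirDeriv b f) p = fderiv ℝ (fderiv ℝ f) p a b := by
    intro a b
    change fderiv ℝ (fun q => fderiv ℝ f q b) p a = _
    rw [fderiv_clm_apply hd (differentiableAt_const b)]
    simp
  rw [key, key]
  exact (hf.contDiffAt.isSymmSndFDerivAt (by simp; exact WithTop.coe_le_coe.2 le_top)) v w

theorem integral_dirDeriv_eq_zero (hf : ContDiff ℝ ∞ f) (hc : HasCompactSupport f)
    (v : ℝ × ℝ × ℝ) : ∫ p, dirDeriv v f p = 0 := by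
  have h := integral_mul_fderiv_eq_neg_fderiv_mul_of_integrable (𝕜 := ℝ)
    (μ := (volume : Measure (ℝ × ℝ × ℝ)))
    (f := fun _ : ℝ × ℝ × ℝ => (1 : ℝ)) (g := f) (v := v)
    (by simp)
    (by simpa [dirDeriv] using! ((hf.dirDeriv v).continuous.integrable_of_hasCompactSupport (hc.dirDeriv v)))
    (by simpa using hf.continuous.integrable_of_hasCompactSupport hc)
    (fun _ _ => differentiableAt_const _)
    (fun x _ => hf.differentiable (by simp) x)
  simpa [dirDeriv] using h

theorem integrable_dirDeriv (hf : ContDiff ℝ ∞ f) (hc : HasCompactSupport f)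
    (v : ℝ × ℝ × ℝ) : Integrable (dirDeriv v f) :=
  (hf.dirDeriv v).continuous.integrable_of_hasCompactSupport (hc.dirDeriv v)

/-- The divergence of a compactly supported field integrates to zero. -/
theorem integral_divergence_eq_zero {P Q S : ℝ × ℝ × ℝ → ℝ}
    (hP : ContDiff ℝ ∞ P) (hQ : ContDiff ℝ ∞ Q) (hS : ContDiff ℝ ∞ S)
    (cP : HasCompactSupport P) (cQ : HasCompactSupport Q) (cS : HasCompactSupport S) :
    ∫ p, (dx P p + dy Q p + dz S p) = 0 := by
  rw [integral_add (f := fun p => dx P p + dy Q p)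
    ((integrable_dirDeriv hP cP _).add (integrable_dirDeriv hQ cQ _))
    (integrable_dirDeriv hS cS _), integral_add (integrable_dirDeriv hP cP _)
    (integrable_dirDeriv hQ cQ _), integral_dirDeriv_eq_zero hP cP,
    integral_dirDeriv_eq_zero hQ cQ, integral_dirDeriv_eq_zero hS cS]
  simp

end Calculus

section Identities

variable {U W : ℝ × ℝ × ℝ → ℝ}

/-- Integration by parts behind the evolution of `∫ u w`. -/
theorem integral_mass_identity (hU : ContDiff ℝ ∞ U) (hW : ContDiff ℝ ∞ W)
    (cW : HasCompactSupport W) :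
    ∫ p, (-(dx (lap3 U) p + U p * dx U p)) * W p
      = ∫ p, (1 / 2 * (U p * U p * dx W p) + U p * lap3 (dx W) p) := by
  have hU1 := hU.dirDeriv (1, 0, 0)
  have hU2 := hU.dirDeriv (0, 1, 0)
  have hU3 := hU.dirDeriv (0, 0, 1)
  have hW1 := hW.dirDeriv (1, 0, 0)
  have hV := hU.lap3
  have hW11 := hW1.dirDeriv (1, 0, 0)
  have hW12 := hW1.dirDeriv (0, 1, 0)
  have hW13 := hW1.dirDeriv (0, 0, 1)
  have cW1 := cW.dirDeriv (1, 0, 0)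
  have cW11 := cW1.dirDeriv (1, 0, 0)
  have cW12 := cW1.dirDeriv (0, 1, 0)
  have cW13 := cW1.dirDeriv (0, 0, 1)
  have key := integral_divergence_eq_zero
    (P := fun p => W p * lap3 U p - dx W p * dx U p + dx (dx W) p * U p
      + 1 / 2 * (W p * (U p * U p)))
    (Q := fun p => dy (dx W) p * U p - dx W p * dy U p)
    (S := fun p => dz (dx W) p * U p - dx W p * dz U p)
    (by fun_prop) (by fun_prop) (by fun_prop)
    (((cW.mul_right.sub cW1.mul_right).add cW11.mul_right).add cW.mul_right.mul_left)
    (cW12.mul_right.sub cW1.mul_right) (cW13.mul_right.sub cW1.mul_right)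
  rw [← sub_eq_zero, ← integral_sub, ← neg_eq_zero, ← integral_neg, ← key]
  · refine integral_congr_ae (.of_forall fun p => ?_)
    simp (disch := fun_prop) only [dirDeriv_add, dirDeriv_sub, dirDeriv_mul, dirDeriv_const]
    simp only [lap3]
    ring
  · exact Continuous.integrable_of_hasCompactSupport
      (by have := hV.dirDeriv (1, 0, 0); fun_prop) cW.mul_left
  · refine Continuous.integrable_of_hasCompactSupport
      (by have := hW1.lap3; fun_prop) ?_
    exact cW1.mul_left.mul_left.add
      (((cW11.dirDeriv _).add (cW12.dirDeriv _)).add (cW13.dirDeriv _)).mul_left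

/-- Integration by parts behind the evolution of `½ ∫ u² w`. -/
theorem integral_energy_identity (hU : ContDiff ℝ ∞ U) (hW : ContDiff ℝ ∞ W)
    (cW : HasCompactSupport W) :
    ∫ p, (-(U p * (dx (lap3 U) p + U p * dx U p))) * W p
      = ∫ p, (1 / 2 * (U p * U p * lap3 (dx W) p) + 1 / 3 * (U p * U p * U p * dx W p)
        - dx W p * (3 / 2 * (dx U p * dx U p) + 1 / 2 * (dy U p * dy U p)
          + 1 / 2 * (dz U p * dz U p))
        - dx U p * (dy W p * dy U p + dz W p * dz U p)) := by
  have hU1 := hU.dirDeriv (1, 0, 0)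
  have hU2 := hU.dirDeriv (0, 1, 0)
  have hU3 := hU.dirDeriv (0, 0, 1)
  have hW1 := hW.dirDeriv (1, 0, 0)
  have hW2 := hW.dirDeriv (0, 1, 0)
  have hW3 := hW.dirDeriv (0, 0, 1)
  have hV := hU.lap3
  have hW11 := hW1.dirDeriv (1, 0, 0)
  have hW12 := hW1.dirDeriv (0, 1, 0)
  have hW13 := hW1.dirDeriv (0, 0, 1)
  have cW1 := cW.dirDeriv (1, 0, 0)
  have cW2 := cW.dirDeriv (0, 1, 0)
  have cW3 := cW.dirDeriv (0, 0, 1)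
  have cW11 := cW1.dirDeriv (1, 0, 0)
  have cW12 := cW1.dirDeriv (0, 1, 0)
  have cW13 := cW1.dirDeriv (0, 0, 1)
  have key := integral_divergence_eq_zero
    (P := fun p => W p * (U p * lap3 U p - 1 / 2 * (dx U p * dx U p)
        + 1 / 2 * (dy U p * dy U p + dz U p * dz U p) + 1 / 3 * (U p * U p * U p))
      - dx W p * (U p * dx U p) + dx (dx W) p * (1 / 2 * (U p * U p)))
    (Q := fun p => dy (dx W) p * (1 / 2 * (U p * U p)) - dx W p * (U p * dy U p)
      - W p * (dx U p * dy U p))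
    (S := fun p => dz (dx W) p * (1 / 2 * (U p * U p)) - dx W p * (U p * dz U p)
      - W p * (dx U p * dz U p))
    (by fun_prop) (by fun_prop) (by fun_prop)
    ((cW.mul_right.sub cW1.mul_right).add cW11.mul_right)
    ((cW12.mul_right.sub cW1.mul_right).sub cW.mul_right)
    ((cW13.mul_right.sub cW1.mul_right).sub cW.mul_right)
  rw [← sub_eq_zero, ← integral_sub, ← neg_eq_zero, ← integral_neg, ← key]
  · refine integral_congr_ae (.of_forall fun p => ?_)
    simp (disch := fun_prop) only [dirDeriv_add, dirDeriv_sub, dirDeriv_mul, dirDeriv_const]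
    simp only [lap3, dirDeriv_comm hU (0, 1, 0) (1, 0, 0), dirDeriv_comm hU (0, 0, 1) (1, 0, 0)]
    ring
  · exact Continuous.integrable_of_hasCompactSupport
      (by have := hV.dirDeriv (1, 0, 0); fun_prop) cW.mul_left
  · refine Continuous.integrable_of_hasCompactSupport
      (by have := hW1.lap3; fun_prop) ?_
    exact (((((cW11.dirDeriv _).add (cW12.dirDeriv _)).add
      (cW13.dirDeriv _)).mul_left.mul_left.add cW1.mul_left.mul_left).sub
        cW1.mul_right).sub (cW2.mul_right.add cW3.mul_right).mul_left

end Identities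

section Cutoff

/-- A smooth even cutoff on `ℝ`, equal to `1` on `[-1,1]` and supported in `[-2,2]`. -/
def cutoff : ℝ → ℝ := (⟨1, 2, one_pos, one_lt_two⟩ : ContDiffBump (0 : ℝ))

/-- The primitive of `cutoff` vanishing at `0`. -/
def cutoffPrim (s : ℝ) : ℝ := ∫ r in (0 : ℝ)..s, cutoff r

theorem contDiff_cutoff : ContDiff ℝ ∞ cutoff := ContDiffBump.contDiff _

theorem cutoff_nonneg (s : ℝ) : 0 ≤ cutoff s := ContDiffBump.nonneg _

theorem cutoff_le_one (s : ℝ) : cutoff s ≤ 1 := ContDiffBump.le_one _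

theorem cutoff_eq_one {s : ℝ} (h : |s| ≤ 1) : cutoff s = 1 :=
  ContDiffBump.one_of_mem_closedBall _ (by simpa using h)

theorem cutoff_eq_zero {s : ℝ} (h : 2 ≤ |s|) : cutoff s = 0 :=
  ContDiffBump.zero_of_le_dist _ (by simpa using h)

theorem hasCompactSupport_cutoff : HasCompactSupport cutoff := ContDiffBump.hasCompactSupport _

theorem hasDerivAt_cutoffPrim (s : ℝ) : HasDerivAt cutoffPrim (cutoff s) s :=
  intervalIntegral.integral_hasDerivAt_right
    (contDiff_cutoff.continuous.intervalIntegrable _ _)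
    contDiff_cutoff.continuous.aestronglyMeasurable.stronglyMeasurableAtFilter
    contDiff_cutoff.continuous.continuousAt

theorem contDiff_cutoffPrim : ContDiff ℝ ∞ cutoffPrim := by
  refine contDiff_infty_iff_deriv.2 ⟨fun s => (hasDerivAt_cutoffPrim s).differentiableAt, ?_⟩
  rw [show deriv cutoffPrim = cutoff from funext fun s => (hasDerivAt_cutoffPrim s).deriv]
  exact contDiff_cutoff

theorem cutoffPrim_eq_of_two_le {s : ℝ} (h : 2 ≤ s) : cutoffPrim s = cutoffPrim 2 := by
  have hi := fun a b : ℝ => contDiff_cutoff.continuous.intervalIntegrable (μ := volume) a b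
  rw [cutoffPrim, ← intervalIntegral.integral_add_adjacent_intervals (hi 0 2) (hi 2 s)]
  rw [intervalIntegral.integral_congr (g := fun _ => (0 : ℝ)) (a := 2)]
  · simp [cutoffPrim]
  · intro r hr
    rw [Set.uIcc_of_le h] at hr
    exact cutoff_eq_zero (hr.1.trans (le_abs_self r))

theorem cutoffPrim_eq_of_le_neg_two {s : ℝ} (h : s ≤ -2) : cutoffPrim s = cutoffPrim (-2) := by
  have hi := fun a b : ℝ => contDiff_cutoff.continuous.intervalIntegrable (μ := volume) a b
  rw [cutoffPrim, ← intervalIntegral.integral_add_adjacent_intervals (hi 0 (-2)) (hi (-2) s)]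
  rw [intervalIntegral.integral_congr (g := fun _ => (0 : ℝ)) (a := -2)]
  · simp [cutoffPrim]
  · intro r hr
    rw [Set.uIcc_of_ge h] at hr
    exact cutoff_eq_zero (by rw [le_abs]; right; linarith [hr.2])

theorem abs_cutoffPrim_le (s : ℝ) : |cutoffPrim s| ≤ 2 := by
  have key : ∀ r : ℝ, |r| ≤ 2 → |cutoffPrim r| ≤ 2 := by
    intro r hr
    have := intervalIntegral.norm_integral_le_of_norm_le_const (a := 0) (b := r) (f := cutoff)
      (C := 1) fun x _ => by
        rw [Real.norm_of_nonneg (cutoff_nonneg x)]; exact cutoff_le_one x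
    rw [Real.norm_eq_abs] at this
    calc |cutoffPrim r| ≤ 1 * |r - 0| := this
      _ ≤ 2 := by simpa using hr
  rcases le_total |s| 2 with h | h
  · exact key s h
  · rcases le_abs.1 h with h | h
    · rw [cutoffPrim_eq_of_two_le h]; exact key _ (by norm_num)
    · rw [cutoffPrim_eq_of_le_neg_two (by linarith)]; exact key _ (by norm_num)

/-- The cutoff at scale `X`. -/
def scaledCutoff (X : ℝ) : ℝ → ℝ := fun x => cutoff (X⁻¹ * x)

variable {X Y Z L : ℝ}

theorem contDiff_scaledCutoff (X : ℝ) : ContDiff ℝ ∞ (scaledCutoff X) :=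
  contDiff_cutoff.comp (contDiff_const.mul contDiff_id)

theorem deriv_scaledCutoff (X : ℝ) :
    deriv (scaledCutoff X) = fun x => X⁻¹ * deriv cutoff (X⁻¹ * x) := by
  funext x
  exact deriv_comp_mul_left X⁻¹ cutoff x

theorem deriv_deriv_scaledCutoff (X : ℝ) :
    deriv (deriv (scaledCutoff X)) = fun x => X⁻¹ ^ 2 * deriv (deriv cutoff) (X⁻¹ * x) := by
  rw [deriv_scaledCutoff]
  funext x
  rw [deriv_const_mul_field, deriv_comp_mul_left X⁻¹ (deriv cutoff) x]
  simp only [smul_eq_mul]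
  ring

theorem abs_inv_mul_le_iff (hX : 0 < X) (x c : ℝ) : |X⁻¹ * x| ≤ c ↔ |x| ≤ c * X := by
  rw [abs_mul, abs_inv, abs_of_pos hX, inv_mul_le_iff₀ hX, mul_comm]

theorem scaledCutoff_nonneg (X x : ℝ) : 0 ≤ scaledCutoff X x := cutoff_nonneg _

theorem scaledCutoff_le_one (X x : ℝ) : scaledCutoff X x ≤ 1 := cutoff_le_one _

theorem scaledCutoff_eq_one (hX : 0 < X) {x : ℝ} (h : |x| ≤ X) : scaledCutoff X x = 1 :=
  cutoff_eq_one ((abs_inv_mul_le_iff hX _ _).2 (by simpa using h))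

theorem scaledCutoff_eq_zero (hX : 0 < X) {x : ℝ} (h : 2 * X < |x|) : scaledCutoff X x = 0 := by
  refine cutoff_eq_zero (le_of_lt (not_le.1 fun h' => ?_))
  exact absurd ((abs_inv_mul_le_iff hX _ _).1 h') (not_le.2 h)

/-- `X (Ψ(x/X) - Ψ(x/L))` where `Ψ' = cutoff`: a truncated multiple of `x`. -/
def truncPrim (X L : ℝ) : ℝ → ℝ :=
  fun x => X * (cutoffPrim (X⁻¹ * x) - cutoffPrim (L⁻¹ * x))

theorem contDiff_truncPrim (X L : ℝ) : ContDiff ℝ ∞ (truncPrim X L) := by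
  have h : ∀ a : ℝ, ContDiff ℝ ∞ fun x => cutoffPrim (a * x) :=
    fun a => contDiff_cutoffPrim.comp (contDiff_const.mul contDiff_id)
  exact contDiff_const.mul ((h _).sub (h _))

theorem deriv_truncPrim (hX : 0 < X) :
    deriv (truncPrim X L) = fun x => scaledCutoff X x - X / L * scaledCutoff L x := by
  funext x
  have h : ∀ a : ℝ, HasDerivAt (fun y => cutoffPrim (a * y)) (cutoff (a * x) * a) x := fun a =>
    (hasDerivAt_cutoffPrim (a * x)).comp x (by simpa using (hasDerivAt_id x).const_mul a)
  refine (((h X⁻¹).sub (h L⁻¹)).const_mul X).deriv.trans ?_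
  simp only [scaledCutoff]
  field_simp

theorem abs_truncPrim_le (hX : 0 < X) (x : ℝ) : |truncPrim X L x| ≤ 4 * X := by
  rw [truncPrim, abs_mul, abs_of_pos hX]
  have := abs_sub (cutoffPrim (X⁻¹ * x)) (cutoffPrim (L⁻¹ * x))
  have h1 := abs_cutoffPrim_le (X⁻¹ * x)
  have h2 := abs_cutoffPrim_le (L⁻¹ * x)
  nlinarith

theorem truncPrim_eq_zero (hX : 0 < X) (hL : X ≤ L) {x : ℝ} (h : 2 * L < |x|) :
    truncPrim X L x = 0 := by
  have hL0 := hX.trans_le hL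
  have main : ∀ a : ℝ, 0 < a → a ≤ L →
      cutoffPrim (a⁻¹ * x) = if 0 < x then cutoffPrim 2 else cutoffPrim (-2) := by
    intro a ha haL
    split_ifs with hx
    · rw [abs_of_pos hx] at h
      apply cutoffPrim_eq_of_two_le
      rw [le_inv_mul_iff₀ ha]
      linarith
    · rw [abs_of_nonpos (not_lt.1 hx)] at h
      apply cutoffPrim_eq_of_le_neg_two
      rw [inv_mul_le_iff₀ ha]
      linarith
  rw [truncPrim, main X hX hL, main L hL0 le_rfl]
  simp

/-- Uniform bounds for the first two derivatives of the cutoff. -/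
theorem exists_bound_deriv_cutoff :
    ∃ C : ℝ, 1 ≤ C ∧ (∀ s, |deriv cutoff s| ≤ C) ∧ ∀ s, |deriv (deriv cutoff) s| ≤ C := by
  have h1 : ContDiff ℝ ∞ (deriv cutoff) := (contDiff_infty_iff_deriv.1 contDiff_cutoff).2
  have h2 : ContDiff ℝ ∞ (deriv (deriv cutoff)) := (contDiff_infty_iff_deriv.1 h1).2
  have c1 : HasCompactSupport (deriv cutoff) := hasCompactSupport_cutoff.deriv
  obtain ⟨C1, hC1⟩ := c1.exists_bound_of_continuous h1.continuous
  obtain ⟨C2, hC2⟩ := c1.deriv.exists_bound_of_continuous h2.continuous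
  exact ⟨max 1 (max C1 C2), le_max_left _ _,
    fun s => (hC1 s).trans ((le_max_left _ _).trans (le_max_right _ _)),
    fun s => (hC2 s).trans ((le_max_right _ _).trans (le_max_right _ _))⟩

end Cutoff

section Tensor

/-- The product function `(x,y,z) ↦ A x * B y * G z`. -/
def tensor (A B G : ℝ → ℝ) : ℝ × ℝ × ℝ → ℝ := fun p => A p.1 * B p.2.1 * G p.2.2

variable {A B G : ℝ → ℝ}

theorem contDiff_tensor (hA : ContDiff ℝ ∞ A) (hB : ContDiff ℝ ∞ B) (hG : ContDiff ℝ ∞ G) :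
    ContDiff ℝ ∞ (tensor A B G) :=
  ((hA.comp contDiff_fst).mul (hB.comp (contDiff_fst.comp contDiff_snd))).mul
    (hG.comp (contDiff_snd.comp contDiff_snd))

/-- Directional derivatives along the axes are one-variable derivatives. -/
theorem dx_eq_deriv {f : ℝ × ℝ × ℝ → ℝ} (hf : ContDiff ℝ ∞ f) (x y z : ℝ) :
    dx f (x, y, z) = deriv (fun a => f (a, y, z)) x := by
  have h := (hf.differentiable (by simp) (x, y, z)).hasFDerivAt
  have hg : HasDerivAt (fun a : ℝ => (a, y, z)) ((1 : ℝ), (0 : ℝ), (0 : ℝ)) x :=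
    (hasDerivAt_id x).prodMk (hasDerivAt_const x (y, z))
  exact (h.comp_hasDerivAt x hg).deriv.symm

theorem dy_eq_deriv {f : ℝ × ℝ × ℝ → ℝ} (hf : ContDiff ℝ ∞ f) (x y z : ℝ) :
    dy f (x, y, z) = deriv (fun a => f (x, a, z)) y := by
  have h := (hf.differentiable (by simp) (x, y, z)).hasFDerivAt
  have hg : HasDerivAt (fun a : ℝ => (x, a, z)) ((0 : ℝ), (1 : ℝ), (0 : ℝ)) y :=
    (hasDerivAt_const y x).prodMk ((hasDerivAt_id y).prodMk (hasDerivAt_const y z))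
  exact (h.comp_hasDerivAt y hg).deriv.symm

theorem dz_eq_deriv {f : ℝ × ℝ × ℝ → ℝ} (hf : ContDiff ℝ ∞ f) (x y z : ℝ) :
    dz f (x, y, z) = deriv (fun a => f (x, y, a)) z := by
  have h := (hf.differentiable (by simp) (x, y, z)).hasFDerivAt
  have hg : HasDerivAt (fun a : ℝ => (x, y, a)) ((0 : ℝ), (0 : ℝ), (1 : ℝ)) z :=
    (hasDerivAt_const z x).prodMk ((hasDerivAt_const z y).prodMk (hasDerivAt_id z))
  exact (h.comp_hasDerivAt z hg).deriv.symm

theorem dx_tensor (hA : ContDiff ℝ ∞ A) (hB : ContDiff ℝ ∞ B) (hG : ContDiff ℝ ∞ G) :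
    dx (tensor A B G) = tensor (deriv A) B G := by
  funext ⟨x, y, z⟩
  rw [dx_eq_deriv (contDiff_tensor hA hB hG)]
  have := hA.differentiable (by simp) x
  simp [tensor]

theorem dy_tensor (hA : ContDiff ℝ ∞ A) (hB : ContDiff ℝ ∞ B) (hG : ContDiff ℝ ∞ G) :
    dy (tensor A B G) = tensor A (deriv B) G := by
  funext ⟨x, y, z⟩
  rw [dy_eq_deriv (contDiff_tensor hA hB hG)]
  simp [tensor]

theorem dz_tensor (hA : ContDiff ℝ ∞ A) (hB : ContDiff ℝ ∞ B) (hG : ContDiff ℝ ∞ G) :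
    dz (tensor A B G) = tensor A B (deriv G) := by
  funext ⟨x, y, z⟩
  rw [dz_eq_deriv (contDiff_tensor hA hB hG)]
  simp [tensor]

theorem ContDiff.deriv_infty (hA : ContDiff ℝ ∞ A) : ContDiff ℝ ∞ (deriv A) :=
  (contDiff_infty_iff_deriv.1 hA).2

theorem lap3_dx_tensor (hA : ContDiff ℝ ∞ A) (hB : ContDiff ℝ ∞ B) (hG : ContDiff ℝ ∞ G)
    (p : ℝ × ℝ × ℝ) :
    lap3 (dx (tensor A B G)) p = tensor (deriv (deriv (deriv A))) B G p
      + tensor (deriv A) (deriv (deriv B)) G p + tensor (deriv A) B (deriv (deriv G)) p := by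
  have hA1 := hA.deriv_infty
  rw [dx_tensor hA hB hG, lap3, dx_tensor hA1 hB hG, dx_tensor hA1.deriv_infty hB hG,
    dy_tensor hA1 hB hG, dy_tensor hA1 hB.deriv_infty hG, dz_tensor hA1 hB hG,
    dz_tensor hA1 hB hG.deriv_infty]

/-- The closed box `[-X,X] × [-Y,Y] × [-Z,Z]`. -/
def box3 (X Y Z : ℝ) : Set (ℝ × ℝ × ℝ) :=
  Set.Icc (-X) X ×ˢ (Set.Icc (-Y) Y ×ˢ Set.Icc (-Z) Z)

theorem mem_box3 {X Y Z : ℝ} {p : ℝ × ℝ × ℝ} :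
    p ∈ box3 X Y Z ↔ |p.1| ≤ X ∧ |p.2.1| ≤ Y ∧ |p.2.2| ≤ Z := by
  simp only [box3, Set.mem_prod, Set.mem_Icc, abs_le]

theorem isCompact_box3 (X Y Z : ℝ) : IsCompact (box3 X Y Z) :=
  isCompact_Icc.prod (isCompact_Icc.prod isCompact_Icc)

theorem measureReal_box3 {X Y Z : ℝ} (hX : 0 ≤ X) (hY : 0 ≤ Y) (hZ : 0 ≤ Z) :
    volume.real (box3 X Y Z) = 8 * (X * Y * Z) := by
  rw [box3, Measure.volume_eq_prod, measureReal_prod_prod, Measure.volume_eq_prod,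
    measureReal_prod_prod, Real.volume_real_Icc_of_le (by linarith),
    Real.volume_real_Icc_of_le (by linarith), Real.volume_real_Icc_of_le (by linarith)]
  ring

end Tensor

section Weights

/-- The box cutoff at scales `X`, `Y`, `Z`. -/
def boxCutoff (X Y Z : ℝ) : ℝ × ℝ × ℝ → ℝ :=
  tensor (scaledCutoff X) (scaledCutoff Y) (scaledCutoff Z)

/-- The virial weight, whose `x`-derivative is a box cutoff up to a small tail. -/
def virialWeight (X L Y Z : ℝ) : ℝ × ℝ × ℝ → ℝ :=
  tensor (truncPrim X L) (scaledCutoff Y) (scaledCutoff Z)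

variable {X Y Z L : ℝ}

theorem contDiff_boxCutoff (X Y Z : ℝ) : ContDiff ℝ ∞ (boxCutoff X Y Z) :=
  contDiff_tensor (contDiff_scaledCutoff X) (contDiff_scaledCutoff Y) (contDiff_scaledCutoff Z)

theorem contDiff_virialWeight (X L Y Z : ℝ) : ContDiff ℝ ∞ (virialWeight X L Y Z) :=
  contDiff_tensor (contDiff_truncPrim X L) (contDiff_scaledCutoff Y) (contDiff_scaledCutoff Z)

theorem boxCutoff_nonneg (X Y Z : ℝ) (p : ℝ × ℝ × ℝ) : 0 ≤ boxCutoff X Y Z p :=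
  mul_nonneg (mul_nonneg (scaledCutoff_nonneg _ _) (scaledCutoff_nonneg _ _))
    (scaledCutoff_nonneg _ _)

theorem boxCutoff_le_one (X Y Z : ℝ) (p : ℝ × ℝ × ℝ) : boxCutoff X Y Z p ≤ 1 :=
  mul_le_one₀ (mul_le_one₀ (scaledCutoff_le_one _ _) (scaledCutoff_nonneg _ _)
    (scaledCutoff_le_one _ _)) (scaledCutoff_nonneg _ _) (scaledCutoff_le_one _ _)

theorem boxCutoff_eq_one (hX : 0 < X) (hY : 0 < Y) (hZ : 0 < Z) {p : ℝ × ℝ × ℝ}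
    (hp : p ∈ box3 X Y Z) : boxCutoff X Y Z p = 1 := by
  obtain ⟨h1, h2, h3⟩ := mem_box3.1 hp
  simp [boxCutoff, tensor, scaledCutoff_eq_one, *]

/-- A product function vanishes off a box when its factors vanish off intervals. -/
theorem tensor_eq_zero {A B G : ℝ → ℝ} (hA : ∀ x, X < |x| → A x = 0)
    (hB : ∀ x, Y < |x| → B x = 0) (hG : ∀ x, Z < |x| → G x = 0) {p : ℝ × ℝ × ℝ}
    (hp : p ∉ box3 X Y Z) : tensor A B G p = 0 := by
  rw [mem_box3] at hp
  by_cases h1 : |p.1| ≤ X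
  · by_cases h2 : |p.2.1| ≤ Y
    · have h3 : ¬ |p.2.2| ≤ Z := fun h => hp ⟨h1, h2, h⟩
      simp [tensor, hG _ (not_le.1 h3)]
    · simp [tensor, hB _ (not_le.1 h2)]
  · simp [tensor, hA _ (not_le.1 h1)]

theorem boxCutoff_eq_zero (hX : 0 < X) (hY : 0 < Y) (hZ : 0 < Z) {p : ℝ × ℝ × ℝ}
    (hp : p ∉ box3 (2 * X) (2 * Y) (2 * Z)) : boxCutoff X Y Z p = 0 :=
  tensor_eq_zero (fun _ => scaledCutoff_eq_zero hX) (fun _ => scaledCutoff_eq_zero hY)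
    (fun _ => scaledCutoff_eq_zero hZ) hp

theorem virialWeight_eq_zero (hX : 0 < X) (hL : X ≤ L) (hY : 0 < Y) (hZ : 0 < Z)
    {p : ℝ × ℝ × ℝ} (hp : p ∉ box3 (2 * L) (2 * Y) (2 * Z)) : virialWeight X L Y Z p = 0 :=
  tensor_eq_zero (fun _ => truncPrim_eq_zero hX hL) (fun _ => scaledCutoff_eq_zero hY)
    (fun _ => scaledCutoff_eq_zero hZ) hp

theorem hasCompactSupport_boxCutoff (hX : 0 < X) (hY : 0 < Y) (hZ : 0 < Z) :
    HasCompactSupport (boxCutoff X Y Z) :=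
  .intro (isCompact_box3 _ _ _) fun _ => boxCutoff_eq_zero hX hY hZ

theorem hasCompactSupport_virialWeight (hX : 0 < X) (hL : X ≤ L) (hY : 0 < Y) (hZ : 0 < Z) :
    HasCompactSupport (virialWeight X L Y Z) :=
  .intro (isCompact_box3 _ _ _) fun _ => virialWeight_eq_zero hX hL hY hZ

theorem abs_virialWeight_le (hX : 0 < X) (p : ℝ × ℝ × ℝ) : |virialWeight X L Y Z p| ≤ 4 * X := by
  rw [virialWeight, tensor, abs_mul, abs_mul, abs_of_nonneg (scaledCutoff_nonneg Y _),
    abs_of_nonneg (scaledCutoff_nonneg Z _)]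
  have h1 := abs_truncPrim_le (L := L) hX p.1
  have h2 := mul_le_of_le_one_right (abs_nonneg (truncPrim X L p.1)) (scaledCutoff_le_one Y p.2.1)
  have h3 := mul_le_of_le_one_right
    (mul_nonneg (abs_nonneg (truncPrim X L p.1)) (scaledCutoff_nonneg Y p.2.1))
    (scaledCutoff_le_one Z p.2.2)
  linarith

theorem dx_virialWeight (hX : 0 < X) (p : ℝ × ℝ × ℝ) :
    dx (virialWeight X L Y Z) p = boxCutoff X Y Z p - X / L * boxCutoff L Y Z p := by
  rw [virialWeight, dx_tensor (contDiff_truncPrim X L) (contDiff_scaledCutoff Y)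
    (contDiff_scaledCutoff Z), deriv_truncPrim hX]
  simp only [boxCutoff, tensor]
  ring

theorem abs_deriv_scaledCutoff_le {C : ℝ} (hC : ∀ s, |deriv cutoff s| ≤ C) (hX : 0 < X) (x : ℝ) :
    |deriv (scaledCutoff X) x| ≤ C / X := by
  rw [deriv_scaledCutoff, abs_mul, abs_inv, abs_of_pos hX, div_eq_inv_mul]
  have := hC (X⁻¹ * x)
  gcongr

theorem abs_deriv_deriv_scaledCutoff_le {C : ℝ} (hC : ∀ s, |deriv (deriv cutoff) s| ≤ C)
    (hX : 0 < X) (x : ℝ) : |deriv (deriv (scaledCutoff X)) x| ≤ C / X ^ 2 := by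
  rw [deriv_deriv_scaledCutoff, abs_mul, abs_pow, abs_inv, abs_of_pos hX, div_eq_inv_mul, inv_pow]
  have := hC (X⁻¹ * x)
  gcongr

theorem abs_tensor_le {A B G : ℝ → ℝ} {a b g : ℝ} {p : ℝ × ℝ × ℝ} (hA : |A p.1| ≤ a)
    (hB : |B p.2.1| ≤ b) (hG : |G p.2.2| ≤ g) : |tensor A B G p| ≤ a * b * g := by
  have ha := (abs_nonneg _).trans hA
  have hb := (abs_nonneg _).trans hB
  rw [tensor, abs_mul, abs_mul]
  gcongr

theorem abs_scaledCutoff_le_one (X x : ℝ) : |scaledCutoff X x| ≤ 1 :=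
  abs_le.2 ⟨by linarith [scaledCutoff_nonneg X x], scaledCutoff_le_one X x⟩

/-- Scale-invariant bounds for the derivatives of the cutoffs and of the virial weight. -/
theorem exists_weight_bound : ∃ K : ℝ, 1 ≤ K ∧ ∀ X L Y Z : ℝ, 0 < X → X ≤ L → X ≤ Y → X ≤ Z →
    (∀ p, |dx (boxCutoff X Y Z) p| ≤ K / X ∧ |dy (boxCutoff X Y Z) p| ≤ K / X ∧
      |dz (boxCutoff X Y Z) p| ≤ K / X) ∧
    (∀ p, |dy (virialWeight X L Y Z) p| ≤ K * (X / Y)) ∧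
    (∀ p, |dz (virialWeight X L Y Z) p| ≤ K * (X / Z)) ∧
    (∀ p, |lap3 (dx (virialWeight X L Y Z)) p| ≤ K / X ^ 2) ∧
    ∀ p, p ∉ box3 (2 * L) (2 * Y) (2 * Z) → lap3 (dx (virialWeight X L Y Z)) p = 0 := by
  obtain ⟨C, hC, h1, h2⟩ := exists_bound_deriv_cutoff
  refine ⟨6 * C, by linarith, fun X L Y Z hX hXL hXY hXZ => ?_⟩
  have hY := hX.trans_le hXY
  have hZ := hX.trans_le hXZ
  have hL := hX.trans_le hXL
  have sX := contDiff_scaledCutoff X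
  have sY := contDiff_scaledCutoff Y
  have sZ := contDiff_scaledCutoff Z
  have sL := contDiff_scaledCutoff L
  have sA := contDiff_truncPrim X L
  have ratio : X / L ≤ 1 := (div_le_one hL).2 hXL
  have dA : ∀ x, |deriv (truncPrim X L) x| ≤ 2 := by
    intro x
    rw [deriv_truncPrim hX]
    refine (abs_sub _ _).trans ?_
    rw [abs_mul, abs_of_nonneg (div_pos hX hL).le]
    have a1 := abs_scaledCutoff_le_one X x
    have a2 := abs_scaledCutoff_le_one L x
    have a3 := abs_nonneg (scaledCutoff L x)
    nlinarith [div_pos hX hL]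
  have dA3 : ∀ x, |deriv (deriv (deriv (truncPrim X L))) x| ≤ 2 * C / X ^ 2 := by
    intro x
    have e : deriv (deriv (deriv (truncPrim X L))) x
        = deriv (deriv (scaledCutoff X)) x - X / L * deriv (deriv (scaledCutoff L)) x := by
      have e1 : deriv (deriv (truncPrim X L))
          = fun x => deriv (scaledCutoff X) x - X / L * deriv (scaledCutoff L) x := by
        funext y
        rw [deriv_truncPrim hX, deriv_fun_sub (sX.differentiable (by simp) y)
          ((sL.differentiable (by simp) y).const_mul _), deriv_const_mul_field]
      rw [e1, deriv_fun_sub (sX.deriv_infty.differentiable (by simp) x)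
          ((sL.deriv_infty.differentiable (by simp) x).const_mul _), deriv_const_mul_field]
    rw [e]
    refine (abs_sub _ _).trans ?_
    rw [abs_mul, abs_of_nonneg (div_pos hX hL).le]
    have a1 := abs_deriv_deriv_scaledCutoff_le h2 hX x
    have a2 := abs_deriv_deriv_scaledCutoff_le h2 hL x
    have a3 : C / L ^ 2 ≤ C / X ^ 2 := by gcongr
    have a4 := mul_le_mul ratio (a2.trans a3) (abs_nonneg _) zero_le_one
    have a5 : 2 * C / X ^ 2 = C / X ^ 2 + C / X ^ 2 := by ring
    linarith
  have hd : ∀ {S : ℝ}, 0 < S → ∀ x, |deriv (scaledCutoff S) x| ≤ C / S :=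
    fun hS x => abs_deriv_scaledCutoff_le h1 hS x
  have hone := abs_scaledCutoff_le_one
  have hmono : ∀ {S : ℝ}, X ≤ S → C / S ≤ 6 * C / X := fun {S} hS => by
    have : C / S ≤ C / X := by gcongr
    have h' : 0 ≤ C / X := by positivity
    have h6 : 6 * C / X = 6 * (C / X) := by ring
    linarith
  refine ⟨fun p => ⟨?_, ?_, ?_⟩, fun p => ?_, fun p => ?_, fun p => ?_, fun p hp => ?_⟩
  · rw [boxCutoff, dx_tensor sX sY sZ]
    refine (abs_tensor_le (hd hX _) (hone _ _) (hone _ _)).trans ?_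
    simpa using hmono le_rfl
  · rw [boxCutoff, dy_tensor sX sY sZ]
    refine (abs_tensor_le (hone _ _) (hd hY _) (hone _ _)).trans ?_
    simpa using hmono hXY
  · rw [boxCutoff, dz_tensor sX sY sZ]
    refine (abs_tensor_le (hone _ _) (hone _ _) (hd hZ _)).trans ?_
    simpa using hmono hXZ
  · rw [virialWeight, dy_tensor sA sY sZ]
    refine (abs_tensor_le (abs_truncPrim_le hX _) (hd hY _) (hone _ _)).trans ?_
    have : 0 ≤ C * (X / Y) := by positivity
    have e : 4 * X * (C / Y) * 1 = 4 * (C * (X / Y)) := by ring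
    linarith
  · rw [virialWeight, dz_tensor sA sY sZ]
    refine (abs_tensor_le (abs_truncPrim_le hX _) (hone _ _) (hd hZ _)).trans ?_
    have : 0 ≤ C * (X / Z) := by positivity
    have e : 4 * X * 1 * (C / Z) = 4 * (C * (X / Z)) := by ring
    linarith
  · rw [virialWeight, lap3_dx_tensor sA sY sZ]
    have b1 := abs_tensor_le (p := p) (dA3 _) (hone Y _) (hone Z _)
    have b2 := abs_tensor_le (p := p) (dA _) (abs_deriv_deriv_scaledCutoff_le h2 hY _) (hone Z _)
    have b3 := abs_tensor_le (p := p) (dA _) (hone Y _) (abs_deriv_deriv_scaledCutoff_le h2 hZ _)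
    have c2 : C / Y ^ 2 ≤ C / X ^ 2 := by gcongr
    have c3 : C / Z ^ 2 ≤ C / X ^ 2 := by gcongr
    refine (abs_add_three _ _ _).trans ((add_le_add (add_le_add b1 b2) b3).trans ?_)
    have e1 : 2 * C / X ^ 2 = 2 * (C / X ^ 2) := by ring
    have e2 : 6 * C / X ^ 2 = 6 * (C / X ^ 2) := by ring
    linarith
  · have hzero : ∀ {A : ℝ → ℝ} {S : ℝ}, (∀ x, S < |x| → A x = 0) →
        ∀ x, S < |x| → deriv A x = 0 := by
      intro A S hA x hx
      have ev : A =ᶠ[nhds x] fun _ => 0 := by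
        filter_upwards [(isOpen_lt continuous_const continuous_abs).mem_nhds hx] with y hy
        exact hA y hy
      rw [ev.deriv_eq, deriv_const]
    have zA := hzero fun x => truncPrim_eq_zero (x := x) hX hXL
    have zY := fun x => scaledCutoff_eq_zero (x := x) hY
    have zZ := fun x => scaledCutoff_eq_zero (x := x) hZ
    rw [virialWeight, lap3_dx_tensor sA sY sZ, tensor_eq_zero (hzero (hzero zA)) zY zZ hp,
      tensor_eq_zero zA (hzero (hzero zY)) zZ hp, tensor_eq_zero zA zY (hzero (hzero zZ)) hp]
    simp

end Weights

section Sobolev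

theorem norm_fderiv_le_sum (f : ℝ × ℝ × ℝ → ℝ) (p : ℝ × ℝ × ℝ) :
    ‖fderiv ℝ f p‖ ≤ |dx f p| + |dy f p| + |dz f p| := by
  refine ContinuousLinearMap.opNorm_le_bound _ (by positivity) fun v => ?_
  have e : v = v.1 • ((1 : ℝ), (0 : ℝ), (0 : ℝ)) + v.2.1 • ((0 : ℝ), (1 : ℝ), (0 : ℝ))
      + v.2.2 • ((0 : ℝ), (0 : ℝ), (1 : ℝ)) := by
    ext <;> simp
  have h1 : |v.1| ≤ ‖v‖ := norm_fst_le v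
  have h2 : |v.2.1| ≤ ‖v‖ := (norm_fst_le v.2).trans (norm_snd_le v)
  have h3 : |v.2.2| ≤ ‖v‖ := (norm_snd_le v.2).trans (norm_snd_le v)
  have e' : fderiv ℝ f p v = v.1 * dx f p + v.2.1 * dy f p + v.2.2 * dz f p := by
    conv_lhs => rw [e]
    simp only [map_add, map_smul, smul_eq_mul]
    rfl
  rw [e', Real.norm_eq_abs]
  refine (abs_add_three _ _ _).trans ?_
  rw [abs_mul, abs_mul, abs_mul]
  nlinarith [abs_nonneg (dx f p), abs_nonneg (dy f p), abs_nonneg (dz f p)]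

/-- The Gagliardo–Nirenberg–Sobolev inequality `‖f‖_{3/2} ≲ ‖∇f‖_1` on `ℝ³`. -/
theorem exists_gagliardo_nirenberg : ∃ C : ℝ, 0 ≤ C ∧ ∀ f : ℝ × ℝ × ℝ → ℝ, ContDiff ℝ ∞ f →
    HasCompactSupport f →
    ∫ p, |f p| ^ (3 / 2 : ℝ) ≤ C * (∫ p, (|dx f p| + |dy f p| + |dz f p|)) ^ (3 / 2 : ℝ) := by
  have hconj : Real.HolderConjugate (Module.finrank ℝ (ℝ × ℝ × ℝ)) (3 / 2) := by
    have : Module.finrank ℝ (ℝ × ℝ × ℝ) = 3 := by simp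
    rw [this, Real.holderConjugate_iff]
    norm_num
  refine ⟨lintegralPowLePowLIntegralFDerivConst (volume : Measure (ℝ × ℝ × ℝ)) (3 / 2),
    NNReal.coe_nonneg _, fun f hf hc => ?_⟩
  have gns := lintegral_pow_le_pow_lintegral_fderiv (volume : Measure (ℝ × ℝ × ℝ))
    (hf.of_le (by simp)) hc hconj
  have hdint : Integrable fun p => |dx f p| + |dy f p| + |dz f p| :=
    ((integrable_dirDeriv hf hc _).abs.add (integrable_dirDeriv hf hc _).abs).add
      (integrable_dirDeriv hf hc _).abs
  have hgrad : ∫⁻ p, ‖fderiv ℝ f p‖ₑ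
      ≤ ENNReal.ofReal (∫ p, (|dx f p| + |dy f p| + |dz f p|)) := by
    rw [ofReal_integral_eq_lintegral_ofReal hdint (.of_forall fun p => by positivity)]
    refine lintegral_mono fun p => ?_
    rw [← ofReal_norm]
    exact ENNReal.ofReal_le_ofReal (norm_fderiv_le_sum f p)
  have hnn : 0 ≤ ∫ p, (|dx f p| + |dy f p| + |dz f p|) :=
    integral_nonneg fun p => by positivity
  have hcont : Continuous fun p => |f p| ^ (3 / 2 : ℝ) :=
    hf.continuous.abs.rpow_const fun _ => Or.inr (by norm_num)
  rw [integral_eq_lintegral_of_nonneg_ae (.of_forall fun p => by positivity)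
    hcont.aestronglyMeasurable]
  refine ENNReal.toReal_le_of_le_ofReal (by positivity) ?_
  rw [ENNReal.ofReal_mul (NNReal.coe_nonneg _), ENNReal.ofReal_coe_nnreal,
    ← ENNReal.ofReal_rpow_of_nonneg hnn (by norm_num)]
  refine le_trans (le_of_eq ?_) (gns.trans (by gcongr))
  refine lintegral_congr fun p => ?_
  rw [← ENNReal.ofReal_rpow_of_nonneg (abs_nonneg _) (by norm_num), ← ofReal_norm,
    Real.norm_eq_abs]

end Sobolev

section Rates

/-- A smooth function on `ℝ³` with `‖U‖₂² ≤ m` and `‖∇U‖₂² ≤ m`. -/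
structure H1Bounded (m : ℝ) (U : ℝ × ℝ × ℝ → ℝ) : Prop where
  smooth : ContDiff ℝ ∞ U
  sq_integrable : Integrable fun p => U p * U p
  dx_integrable : Integrable fun p => dx U p * dx U p
  dy_integrable : Integrable fun p => dy U p * dy U p
  dz_integrable : Integrable fun p => dz U p * dz U p
  sq_le : ∫ p, U p * U p ≤ m
  grad_le : ∫ p, (dx U p * dx U p + dy U p * dy U p + dz U p * dz U p) ≤ m

variable {m : ℝ} {U : ℝ × ℝ × ℝ → ℝ}

theorem H1Bounded.grad_integrable (h : H1Bounded m U) :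
    Integrable fun p => dx U p * dx U p + dy U p * dy U p + dz U p * dz U p :=
  (h.dx_integrable.add h.dy_integrable).add h.dz_integrable

theorem H1Bounded.nonneg (h : H1Bounded m U) : 0 ≤ m :=
  (integral_nonneg fun p => mul_self_nonneg (U p)).trans h.sq_le

theorem abs_mul_le_weighted {δ : ℝ} (hδ : 0 < δ) (a b : ℝ) :
    2 * |a * b| ≤ δ * (b * b) + 1 / δ * (a * a) := by
  have h : 0 ≤ (δ * |b| - |a|) ^ 2 / δ := by positivity
  have e : (δ * |b| - |a|) ^ 2 / δ = δ * |b| ^ 2 + 1 / δ * |a| ^ 2 - 2 * (|a| * |b|) := by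
    field_simp
    ring
  rw [e, sq_abs, sq_abs] at h
  rw [abs_mul]
  linarith

/-- The localized cubic term is controlled by the localized mass at twice the scale. -/
theorem exists_cubic_bound (m : ℝ) (hm : 0 ≤ m) : ∃ K : ℝ, 1 ≤ K ∧
    ∀ U : ℝ × ℝ × ℝ → ℝ, H1Bounded m U → ∀ X Y Z δ : ℝ, 1 ≤ X → X ≤ Y → X ≤ Z → 0 < δ →
      ∫ p, |U p| ^ 3 * boxCutoff X Y Z p
        ≤ K * (δ + (∫ p, U p * U p * boxCutoff (2 * X) (2 * Y) (2 * Z) p) / δ + 1 / X) := by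
  obtain ⟨C, hC, gns⟩ := exists_gagliardo_nirenberg
  obtain ⟨k, hk, hw⟩ := exists_weight_bound
  set M : ℝ := (4 + 3 * k) * m with hM
  refine ⟨1 + C * M ^ (1 / 2 : ℝ) * (3 + m + 3 * k * m), ?_, ?_⟩
  · have : 0 ≤ C * M ^ (1 / 2 : ℝ) * (3 + m + 3 * k * m) := by positivity
    linarith
  intro U hU X Y Z δ hX hXY hXZ hδ
  have X0 : 0 < X := by linarith
  have Y0 : 0 < Y := by linarith
  have Z0 : 0 < Z := by linarith
  set q := boxCutoff (2 * X) (2 * Y) (2 * Z) with hq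
  have sU := hU.smooth
  have sq : ContDiff ℝ ∞ q := contDiff_boxCutoff _ _ _
  have cq : HasCompactSupport q :=
    hasCompactSupport_boxCutoff (by linarith) (by linarith) (by linarith)
  set F := ∫ p, U p * U p * q p with hF
  have iF : Integrable fun p => U p * U p * q p :=
    Continuous.integrable_of_hasCompactSupport
      ((sU.continuous.mul sU.continuous).mul sq.continuous) cq.mul_left
  have F0 : 0 ≤ F := integral_nonneg fun p => mul_nonneg (mul_self_nonneg _) (boxCutoff_nonneg _ _ _ p)
  have Fm : F ≤ m := (integral_mono iF hU.sq_integrable fun p =>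
    mul_le_of_le_one_right (mul_self_nonneg _) (boxCutoff_le_one _ _ _ p)).trans hU.sq_le
  have sf : ContDiff ℝ ∞ fun p => U p * U p * q p := (sU.mul sU).mul sq
  have cf : HasCompactSupport fun p => U p * U p * q p := cq.mul_left
  set s := ∫ p, (|dx (fun p => U p * U p * q p) p| + |dy (fun p => U p * U p * q p) p|
    + |dz (fun p => U p * U p * q p) p|) with hs
  have s0 : 0 ≤ s := integral_nonneg fun p => by positivity
  have sle : ∀ d : ℝ, 0 < d → s ≤ d * m + 3 / d * F + 3 * k / X * m := by
    intro d hd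
    have dir : ∀ (v : ℝ × ℝ × ℝ) (p : ℝ × ℝ × ℝ), |dirDeriv v q p| ≤ k / (2 * X) →
        |dirDeriv v (fun p => U p * U p * q p) p|
          ≤ d * (dirDeriv v U p * dirDeriv v U p) + 1 / d * (U p * U p * q p)
            + k / X * (U p * U p) := by
      intro v p hv
      rw [dirDeriv_mul (sU.mul sU) sq, dirDeriv_mul sU sU]
      have q0 := boxCutoff_nonneg (2 * X) (2 * Y) (2 * Z) p
      have q1 := boxCutoff_le_one (2 * X) (2 * Y) (2 * Z) p
      rw [← hq] at q0 q1
      have t1 := mul_le_mul_of_nonneg_right (abs_mul_le_weighted hd (U p) (dirDeriv v U p)) q0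
      have t2 : d * (dirDeriv v U p * dirDeriv v U p) * q p
          ≤ d * (dirDeriv v U p * dirDeriv v U p) :=
        mul_le_of_le_one_right (mul_nonneg hd.le (mul_self_nonneg _)) q1
      have t3 : |U p * U p * dirDeriv v q p| ≤ k / X * (U p * U p) := by
        rw [abs_mul, abs_of_nonneg (mul_self_nonneg (U p)), mul_comm]
        refine mul_le_mul_of_nonneg_right (hv.trans ?_) (mul_self_nonneg _)
        gcongr
        linarith
      have t4 : |(dirDeriv v U p * U p + U p * dirDeriv v U p) * q p|
          = 2 * |U p * dirDeriv v U p| * q p := by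
        rw [abs_mul, abs_of_nonneg q0, mul_comm (dirDeriv v U p), ← two_mul, abs_mul,
          abs_of_pos (zero_lt_two (α := ℝ))]
      refine (abs_add_le _ _).trans ?_
      rw [t4]
      linarith
    have hb := (hw (2 * X) (2 * X) (2 * Y) (2 * Z) (by linarith) le_rfl (by linarith)
      (by linarith)).1
    have step : s ≤ ∫ p, (d * (dx U p * dx U p + dy U p * dy U p + dz U p * dz U p)
        + 3 / d * (U p * U p * q p) + 3 * k / X * (U p * U p)) := by
      refine integral_mono ?_ ?_ fun p => ?_
      · exact ((integrable_dirDeriv sf cf _).abs.add (integrable_dirDeriv sf cf _).abs).add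
          (integrable_dirDeriv sf cf _).abs
      · exact ((hU.grad_integrable.const_mul _).add (iF.const_mul _)).add
          (hU.sq_integrable.const_mul _)
      · have a1 := dir (1, 0, 0) p (hb p).1
        have a2 := dir (0, 1, 0) p (hb p).2.1
        have a3 := dir (0, 0, 1) p (hb p).2.2
        have e1 : 3 / d * (U p * U p * q p) = 3 * (1 / d * (U p * U p * q p)) := by ring
        have e2 : 3 * k / X * (U p * U p) = 3 * (k / X * (U p * U p)) := by ring
        simp only [e1, e2]
        linarith
    refine step.trans ?_
    rw [integral_add (f := fun p => d * (dx U p * dx U p + dy U p * dy U p + dz U p * dz U p)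
        + 3 / d * (U p * U p * q p)) ((hU.grad_integrable.const_mul _).add (iF.const_mul _))
        (hU.sq_integrable.const_mul _), integral_add (hU.grad_integrable.const_mul _)
        (iF.const_mul _), integral_const_mul, integral_const_mul, integral_const_mul]
    have g1 := hU.grad_le
    have g2 := hU.sq_le
    gcongr
  have sM : s ≤ M := by
    have h1 := sle 1 one_pos
    have h2 : 3 * k / X * m ≤ 3 * k * m := by
      have : 3 * k / X ≤ 3 * k := div_le_self (by linarith) hX
      gcongr
    rw [hM]
    linarith
  have split : s ^ (3 / 2 : ℝ) ≤ M ^ (1 / 2 : ℝ) * s := by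
    have : s ^ (3 / 2 : ℝ) = s ^ (1 / 2 : ℝ) * s := by
      rcases s0.eq_or_lt with h | h
      · rw [← h]
        simp
      · rw [show (3 / 2 : ℝ) = 1 / 2 + 1 by norm_num, Real.rpow_add_one h.ne']
    rw [this]
    gcongr
  have cube : ∫ p, |U p| ^ 3 * boxCutoff X Y Z p ≤ ∫ p, |U p * U p * q p| ^ (3 / 2 : ℝ) := by
    refine integral_mono ?_ ?_ fun p => ?_
    · exact Continuous.integrable_of_hasCompactSupport
        ((sU.continuous.abs.pow 3).mul (contDiff_boxCutoff X Y Z).continuous)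
        (hasCompactSupport_boxCutoff X0 Y0 Z0).mul_left
    · refine Continuous.integrable_of_hasCompactSupport
        (sf.continuous.abs.rpow_const fun _ => Or.inr (by norm_num)) ?_
      exact cf.comp_left (g := fun x : ℝ => |x| ^ (3 / 2 : ℝ)) (by
        rw [abs_zero, Real.zero_rpow (by norm_num)])
    · dsimp only
      by_cases hp : p ∈ box3 (2 * X) (2 * Y) (2 * Z)
      · have q1 : q p = 1 := boxCutoff_eq_one (by linarith) (by linarith) (by linarith) hp
        have e : |U p * U p * q p| ^ (3 / 2 : ℝ) = |U p| ^ 3 := by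
          rw [q1, mul_one, abs_mul, ← pow_two, ← Real.rpow_natCast, ← Real.rpow_natCast,
            ← Real.rpow_mul (abs_nonneg _)]
          norm_num
        rw [e]
        exact mul_le_of_le_one_right (by positivity) (boxCutoff_le_one _ _ _ p)
      · rw [boxCutoff_eq_zero X0 Y0 Z0 hp, mul_zero]
        positivity
  refine cube.trans ((gns _ sf cf).trans ?_)
  rw [← hs]
  have main : C * s ^ (3 / 2 : ℝ) ≤ C * M ^ (1 / 2 : ℝ) * s := by
    rw [mul_assoc]
    gcongr
  refine main.trans ?_
  have hFd : 0 ≤ F / δ := by positivity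
  have hX' : 0 ≤ 1 / X := by positivity
  have s3 : s ≤ (3 + m + 3 * k * m) * (δ + F / δ + 1 / X) := by
    have h1 := sle δ hδ
    have e1 : 3 / δ * F = 3 * (F / δ) := by ring
    have e2 : 3 * k / X * m = 3 * k * m * (1 / X) := by ring
    rw [e1, e2] at h1
    have hkm : 0 ≤ k * m := by positivity
    nlinarith [mul_nonneg hm hFd, mul_nonneg hkm hFd, mul_nonneg hkm hδ.le, mul_nonneg hm hX',
      mul_nonneg hkm hX', hδ]
  have hpos : 0 ≤ C * M ^ (1 / 2 : ℝ) := by positivity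
  have s4 := mul_le_mul_of_nonneg_left s3 hpos
  have : 0 ≤ δ + F / δ + 1 / X := by positivity
  linarith

end Rates

section VirialRates

variable {m : ℝ} {U : ℝ × ℝ × ℝ → ℝ}

theorem abs_integral_mul_le_of_box (hU : H1Bounded m U) {g : ℝ × ℝ × ℝ → ℝ} {c A B D : ℝ}
    (hc : 0 ≤ c) (hA : 0 < A) (hB : 0 < B) (hD : 0 < D) (hg : ∀ p, |g p| ≤ c)
    (hs : ∀ p, p ∉ box3 A B D → g p = 0) :
    |∫ p, U p * g p| ≤ c * ((m + 1) * √(8 * (A * B * D))) := by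
  set V := 8 * (A * B * D) with hV
  have V0 : 0 < V := by positivity
  have κ0 : 0 < √V := Real.sqrt_pos.2 V0
  have hbox : MeasurableSet (box3 A B D) := (isCompact_box3 A B D).measurableSet
  have hind : Integrable ((box3 A B D).indicator fun _ => (1 : ℝ)) :=
    (integrable_indicator_iff hbox).2
      (integrableOn_const (isCompact_box3 A B D).measure_lt_top.ne)
  have hpt : ∀ p, ‖U p * g p‖
      ≤ c * (√V * (U p * U p) + 1 / √V * (box3 A B D).indicator (fun _ => (1 : ℝ)) p) := by
    intro p
    by_cases hp : p ∈ box3 A B D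
    · have h1 := abs_mul_le_weighted κ0 1 (U p)
      have h2 := hg p
      rw [one_mul] at h1
      rw [Set.indicator_of_mem hp, Real.norm_eq_abs, abs_mul, mul_comm |U p|]
      exact mul_le_mul h2 (by linarith [abs_nonneg (U p)]) (abs_nonneg _) hc
    · rw [hs p hp, mul_zero, norm_zero, Set.indicator_of_notMem hp]
      have := mul_self_nonneg (U p)
      positivity
  have key := norm_integral_le_of_norm_le
    (((hU.sq_integrable.const_mul (√V)).add (hind.const_mul (1 / √V))).const_mul c)
    (.of_forall hpt)
  rw [Real.norm_eq_abs] at key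
  refine key.trans ?_
  simp only [Pi.add_apply]
  rw [integral_const_mul, integral_add (hU.sq_integrable.const_mul _) (hind.const_mul _),
    integral_const_mul, integral_const_mul, integral_indicator hbox, setIntegral_const,
    measureReal_box3 hA.le hB.le hD.le, ← hV, smul_eq_mul, mul_one]
  have e : 1 / √V * V = √V := by
    rw [one_div_mul_eq_div, Real.div_sqrt]
  rw [e]
  have := hU.sq_le
  refine mul_le_mul_of_nonneg_left ?_ hc
  nlinarith

theorem sqrt_volume_double {L Y Z : ℝ} :
    √(8 * (2 * L * (2 * Y) * (2 * Z))) = 8 * √(L * Y * Z) := by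
  rw [show 8 * (2 * L * (2 * Y) * (2 * Z)) = 8 ^ 2 * (L * Y * Z) by ring,
    Real.sqrt_mul (by norm_num), Real.sqrt_sq (by norm_num)]

theorem integrable_mul_of_abs_le_const {f g : ℝ × ℝ × ℝ → ℝ} {c : ℝ} (hf : Integrable f)
    (hg : Continuous g) (h : ∀ p, |g p| ≤ c) : Integrable fun p => f p * g p :=
  hf.mul_bdd hg.aestronglyMeasurable (.of_forall h)

/-- The weighted momentum `∫ U W` is small compared with time. -/
theorem H1Bounded.abs_integral_mul_virialWeight_le (hU : H1Bounded m U) {X L Y Z : ℝ} (hX : 0 < X)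
    (hL : X ≤ L) (hY : 0 < Y) (hZ : 0 < Z) :
    |∫ p, U p * virialWeight X L Y Z p| ≤ 32 * (m + 1) * (X * √(L * Y * Z)) := by
  have h := abs_integral_mul_le_of_box hU (c := 4 * X) (by linarith) (by linarith)
    (by linarith) (by linarith) (abs_virialWeight_le hX)
    (fun _ => virialWeight_eq_zero hX hL hY hZ)
  rw [sqrt_volume_double] at h
  linarith

theorem H1Bounded.abs_integral_sq_mul_virialWeight_le (hU : H1Bounded m U) {X L Y Z : ℝ}
    (hX : 0 < X) : |∫ p, U p * U p * virialWeight X L Y Z p| ≤ 4 * m * X := by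
  have h := norm_integral_le_of_norm_le (hU.sq_integrable.mul_const (4 * X))
    (f := fun p => U p * U p * virialWeight X L Y Z p) (.of_forall fun p => by
      rw [Real.norm_eq_abs, abs_mul, abs_of_nonneg (mul_self_nonneg (U p))]
      exact mul_le_mul_of_nonneg_left (abs_virialWeight_le hX p) (mul_self_nonneg _))
  rw [integral_mul_const] at h
  have := hU.sq_le
  rw [Real.norm_eq_abs] at h
  nlinarith

/-- The local mass is controlled by the rate of change of the weighted momentum. -/
theorem exists_mass_rate_bound (m : ℝ) : ∃ K : ℝ, 1 ≤ K ∧ ∀ U : ℝ × ℝ × ℝ → ℝ,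
    H1Bounded m U → ∀ X L Y Z : ℝ, 0 < X → X ≤ L → X ≤ Y → X ≤ Z →
      ∫ p, U p * U p * boxCutoff X Y Z p
        ≤ 2 * (∫ p, (1 / 2 * (U p * U p * dx (virialWeight X L Y Z) p)
            + U p * lap3 (dx (virialWeight X L Y Z)) p))
          + K * (X / L + √(L * Y * Z) / X ^ 2) := by
  obtain ⟨k, hk, hw⟩ := exists_weight_bound
  refine ⟨1 + |m| + 16 * k * (|m| + 1), ?_, ?_⟩
  · have : 0 ≤ |m| + 16 * k * (|m| + 1) := by positivity
    linarith
  intro U hU X L Y Z hX hXL hXY hXZ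
  have L0 : 0 < L := by linarith
  have Y0 : 0 < Y := by linarith
  have Z0 : 0 < Z := by linarith
  have m0 := hU.nonneg
  obtain ⟨-, -, -, hlap, hlap0⟩ := hw X L Y Z hX hXL hXY hXZ
  set W := virialWeight X L Y Z with hW
  have sW : ContDiff ℝ ∞ W := contDiff_virialWeight _ _ _ _
  have sl : ContDiff ℝ ∞ (lap3 (dx W)) := (sW.dirDeriv _).lap3
  have iQ : ∀ A B D : ℝ, Integrable fun p => U p * U p * boxCutoff A B D p := fun A B D =>
    integrable_mul_of_abs_le_const (c := 1) hU.sq_integrable (contDiff_boxCutoff A B D).continuous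
      fun p => by rw [abs_of_nonneg (boxCutoff_nonneg _ _ _ p)]; exact boxCutoff_le_one _ _ _ p
  have il : Integrable fun p => U p * lap3 (dx W) p :=
    Continuous.integrable_of_hasCompactSupport (hU.smooth.continuous.mul sl.continuous)
      (HasCompactSupport.mul_left (.intro (isCompact_box3 _ _ _) fun p hp => hlap0 p hp))
  have el := abs_integral_mul_le_of_box hU (c := k / X ^ 2) (by positivity) (by linarith)
    (by linarith) (by linarith) hlap hlap0
  rw [sqrt_volume_double] at el
  have e : ∫ p, (1 / 2 * (U p * U p * dx W p) + U p * lap3 (dx W) p)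
      = 1 / 2 * (∫ p, U p * U p * boxCutoff X Y Z p)
        - X / L / 2 * (∫ p, U p * U p * boxCutoff L Y Z p) + ∫ p, U p * lap3 (dx W) p := by
    rw [← integral_const_mul, ← integral_const_mul, ← integral_sub ((iQ _ _ _).const_mul _)
      ((iQ _ _ _).const_mul _), ← integral_add (f := fun p => 1 / 2 * (U p * U p * boxCutoff X Y Z p)
        - X / L / 2 * (U p * U p * boxCutoff L Y Z p)) (((iQ _ _ _).const_mul _).sub
      ((iQ _ _ _).const_mul _)) il]
    congr with p
    rw [hW, dx_virialWeight hX]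
    ring
  rw [e]
  have tail : ∫ p, U p * U p * boxCutoff L Y Z p ≤ m :=
    (integral_mono (iQ _ _ _) hU.sq_integrable fun p =>
      mul_le_of_le_one_right (mul_self_nonneg _) (boxCutoff_le_one _ _ _ p)).trans hU.sq_le
  have hXL' : 0 ≤ X / L := by positivity
  have tail' := mul_le_mul_of_nonneg_left tail hXL'
  have hs : 0 ≤ √(L * Y * Z) / X ^ 2 := by positivity
  have lo := (abs_le.1 el).1
  have e2 : k / X ^ 2 * ((m + 1) * (8 * √(L * Y * Z)))
      = 8 * k * (m + 1) * (√(L * Y * Z) / X ^ 2) := by ring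
  rw [e2] at lo
  rw [abs_of_nonneg m0]
  have hkm : 0 ≤ k * (m + 1) := by positivity
  nlinarith [mul_nonneg hkm hXL', mul_nonneg m0 hs]

set_option maxHeartbeats 1000000 in
/-- The local energy is controlled by the rate of change of the weighted mass, up to the local
mass at twice the scale. -/
theorem exists_energy_rate_bound (m : ℝ) (hm : 0 ≤ m) : ∃ K : ℝ, 1 ≤ K ∧ ∀ U : ℝ × ℝ × ℝ → ℝ,
    H1Bounded m U → ∀ X L Y Z δ : ℝ, 1 ≤ X → X ≤ L → L ≤ Y → L ≤ Z → 0 < δ →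
      ∫ p, (dx U p * dx U p + dy U p * dy U p + dz U p * dz U p) * boxCutoff X Y Z p
        ≤ -2 * (∫ p, (1 / 2 * (U p * U p * lap3 (dx (virialWeight X L Y Z)) p)
            + 1 / 3 * (U p * U p * U p * dx (virialWeight X L Y Z) p)
            - dx (virialWeight X L Y Z) p * (3 / 2 * (dx U p * dx U p)
              + 1 / 2 * (dy U p * dy U p) + 1 / 2 * (dz U p * dz U p))
            - dx U p * (dy (virialWeight X L Y Z) p * dy U p
              + dz (virialWeight X L Y Z) p * dz U p)))
          + K * (δ + (∫ p, U p * U p * boxCutoff (2 * X) (2 * Y) (2 * Z) p) / δ + 1 / X + X / L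
            + X / Y + X / Z) := by
  obtain ⟨k, hk, hw⟩ := exists_weight_bound
  obtain ⟨c, hc, hcub⟩ := exists_cubic_bound m hm
  refine ⟨2 * c + 2 * c * (m + 2) + 3 * m + 2 * k * m, ?_, ?_⟩
  · have : 0 ≤ 2 * c * (m + 2) + 3 * m + 2 * k * m := by positivity
    linarith
  intro U hU X L Y Z δ hX hXL hLY hLZ hδ
  have X0 : 0 < X := by linarith
  have L0 : 0 < L := by linarith
  have Y0 : 0 < Y := by linarith
  have Z0 : 0 < Z := by linarith
  have sU := hU.smooth
  obtain ⟨-, hwy, hwz, hlap, hlap0⟩ := hw X L Y Z X0 hXL (by linarith) (by linarith)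
  have c1 := hcub U hU X Y Z δ hX (by linarith) (by linarith) hδ
  have c2 := hcub U hU L Y Z 1 (by linarith) hLY hLZ one_pos
  set W := virialWeight X L Y Z with hW
  set G : ℝ × ℝ × ℝ → ℝ := fun p => dx U p * dx U p + dy U p * dy U p + dz U p * dz U p with hG
  set F := ∫ p, U p * U p * boxCutoff (2 * X) (2 * Y) (2 * Z) p with hF
  have sW : ContDiff ℝ ∞ W := contDiff_virialWeight _ _ _ _
  have cW : HasCompactSupport W := hasCompactSupport_virialWeight X0 hXL Y0 Z0
  have bQ : ∀ (A B D : ℝ) (p : ℝ × ℝ × ℝ), |boxCutoff A B D p| ≤ 1 := fun A B D p => by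
    rw [abs_of_nonneg (boxCutoff_nonneg _ _ _ p)]; exact boxCutoff_le_one _ _ _ p
  have i2 : ∀ A B D : ℝ, Integrable fun p => U p * U p * boxCutoff A B D p := fun A B D =>
    integrable_mul_of_abs_le_const hU.sq_integrable (contDiff_boxCutoff A B D).continuous
      (bQ A B D)
  have i3 : ∀ A : ℝ, 0 < A → Integrable fun p => |U p| ^ 3 * boxCutoff A Y Z p := fun A hA =>
    Continuous.integrable_of_hasCompactSupport
      ((sU.continuous.abs.pow 3).mul (contDiff_boxCutoff A Y Z).continuous)
      (hasCompactSupport_boxCutoff hA Y0 Z0).mul_left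
  have iG : Integrable fun p => G p * boxCutoff X Y Z p :=
    integrable_mul_of_abs_le_const hU.grad_integrable (contDiff_boxCutoff X Y Z).continuous
      (bQ X Y Z)
  set E : ℝ × ℝ × ℝ → ℝ := fun p => 1 / 2 * (U p * U p * lap3 (dx W) p)
    + 1 / 3 * (U p * U p * U p * dx W p)
    - dx W p * (3 / 2 * (dx U p * dx U p) + 1 / 2 * (dy U p * dy U p) + 1 / 2 * (dz U p * dz U p))
    - dx U p * (dy W p * dy U p + dz W p * dz U p) with hE
  have cU := sU.continuous
  have cx := (sU.dirDeriv (1, 0, 0)).continuous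
  have cy := (sU.dirDeriv (0, 1, 0)).continuous
  have cz := (sU.dirDeriv (0, 0, 1)).continuous
  have wx := (sW.dirDeriv (1, 0, 0)).continuous
  have wy := (sW.dirDeriv (0, 1, 0)).continuous
  have wz := (sW.dirDeriv (0, 0, 1)).continuous
  have wl := (sW.dirDeriv (1, 0, 0)).lap3.continuous
  have hl0 : HasCompactSupport (lap3 (dx W)) := .intro (isCompact_box3 _ _ _) fun p hp => hlap0 p hp
  have iE : Integrable E := by
    refine Continuous.integrable_of_hasCompactSupport (by fun_prop) ?_
    refine .sub (.sub (.add ?_ ?_) ?_) ?_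
    · exact (hl0.mul_left (f := fun p => U p * U p)).mul_left (f := fun _ => (1 / 2 : ℝ))
    · exact ((cW.dirDeriv (1, 0, 0)).mul_left (f := fun p => U p * U p * U p)).mul_left
        (f := fun _ => (1 / 3 : ℝ))
    · exact (cW.dirDeriv (1, 0, 0)).mul_right
    · exact HasCompactSupport.mul_left
        (((cW.dirDeriv (0, 1, 0)).mul_right).add ((cW.dirDeriv (0, 0, 1)).mul_right))
  have pt : ∀ p, G p * boxCutoff X Y Z p ≤ -2 * E p + k / X ^ 2 * (U p * U p)
      + (2 * (|U p| ^ 3 * boxCutoff X Y Z p) + 2 * (X / L) * (|U p| ^ 3 * boxCutoff L Y Z p))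
      + (3 * (X / L) + 2 * k * (X / Y + X / Z)) * G p := by
    intro p
    have q0 := boxCutoff_nonneg X Y Z p
    have l0 := boxCutoff_nonneg L Y Z p
    have l1 := boxCutoff_le_one L Y Z p
    have hXL0 : 0 ≤ X / L := by positivity
    have hXY0 : 0 ≤ X / Y := by positivity
    have hXZ0 : 0 ≤ X / Z := by positivity
    have t1 : U p * U p * lap3 (dx W) p ≤ k / X ^ 2 * (U p * U p) := by
      have := (abs_le.1 (hlap p)).2
      nlinarith [mul_self_nonneg (U p)]
    have ew : dx W p = boxCutoff X Y Z p - X / L * boxCutoff L Y Z p := dx_virialWeight X0 p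
    have u3 : |U p * U p * U p| = |U p| ^ 3 := by
      rw [abs_mul, abs_mul]
      ring
    have u3' := abs_le.1 u3.le
    have u30 : 0 ≤ |U p| ^ 3 := by positivity
    have t2 : 2 / 3 * (U p * U p * U p * dx W p)
        ≤ 2 * (|U p| ^ 3 * boxCutoff X Y Z p) + 2 * (X / L) * (|U p| ^ 3 * boxCutoff L Y Z p) := by
      rw [ew]
      have a1 := mul_le_mul_of_nonneg_right u3'.2 q0
      have a2 := mul_le_mul_of_nonneg_right u3'.1 (mul_nonneg hXL0 l0)
      nlinarith [mul_nonneg u30 q0, mul_nonneg u30 (mul_nonneg hXL0 l0)]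
    have x0 := mul_self_nonneg (dx U p)
    have y0 := mul_self_nonneg (dy U p)
    have z0 := mul_self_nonneg (dz U p)
    have t3 : G p * boxCutoff X Y Z p ≤ 2 * (dx W p * (3 / 2 * (dx U p * dx U p)
        + 1 / 2 * (dy U p * dy U p) + 1 / 2 * (dz U p * dz U p))) + 3 * (X / L) * G p := by
      rw [ew]
      have a1 : X / L * boxCutoff L Y Z p ≤ X / L := mul_le_of_le_one_right hXL0 l1
      have a2 : 0 ≤ X / L * boxCutoff L Y Z p := mul_nonneg hXL0 l0
      simp only [hG]
      nlinarith [mul_nonneg q0 x0, mul_le_mul_of_nonneg_right a1 x0,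
        mul_le_mul_of_nonneg_right a1 y0, mul_le_mul_of_nonneg_right a1 z0,
        mul_nonneg hXL0 y0, mul_nonneg hXL0 z0]
    have cross : ∀ {w a r : ℝ}, |w| ≤ r → a * a ≤ G p - dx U p * dx U p →
        -(2 * (dx U p * (w * a))) ≤ r * G p := by
      intro w a r hw ha
      have h1 := abs_mul_le_weighted one_pos (dx U p) a
      have h2 : -(dx U p * (w * a)) ≤ |w| * |dx U p * a| := by
        rw [← abs_mul]
        exact (neg_le_abs _).trans (le_of_eq (by ring_nf))
      have h3 : |w| * (2 * |dx U p * a|) ≤ r * G p :=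
        mul_le_mul hw (by linarith) (by positivity) ((abs_nonneg _).trans hw)
      linarith
    have t4 := cross (hwy p) (a := dy U p) (by simp only [hG]; linarith)
    have t5 := cross (hwz p) (a := dz U p) (by simp only [hG]; linarith)
    have g0 : 0 ≤ G p := by simp only [hG]; linarith
    have hk0 : 0 ≤ k * (X / Y + X / Z) * G p := by positivity
    simp only [hE]
    linarith
  have int := integral_mono iG ((((iE.const_mul (-2)).add
    (hU.sq_integrable.const_mul (k / X ^ 2))).add (((i3 X X0).const_mul 2).add
      ((i3 L L0).const_mul (2 * (X / L))))).add
        (hU.grad_integrable.const_mul (3 * (X / L) + 2 * k * (X / Y + X / Z)))) pt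
  refine int.trans ?_
  simp only [Pi.add_apply]
  rw [integral_add, integral_add, integral_add, integral_add, integral_const_mul,
    integral_const_mul, integral_const_mul, integral_const_mul, integral_const_mul]
  rotate_left
  · exact (i3 X X0).const_mul 2
  · exact (i3 L L0).const_mul _
  · exact iE.const_mul _
  · exact hU.sq_integrable.const_mul _
  · exact (iE.const_mul (-2)).add (hU.sq_integrable.const_mul (k / X ^ 2))
  · exact ((i3 X X0).const_mul 2).add ((i3 L L0).const_mul (2 * (X / L)))
  · exact ((iE.const_mul (-2)).add (hU.sq_integrable.const_mul (k / X ^ 2))).add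
      (((i3 X X0).const_mul 2).add ((i3 L L0).const_mul (2 * (X / L))))
  · exact hU.grad_integrable.const_mul _
  have F2 : ∫ p, U p * U p * boxCutoff (2 * L) (2 * Y) (2 * Z) p ≤ m :=
    (integral_mono (i2 _ _ _) hU.sq_integrable fun p =>
      mul_le_of_le_one_right (mul_self_nonneg _) (boxCutoff_le_one _ _ _ p)).trans hU.sq_le
  have F0 : 0 ≤ F := integral_nonneg fun p =>
    mul_nonneg (mul_self_nonneg _) (boxCutoff_nonneg _ _ _ p)
  have hL1 : 1 / L ≤ 1 := by
    rw [div_le_one L0]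
    linarith
  have c2' : ∫ p, |U p| ^ 3 * boxCutoff L Y Z p ≤ c * (m + 2) :=
    c2.trans (mul_le_mul_of_nonneg_left (by linarith) (by linarith))
  have e1 : k / X ^ 2 * ∫ p, U p * U p ≤ k * m * (1 / X) := by
    have h1 : k / X ^ 2 ≤ k * (1 / X) := by
      rw [mul_one_div]
      exact div_le_div_of_nonneg_left (by linarith) X0 (by nlinarith)
    have := mul_le_mul h1 hU.sq_le (integral_nonneg fun p => mul_self_nonneg (U p))
      (by positivity)
    linarith
  have aXL : 0 ≤ X / L := by positivity
  have aXY : 0 ≤ X / Y := by positivity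
  have aXZ : 0 ≤ X / Z := by positivity
  have aX : 0 ≤ 1 / X := by positivity
  have aF : 0 ≤ F / δ := by positivity
  have e2 := mul_le_mul_of_nonneg_left c2' (mul_nonneg zero_le_two aXL)
  have e3 := mul_le_mul_of_nonneg_left hU.grad_le
    (show 0 ≤ 3 * (X / L) + 2 * k * (X / Y + X / Z) by positivity)
  set S := δ + F / δ + 1 / X with hS
  have S0 : 0 ≤ S := by positivity
  have SX : 1 / X ≤ S := by linarith
  have km : 0 ≤ k * m := by positivity
  have cm : 0 ≤ c * (m + 2) := by positivity
  have b1 : 2 * c * S ≤ 2 * c * (S + X / L + X / Y + X / Z) := by gcongr; linarith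
  have b2 : 2 * (X / L) * (c * (m + 2)) ≤ 2 * c * (m + 2) * (S + X / L + X / Y + X / Z) := by
    nlinarith [mul_nonneg cm S0, mul_nonneg cm aXY, mul_nonneg cm aXZ]
  have b3 : 3 * (X / L) * m ≤ 3 * m * (S + X / L + X / Y + X / Z) := by
    nlinarith [mul_nonneg hm S0, mul_nonneg hm aXY, mul_nonneg hm aXZ]
  have b4 : k * m * (1 / X) + 2 * k * (X / Y + X / Z) * m
      ≤ 2 * k * m * (S + X / L + X / Y + X / Z) := by
    nlinarith [mul_nonneg km S0, mul_nonneg km aXL, mul_le_mul_of_nonneg_left SX km]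
  linarith

end VirialRates

section Time

/-- The spatial profile of `u` at time `t`. -/
def slice (u : ℝ → ℝ → ℝ → ℝ → ℝ) (t : ℝ) : ℝ × ℝ × ℝ → ℝ :=
  fun p => u t p.1 p.2.1 p.2.2

variable {u : ℝ → ℝ → ℝ → ℝ → ℝ} {t : ℝ}

theorem slice_px3 (h : ContDiff ℝ ∞ (slice u t)) : slice (px3 u) t = dx (slice u t) :=
  funext fun p => (dx_eq_deriv h p.1 p.2.1 p.2.2).symm

theorem slice_py3 (h : ContDiff ℝ ∞ (slice u t)) : slice (py3 u) t = dy (slice u t) :=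
  funext fun p => (dy_eq_deriv h p.1 p.2.1 p.2.2).symm

theorem slice_pz3 (h : ContDiff ℝ ∞ (slice u t)) : slice (pz3 u) t = dz (slice u t) :=
  funext fun p => (dz_eq_deriv h p.1 p.2.1 p.2.2).symm

namespace IsAdmissibleZK3

theorem contDiff_uncurry (hu : IsAdmissibleZK3 u) :
    ContDiff ℝ ∞ fun q : ℝ × ℝ × ℝ × ℝ => slice u q.1 q.2 :=
  hu.smooth

theorem contDiff_slice (hu : IsAdmissibleZK3 u) (t : ℝ) : ContDiff ℝ ∞ (slice u t) :=
  hu.contDiff_uncurry.comp (contDiff_const.prodMk contDiff_id)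

theorem pt3_eq (hu : IsAdmissibleZK3 u) (ht : 2 ≤ t) (p : ℝ × ℝ × ℝ) :
    pt3 u t p.1 p.2.1 p.2.2
      = -(dx (lap3 (slice u t)) p + slice u t p * dx (slice u t) p) := by
  have h := hu.contDiff_slice t
  have hx : slice (px3 (px3 u)) t = dx (dx (slice u t)) := by
    rw [slice_px3 (u := px3 u) (by rw [slice_px3 h]; exact h.dirDeriv _), slice_px3 h]
  have hy : slice (py3 (py3 u)) t = dy (dy (slice u t)) := by
    rw [slice_py3 (u := py3 u) (by rw [slice_py3 h]; exact h.dirDeriv _), slice_py3 h]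
  have hz : slice (pz3 (pz3 u)) t = dz (dz (slice u t)) := by
    rw [slice_pz3 (u := pz3 u) (by rw [slice_pz3 h]; exact h.dirDeriv _), slice_pz3 h]
  set v : ℝ → ℝ → ℝ → ℝ → ℝ := fun t' x' y' z' =>
    px3 (px3 u) t' x' y' z' + py3 (py3 u) t' x' y' z' + pz3 (pz3 u) t' x' y' z' with hv
  have hl : slice v t = lap3 (slice u t) := by
    funext q
    have := congrFun hx q
    have := congrFun hy q
    have := congrFun hz q
    simp only [slice, lap3, hv] at *
    linarith
  have h1 := congrFun (slice_px3 (u := v) (t := t) (by rw [hl]; exact h.lap3)) p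
  have h2 := congrFun (slice_px3 h) p
  have e := hu.eqn t p.1 p.2.1 p.2.2 ht
  rw [hl] at h1
  rw [← h1, ← h2]
  simp only [slice]
  linarith

/-- Square integrability of the derivatives of an admissible solution. -/
theorem integrable_sq (hu : IsAdmissibleZK3 u) (ht : 2 ≤ t) (l : List (Fin 4))
    (hc : Continuous (slice (D3 u l) t)) :
    Integrable fun p => slice (D3 u l) t p * slice (D3 u l) t p := by
  obtain ⟨C, hC⟩ := hu.decay l 2 t t ht
  have hdim : ((Module.finrank ℝ (ℝ × ℝ × ℝ) : ℕ) : ℝ) < 4 := by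
    simp
    norm_num
  refine ((integrable_one_add_norm (μ := (volume : Measure (ℝ × ℝ × ℝ))) hdim).const_mul
    (C ^ 2)).mono' (hc.mul hc).aestronglyMeasurable (.of_forall fun p => ?_)
  have h := hC t p.1 p.2.1 p.2.2 ⟨le_rfl, le_rfl⟩
  have hn : ‖p‖ ≤ |p.1| + |p.2.1| + |p.2.2| := by
    simp only [Prod.norm_def, Real.norm_eq_abs]
    refine max_le ?_ (max_le ?_ ?_) <;>
      linarith [abs_nonneg p.1, abs_nonneg p.2.1, abs_nonneg p.2.2]
  set w := slice (D3 u l) t p with hw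
  have h1 : (1 + ‖p‖) ^ 2 * |w| ≤ C := by
    refine le_trans (mul_le_mul_of_nonneg_right ?_ (abs_nonneg _)) h
    exact pow_le_pow_left₀ (by positivity) (by linarith) 2
  have hp : 0 < 1 + ‖p‖ := by positivity
  rw [Real.norm_eq_abs, abs_of_nonneg (mul_self_nonneg w), Real.rpow_neg hp.le,
    show (4 : ℝ) = ((4 : ℕ) : ℝ) by norm_num, Real.rpow_natCast, ← div_eq_mul_inv,
    le_div_iff₀ (by positivity)]
  calc w * w * (1 + ‖p‖) ^ 4 = ((1 + ‖p‖) ^ 2 * |w|) ^ 2 := by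
        rw [mul_pow, sq_abs]
        ring
    _ ≤ C ^ 2 := by gcongr

theorem h1Bounded (hu : IsAdmissibleZK3 u) (ht : 2 ≤ t) {C : ℝ}
    (hC : √(∫ p : ℝ × ℝ × ℝ, (u t p.1 p.2.1 p.2.2) ^ 2)
        + √(∫ p : ℝ × ℝ × ℝ, ((px3 u t p.1 p.2.1 p.2.2) ^ 2 + (py3 u t p.1 p.2.1 p.2.2) ^ 2
              + (pz3 u t p.1 p.2.1 p.2.2) ^ 2)) ≤ C) :
    H1Bounded (C ^ 2) (slice u t) := by
  have h := hu.contDiff_slice t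
  have ex := slice_px3 h
  have ey := slice_py3 h
  have ez := slice_pz3 h
  have hx : Integrable fun p => dx (slice u t) p * dx (slice u t) p := by
    have e : slice (D3 u [1]) t = dx (slice u t) := by simpa [D3] using ex
    simpa [e] using hu.integrable_sq ht [1] (by rw [e]; exact (h.dirDeriv _).continuous)
  have hy : Integrable fun p => dy (slice u t) p * dy (slice u t) p := by
    have e : slice (D3 u [2]) t = dy (slice u t) := by simpa [D3] using ey
    simpa [e] using hu.integrable_sq ht [2] (by rw [e]; exact (h.dirDeriv _).continuous)
  have hz : Integrable fun p => dz (slice u t) p * dz (slice u t) p := by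
    have e : slice (D3 u [3]) t = dz (slice u t) := by simpa [D3] using ez
    simpa [e] using hu.integrable_sq ht [3] (by rw [e]; exact (h.dirDeriv _).continuous)
  have n1 := Real.sqrt_nonneg (∫ p : ℝ × ℝ × ℝ, (u t p.1 p.2.1 p.2.2) ^ 2)
  have n2 := Real.sqrt_nonneg (∫ p : ℝ × ℝ × ℝ, ((px3 u t p.1 p.2.1 p.2.2) ^ 2
    + (py3 u t p.1 p.2.1 p.2.2) ^ 2 + (pz3 u t p.1 p.2.1 p.2.2) ^ 2))
  refine ⟨h, hu.integrable_sq ht [] h.continuous, hx, hy, hz, ?_, ?_⟩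
  · have := (Real.sqrt_le_left (by linarith)).1 (le_of_add_le_of_nonneg_left hC n2)
    simpa only [slice, ← pow_two] using this
  · have := (Real.sqrt_le_left (by linarith)).1 (le_of_add_le_of_nonneg_right hC n1)
    rw [← ex, ← ey, ← ez]
    simpa only [slice, ← pow_two] using this

end IsAdmissibleZK3

/-- Differentiation under the integral against a compactly supported weight. -/
theorem hasDerivAt_integral_mul_of_hasCompactSupport {G : ℝ → ℝ × ℝ × ℝ → ℝ}
    (hG : ContDiff ℝ ∞ fun q : ℝ × ℝ × ℝ × ℝ => G q.1 q.2) {W : ℝ × ℝ × ℝ → ℝ}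
    (hW : Continuous W) (cW : HasCompactSupport W) (t : ℝ) :
    HasDerivAt (fun s => ∫ p, G s p * W p) (∫ p, deriv (fun s => G s p) t * W p) t := by
  have hd : ∀ s p, HasDerivAt (fun r => G r p)
      (fderiv ℝ (fun q : ℝ × ℝ × ℝ × ℝ => G q.1 q.2) (s, p) (1, 0)) s := fun s p =>
    HasFDerivAt.comp_hasDerivAt (f := fun r => (r, p)) s
      ((hG.differentiable (by simp)) (s, p)).hasFDerivAt
      ((hasDerivAt_id s).prodMk (hasDerivAt_const s p))
  have hc' : Continuous fun q : ℝ × ℝ × ℝ × ℝ => deriv (fun s => G s q.2) q.1 := by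
    have e : (fun q : ℝ × ℝ × ℝ × ℝ => deriv (fun s => G s q.2) q.1)
        = fun q => fderiv ℝ (fun q : ℝ × ℝ × ℝ × ℝ => G q.1 q.2) q (1, 0) :=
      funext fun q => (hd q.1 q.2).deriv
    rw [e]
    exact (hG.continuous_fderiv (by simp)).clm_apply continuous_const
  have hcG : ∀ s, Continuous (G s) := fun s =>
    hG.continuous.comp (continuous_const.prodMk continuous_id)
  have hcG' : Continuous fun p => deriv (fun s => G s p) t :=
    hc'.comp (continuous_const.prodMk continuous_id)
  obtain ⟨M, hM⟩ := ((isCompact_Icc (a := t - 1) (b := t + 1)).prod cW).exists_bound_of_continuousOn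
    hc'.continuousOn
  refine (hasDerivAt_integral_of_dominated_loc_of_deriv_le (bound := fun p => M * |W p|)
    (F' := fun s p => deriv (fun r => G r p) s * W p) (Icc_mem_nhds (sub_one_lt t) (lt_add_one t))
    (.of_forall fun s => ((hcG s).mul hW).aestronglyMeasurable)
    (((hcG t).mul hW).integrable_of_hasCompactSupport cW.mul_left)
    (hcG'.mul hW).aestronglyMeasurable (.of_forall fun p s hs => ?_)
    ((hW.integrable_of_hasCompactSupport cW).abs.const_mul M)
    (.of_forall fun p s _ => ?_)).2
  · rw [norm_mul, Real.norm_eq_abs (W p)]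
    by_cases hp : p ∈ tsupport W
    · exact mul_le_mul_of_nonneg_right (hM (s, p) ⟨hs, hp⟩) (abs_nonneg _)
    · simp [image_eq_zero_of_notMem_tsupport hp]
  · exact ((hd s p).differentiableAt.hasDerivAt).mul_const _

namespace IsAdmissibleZK3

theorem hasDerivAt_slice (hu : IsAdmissibleZK3 u) (ht : 2 ≤ t) (p : ℝ × ℝ × ℝ) :
    HasDerivAt (fun s => slice u s p)
      (-(dx (lap3 (slice u t)) p + slice u t p * dx (slice u t) p)) t := by
  rw [← hu.pt3_eq ht p]
  have h : DifferentiableAt ℝ (fun s => slice u s p) t :=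
    ((hu.contDiff_uncurry.comp (contDiff_id.prodMk contDiff_const)).differentiable (by simp)) t
  exact h.hasDerivAt

theorem hasDerivAt_momentum (hu : IsAdmissibleZK3 u) (ht : 2 ≤ t) {W : ℝ × ℝ × ℝ → ℝ}
    (hW : ContDiff ℝ ∞ W) (cW : HasCompactSupport W) :
    HasDerivAt (fun s => ∫ p, slice u s p * W p)
      (∫ p, (1 / 2 * (slice u t p * slice u t p * dx W p) + slice u t p * lap3 (dx W) p)) t := by
  have h := hasDerivAt_integral_mul_of_hasCompactSupport hu.contDiff_uncurry hW.continuous cW t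
  simp only [(hu.hasDerivAt_slice ht _).deriv] at h
  rwa [integral_mass_identity (hu.contDiff_slice t) hW cW] at h

theorem hasDerivAt_mass (hu : IsAdmissibleZK3 u) (ht : 2 ≤ t) {W : ℝ × ℝ × ℝ → ℝ}
    (hW : ContDiff ℝ ∞ W) (cW : HasCompactSupport W) :
    HasDerivAt (fun s => ∫ p, slice u s p * slice u s p * W p)
      (2 * ∫ p, (1 / 2 * (slice u t p * slice u t p * lap3 (dx W) p)
        + 1 / 3 * (slice u t p * slice u t p * slice u t p * dx W p)
        - dx W p * (3 / 2 * (dx (slice u t) p * dx (slice u t) p)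
          + 1 / 2 * (dy (slice u t) p * dy (slice u t) p)
          + 1 / 2 * (dz (slice u t) p * dz (slice u t) p))
        - dx (slice u t) p * (dy W p * dy (slice u t) p + dz W p * dz (slice u t) p))) t := by
  have h := hasDerivAt_integral_mul_of_hasCompactSupport
    (G := fun s p => slice u s p * slice u s p)
    (hu.contDiff_uncurry.mul hu.contDiff_uncurry) hW.continuous cW t
  rw [← integral_energy_identity (hu.contDiff_slice t) hW cW, ← integral_const_mul]
  refine h.congr_deriv (integral_congr_ae (.of_forall fun p => ?_))
  dsimp only
  rw [((hu.hasDerivAt_slice ht p).fun_mul (hu.hasDerivAt_slice ht p)).deriv]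
  ring

end IsAdmissibleZK3

end Time

section Decay

variable {m : ℝ} {u : ℝ → ℝ → ℝ → ℝ → ℝ}

theorem sqrt_eight_mul_le (V : ℝ) : √(8 * V) ≤ 3 * √V := by
  rw [Real.sqrt_mul (by norm_num)]
  gcongr
  rw [Real.sqrt_le_left] <;> norm_num

set_option maxHeartbeats 1000000 in
/-- In every dyadic time window there is a time at which the local energy at the scales
`X, Y, Z` is small, provided the error terms are. -/
theorem exists_time_local_energy_le (m : ℝ) (hm : 0 ≤ m) : ∃ K : ℝ, 0 < K ∧
    ∀ u : ℝ → ℝ → ℝ → ℝ → ℝ, IsAdmissibleZK3 u → (∀ t, 2 ≤ t → H1Bounded m (slice u t)) →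
      ∀ S X L Y Z δ : ℝ, 4 ≤ S → 1 ≤ X → X ≤ L → L ≤ Y → L ≤ Z → 0 < δ → δ ≤ 1 →
        ∃ t ∈ Set.Ioo (S / 2) S,
          (∫ p, slice u t p * slice u t p * boxCutoff (2 * X) (2 * Y) (2 * Z) p)
            + ∫ p, (dx (slice u t) p * dx (slice u t) p + dy (slice u t) p * dy (slice u t) p
              + dz (slice u t) p * dz (slice u t) p) * boxCutoff X Y Z p
          ≤ K * (δ + 1 / δ * (1 / X + X / L + X / Y + X / Z + √(L * Y * Z) / X ^ 2
              + X * √(L * Y * Z) / S + X / S)) := by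
  obtain ⟨K₁, hK₁, mass⟩ := exists_mass_rate_bound m
  obtain ⟨K₂, hK₂, energy⟩ := exists_energy_rate_bound m hm
  refine ⟨2 * K₂ + 2 * K₁ * K₂ + 3072 * K₂ * (m + 1) + 16 * m, by positivity, ?_⟩
  intro u hu hb S X L Y Z δ hS hX hXL hLY hLZ hδ hδ1
  have X0 : 0 < X := by linarith
  have L0 : 0 < L := by linarith
  have Y0 : 0 < Y := by linarith
  have Z0 : 0 < Z := by linarith
  have S0 : 0 < S := by linarith
  set R := √(L * Y * Z) with hR
  have R0 : 0 ≤ R := Real.sqrt_nonneg _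
  have hR2 : √(2 * L * (2 * Y) * (2 * Z)) ≤ 3 * R := by
    rw [show 2 * L * (2 * Y) * (2 * Z) = 8 * (L * Y * Z) by ring]
    exact sqrt_eight_mul_le _
  set W₁ := virialWeight (2 * X) (2 * L) (2 * Y) (2 * Z) with hW₁
  set W₀ := virialWeight X L Y Z with hW₀
  have cW₁ : HasCompactSupport W₁ := hasCompactSupport_virialWeight (by linarith) (by linarith)
    (by linarith) (by linarith)
  have cW₀ : HasCompactSupport W₀ := hasCompactSupport_virialWeight X0 hXL Y0 Z0
  set c : ℝ := 2 * (1 + K₂ / δ) with hc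
  have hKδ : 0 < K₂ / δ := by positivity
  have c0 : 0 < c := by positivity
  have c4 : c ≤ 4 * K₂ * (1 / δ) := by
    have : 1 ≤ K₂ / δ := by
      rw [le_div_iff₀ hδ]
      linarith
    rw [hc, mul_assoc, mul_one_div]
    linarith
  set N : ℝ → ℝ := fun s => c * (∫ p, slice u s p * W₁ p) - ∫ p, slice u s p * slice u s p * W₀ p
    with hN
  have hder : ∀ t, 2 ≤ t → HasDerivAt N _ t := fun t ht =>
    ((hu.hasDerivAt_momentum ht (contDiff_virialWeight _ _ _ _) cW₁).const_mul c).sub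
      (hu.hasDerivAt_mass ht (contDiff_virialWeight _ _ _ _) cW₀)
  set B : ℝ := c * (192 * (m + 1) * (X * R)) + 4 * m * X with hB
  have hNB : ∀ t, 2 ≤ t → |N t| ≤ B := by
    intro t ht
    have h1 := (hb t ht).abs_integral_mul_virialWeight_le (X := 2 * X) (L := 2 * L) (Y := 2 * Y)
      (Z := 2 * Z) (by linarith) (by linarith) (by linarith) (by linarith)
    have h2 := (hb t ht).abs_integral_sq_mul_virialWeight_le (L := L) (Y := Y) (Z := Z) X0
    have h3 : 32 * (m + 1) * (2 * X * √(2 * L * (2 * Y) * (2 * Z)))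
        ≤ 32 * (m + 1) * (2 * X * (3 * R)) := by gcongr
    rw [hN]
    refine (abs_sub _ _).trans (add_le_add ?_ h2)
    rw [abs_mul, abs_of_pos c0]
    refine mul_le_mul_of_nonneg_left ?_ c0.le
    linarith
  obtain ⟨t, ht, hslope⟩ := exists_hasDerivAt_eq_slope N _ (half_lt_self S0)
    (fun s hs => (hder s (by linarith [hs.1])).continuousAt.continuousWithinAt)
    (fun s hs => hder s (by linarith [hs.1]))
  have ht2 : 2 ≤ t := by linarith [ht.1]
  refine ⟨t, ht, ?_⟩
  have e1 := mass _ (hb t ht2) (2 * X) (2 * L) (2 * Y) (2 * Z) (by linarith) (by linarith)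
    (by linarith) (by linarith)
  have e2 := energy _ (hb t ht2) X L Y Z δ hX hXL hLY hLZ hδ
  set F := ∫ p, slice u t p * slice u t p * boxCutoff (2 * X) (2 * Y) (2 * Z) p with hF
  set J := ∫ p, (dx (slice u t) p * dx (slice u t) p + dy (slice u t) p * dy (slice u t) p
    + dz (slice u t) p * dz (slice u t) p) * boxCutoff X Y Z p with hJ
  have hsl : (N S - N (S / 2)) / (S - S / 2) ≤ 4 * (B / S) := by
    have a1 := (abs_le.1 (hNB S (by linarith))).2
    have a2 := (abs_le.1 (hNB (S / 2) (by linarith))).1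
    rw [div_le_iff₀ (by linarith)]
    have : 4 * (B / S) * (S - S / 2) = 2 * B := by
      field_simp
      ring
    linarith
  rw [← hslope] at hsl
  have q1 : 2 * X / (2 * L) = X / L := mul_div_mul_left _ _ two_ne_zero
  have q2 : √(2 * L * (2 * Y) * (2 * Z)) / (2 * X) ^ 2 ≤ R / X ^ 2 := by
    rw [div_le_div_iff₀ (by positivity) (by positivity)]
    nlinarith [mul_nonneg R0 (sq_nonneg X), mul_le_mul_of_nonneg_right hR2 (sq_nonneg X)]
  rw [q1] at e1
  have e1' := e1.trans (add_le_add le_rfl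
    (mul_le_mul_of_nonneg_left (add_le_add (le_refl (X / L)) q2) (by linarith : 0 ≤ K₁)))
  have e3 := mul_le_mul_of_nonneg_left e1' (by positivity : 0 ≤ 1 + K₂ / δ)
  have e4 : K₂ * (F / δ) = K₂ / δ * F := by ring
  have a1 : 0 ≤ 1 / X := by positivity
  have a2 : 0 ≤ X / L := by positivity
  have a3 : 0 ≤ X / Y := by positivity
  have a4 : 0 ≤ X / Z := by positivity
  have a5 : 0 ≤ R / X ^ 2 := by positivity
  have a6 : 0 ≤ X * R / S := by positivity
  have a7 : 0 ≤ X / S := by positivity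
  have hδ' : 1 ≤ 1 / δ := by rwa [le_div_iff₀ hδ, one_mul]
  set err := 1 / X + X / L + X / Y + X / Z + R / X ^ 2 + X * R / S + X / S with herr
  have err0 : 0 ≤ err := by positivity
  have err1 : err ≤ 1 / δ * err := le_mul_of_one_le_left err0 hδ'
  have sum : F + J ≤ 4 * (B / S) + K₂ * δ + c / 2 * (K₁ * (X / L + R / X ^ 2))
      + K₂ * (1 / X + X / L + X / Y + X / Z) := by
    have hc2 : 1 + K₂ / δ = c / 2 := by rw [hc]; ring
    rw [hc2] at e3
    have hc3 : K₂ / δ = c / 2 - 1 := by rw [hc]; ring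
    rw [hc3] at e4
    linarith
  refine sum.trans ?_
  have eB : 4 * (B / S) = c * (768 * (m + 1) * (X * R / S)) + 16 * m * (X / S) := by
    rw [hB]
    field_simp
    ring
  have b1 : c * (768 * (m + 1) * (X * R / S)) ≤ 4 * K₂ * (1 / δ) * (768 * (m + 1) * err) := by
    gcongr
    linarith
  have b2 : 16 * m * (X / S) ≤ 16 * m * (1 / δ * err) := by
    gcongr
    linarith
  have b3 : c / 2 * (K₁ * (X / L + R / X ^ 2)) ≤ 4 * K₂ * (1 / δ) / 2 * (K₁ * err) := by
    gcongr
    linarith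
  have b4 : K₂ * (1 / X + X / L + X / Y + X / Z) ≤ K₂ * (1 / δ * err) := by
    gcongr
    linarith
  have b5 : 0 ≤ K₂ * (1 / δ * err) := by positivity
  have b6 : 0 ≤ (K₂ + 2 * K₁ * K₂ + 3072 * K₂ * (m + 1) + 16 * m) * δ := by positivity
  rw [eB]
  linarith

/-- Expanding box scales at which the local energy is small along a sequence of times. -/
theorem frequently_local_energy_le (hm : 0 ≤ m) (hu : IsAdmissibleZK3 u)
    (hb : ∀ t, 2 ≤ t → H1Bounded m (slice u t)) {X L Y Z : ℝ → ℝ}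
    (hX : ∀ᶠ S in atTop, 1 ≤ X S) (hXL : ∀ᶠ S in atTop, X S ≤ L S)
    (hLY : ∀ᶠ S in atTop, L S ≤ Y S) (hLZ : ∀ᶠ S in atTop, L S ≤ Z S)
    (herr : Tendsto (fun S => 1 / X S + X S / L S + X S / Y S + X S / Z S
      + √(L S * Y S * Z S) / X S ^ 2 + X S * √(L S * Y S * Z S) / S + X S / S) atTop (nhds 0))
    {ε : ℝ} (hε : 0 < ε) :
    ∀ᶠ S in atTop, ∃ t ∈ Set.Ioo (S / 2) S,
      (∫ p, slice u t p * slice u t p * boxCutoff (2 * X S) (2 * Y S) (2 * Z S) p)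
        + ∫ p, (dx (slice u t) p * dx (slice u t) p + dy (slice u t) p * dy (slice u t) p
          + dz (slice u t) p * dz (slice u t) p) * boxCutoff (X S) (Y S) (Z S) p ≤ ε := by
  obtain ⟨K, hK, h⟩ := exists_time_local_energy_le m hm
  set δ := min 1 (ε / (2 * K)) with hδ
  have δ0 : 0 < δ := lt_min one_pos (by positivity)
  have hlim : Tendsto (fun S => K * (δ + 1 / δ * (1 / X S + X S / L S + X S / Y S + X S / Z S
      + √(L S * Y S * Z S) / X S ^ 2 + X S * √(L S * Y S * Z S) / S + X S / S)))
      atTop (nhds (K * (δ + 1 / δ * 0))) := ((herr.const_mul _).const_add _).const_mul _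
  have hlt : K * (δ + 1 / δ * 0) < ε := by
    have := mul_le_mul_of_nonneg_left (min_le_right 1 (ε / (2 * K))) hK.le
    rw [← hδ] at this
    have e : K * (ε / (2 * K)) = ε / 2 := by field_simp
    rw [mul_zero, add_zero]
    linarith
  filter_upwards [hX, hXL, hLY, hLZ, eventually_ge_atTop 4, hlim.eventually (gt_mem_nhds hlt)]
    with S h1 h2 h3 h4 h5 h6
  obtain ⟨t, ht, hle⟩ := h u hu hb S _ _ _ _ δ h5 h1 h2 h3 h4 δ0 (min_le_left _ _)
  exact ⟨t, ht, hle.trans h6.le⟩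

/-- The local `H¹` energy over a region inside a box is bounded by its smoothed version. -/
theorem setIntegral_le_localized (hb : H1Bounded m (slice u t)) {X Y Z : ℝ} (hX : 0 < X)
    (hY : 0 < Y) (hZ : 0 < Z) {Ω : Set (ℝ × ℝ × ℝ)} (hΩ : MeasurableSet Ω)
    (hsub : Ω ⊆ box3 X Y Z) :
    ∫ p in Ω, ((u t p.1 p.2.1 p.2.2) ^ 2 + (px3 u t p.1 p.2.1 p.2.2) ^ 2
        + (py3 u t p.1 p.2.1 p.2.2) ^ 2 + (pz3 u t p.1 p.2.1 p.2.2) ^ 2)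
      ≤ (∫ p, slice u t p * slice u t p * boxCutoff (2 * X) (2 * Y) (2 * Z) p)
        + ∫ p, (dx (slice u t) p * dx (slice u t) p + dy (slice u t) p * dy (slice u t) p
          + dz (slice u t) p * dz (slice u t) p) * boxCutoff X Y Z p := by
  have ex := slice_px3 hb.smooth
  have ey := slice_py3 hb.smooth
  have ez := slice_pz3 hb.smooth
  have bQ : ∀ (A B D : ℝ) (p : ℝ × ℝ × ℝ), |boxCutoff A B D p| ≤ 1 := fun A B D p => by
    rw [abs_of_nonneg (boxCutoff_nonneg _ _ _ p)]; exact boxCutoff_le_one _ _ _ p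
  have i1 := integrable_mul_of_abs_le_const hb.sq_integrable
    (contDiff_boxCutoff (2 * X) (2 * Y) (2 * Z)).continuous (bQ _ _ _)
  have i2 := integrable_mul_of_abs_le_const hb.grad_integrable
    (contDiff_boxCutoff X Y Z).continuous (bQ _ _ _)
  have e : ∀ p : ℝ × ℝ × ℝ, (u t p.1 p.2.1 p.2.2) ^ 2 + (px3 u t p.1 p.2.1 p.2.2) ^ 2
        + (py3 u t p.1 p.2.1 p.2.2) ^ 2 + (pz3 u t p.1 p.2.1 p.2.2) ^ 2
      = slice u t p * slice u t p + (dx (slice u t) p * dx (slice u t) p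
        + dy (slice u t) p * dy (slice u t) p + dz (slice u t) p * dz (slice u t) p) := by
    intro p
    rw [← ex, ← ey, ← ez]
    simp only [slice]
    ring
  simp only [e]
  rw [← integral_add i1 i2, ← integral_indicator hΩ]
  refine integral_mono ((hb.sq_integrable.add hb.grad_integrable).indicator hΩ) (i1.add i2)
    fun p => ?_
  by_cases hp : p ∈ Ω
  · obtain ⟨h1, h2, h3⟩ := mem_box3.1 (hsub hp)
    have hp2 : p ∈ box3 (2 * X) (2 * Y) (2 * Z) :=
      mem_box3.2 ⟨by linarith, by linarith, by linarith⟩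
    rw [Set.indicator_of_mem hp]
    dsimp only
    rw [boxCutoff_eq_one hX hY hZ (hsub hp),
      boxCutoff_eq_one (by linarith) (by linarith) (by linarith) hp2, mul_one, mul_one]
  · rw [Set.indicator_of_notMem hp]
    have q1 := boxCutoff_nonneg (2 * X) (2 * Y) (2 * Z) p
    have q2 := boxCutoff_nonneg X Y Z p
    have x0 := mul_self_nonneg (dx (slice u t) p)
    have y0 := mul_self_nonneg (dy (slice u t) p)
    have z0 := mul_self_nonneg (dz (slice u t) p)
    have w0 := mul_self_nonneg (slice u t p)
    dsimp only
    positivity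

/-- The box scales `S^b, S^{b+2a}, S^{br₁}, S^{br₂}` have vanishing error terms. -/
theorem tendsto_scale_error {b r₁ r₂ a : ℝ} (hb : 0 < b) (hr₁ : 1 < r₁) (hr₂ : 1 < r₂)
    (ha : 0 < a) (ha₁ : a < b * (3 - r₁ - r₂) / 2) (ha₂ : a < 1 - b * (3 + r₁ + r₂) / 2) :
    Tendsto (fun S : ℝ => 1 / S ^ b + S ^ b / S ^ (b + 2 * a) + S ^ b / S ^ (b * r₁)
      + S ^ b / S ^ (b * r₂) + √(S ^ (b + 2 * a) * S ^ (b * r₁) * S ^ (b * r₂)) / (S ^ b) ^ 2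
      + S ^ b * √(S ^ (b + 2 * a) * S ^ (b * r₁) * S ^ (b * r₂)) / S + S ^ b / S)
      atTop (nhds 0) := by
  have key : ∀ e : ℝ, e < 0 → Tendsto (fun S : ℝ => S ^ e) atTop (nhds 0) := fun e he => by
    simpa using tendsto_rpow_neg_atTop (neg_pos.2 he)
  set g : ℝ := (b + 2 * a + b * r₁ + b * r₂) / 2 with hg
  have hbr₁ : b < b * r₁ := by nlinarith
  have hbr₂ : b < b * r₂ := by nlinarith
  have lim := ((((((key (-b) (by linarith)).add (key (-(2 * a)) (by linarith))).add
    (key (b - b * r₁) (by linarith))).add (key (b - b * r₂) (by linarith))).add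
    (key (g - 2 * b) (by rw [hg]; linarith))).add (key (b + g - 1) (by rw [hg]; linarith))).add
    (key (b - 1) (by linarith))
  simp only [add_zero] at lim
  refine lim.congr' ?_
  filter_upwards [eventually_gt_atTop 0] with S hS
  have hsqrt : √(S ^ (b + 2 * a) * S ^ (b * r₁) * S ^ (b * r₂)) = S ^ g := by
    rw [← Real.rpow_add hS, ← Real.rpow_add hS, Real.sqrt_eq_rpow, ← Real.rpow_mul hS.le, hg]
    congr 1
    ring
  rw [hsqrt, one_div, ← Real.rpow_neg hS.le, ← Real.rpow_sub hS, ← Real.rpow_sub hS,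
    ← Real.rpow_sub hS, ← Real.rpow_natCast (S ^ b) 2, ← Real.rpow_mul hS.le,
    ← Real.rpow_sub hS, ← Real.rpow_add hS, ← Real.rpow_sub_one hS.ne',
    ← Real.rpow_sub_one hS.ne']
  congr 5 <;> push_cast <;> ring_nf

end Decay

/-- Local `H¹` decay for 3D ZK:
`liminf_{t→∞} ∫_{Ω(t)} (u² + |∇u|²) dxdydz = 0` where
`Ω(t) = {(x,y,z) : |x| < t^b, |y| < t^{br₁}, |z| < t^{br₂}}`. -/
theorem zk3_H1_liminf_decay
    (b r₁ r₂ : ℝ) (hb : 0 < b) (hr₁ : 1 < r₁) (hr₂ : 1 < r₂)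
    (hsum : r₁ + r₂ < 3) (h₁ : r₁ + 1 < 3*r₂) (h₂ : r₂ + 1 < 3*r₁)
    (hbb : b < 2/(3 + r₁ + r₂))
    (u : ℝ → ℝ → ℝ → ℝ → ℝ) (hu : IsAdmissibleZK3 u)
    (hH1 : ∃ C : ℝ, ∀ t : ℝ, 2 ≤ t →
      Real.sqrt (∫ p : ℝ × ℝ × ℝ, (u t p.1 p.2.1 p.2.2)^2)
        + Real.sqrt (∫ p : ℝ × ℝ × ℝ,
            ((px3 u t p.1 p.2.1 p.2.2)^2 + (py3 u t p.1 p.2.1 p.2.2)^2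
              + (pz3 u t p.1 p.2.1 p.2.2)^2)) ≤ C) :
    Filter.liminf
      (fun t : ℝ =>
        ∫ p in {q : ℝ × ℝ × ℝ |
            |q.1| < t ^ b ∧ |q.2.1| < t ^ (b*r₁) ∧ |q.2.2| < t ^ (b*r₂)},
          ((u t p.1 p.2.1 p.2.2)^2 + (px3 u t p.1 p.2.1 p.2.2)^2
            + (py3 u t p.1 p.2.1 p.2.2)^2 + (pz3 u t p.1 p.2.1 p.2.2)^2))
      Filter.atTop = 0 := by
  obtain ⟨C, hC⟩ := hH1
  have hB : ∀ t, 2 ≤ t → H1Bounded (C ^ 2) (slice u t) := fun t ht => hu.h1Bounded ht (hC t ht)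
  set Ω : ℝ → Set (ℝ × ℝ × ℝ) := fun t => {q : ℝ × ℝ × ℝ |
    |q.1| < t ^ b ∧ |q.2.1| < t ^ (b*r₁) ∧ |q.2.2| < t ^ (b*r₂)} with hΩ
  have hΩm : ∀ t, MeasurableSet (Ω t) := fun t => by
    refine IsOpen.measurableSet ?_
    refine IsOpen.and (isOpen_lt (by fun_prop) continuous_const) (IsOpen.and
      (isOpen_lt (by fun_prop) continuous_const) (isOpen_lt (by fun_prop) continuous_const))
  have hΩsub : ∀ t S : ℝ, 0 < t → t ≤ S → Ω t ⊆ box3 (S ^ b) (S ^ (b * r₁)) (S ^ (b * r₂)) := by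
    rintro t S ht hS p ⟨h1, h2, h3⟩
    have mono : ∀ e : ℝ, 0 < e → t ^ e ≤ S ^ e := fun e he =>
      Real.rpow_le_rpow ht.le hS he.le
    exact mem_box3.2 ⟨h1.le.trans (mono _ hb), h2.le.trans (mono _ (by positivity)),
      h3.le.trans (mono _ (by positivity))⟩
  set f : ℝ → ℝ := fun t => ∫ p in Ω t, ((u t p.1 p.2.1 p.2.2)^2 + (px3 u t p.1 p.2.1 p.2.2)^2
    + (py3 u t p.1 p.2.1 p.2.2)^2 + (pz3 u t p.1 p.2.1 p.2.2)^2) with hf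
  have hf0 : ∀ t, 0 ≤ f t := fun t => integral_nonneg fun p => by positivity
  have hfreq : ∀ ε : ℝ, 0 < ε → ∃ᶠ t in atTop, f t ≤ ε := by
    intro ε hε
    have hden : 0 < 3 + r₁ + r₂ := by linarith
    rw [lt_div_iff₀ hden] at hbb
    obtain ⟨a, a0, a4⟩ : ∃ a : ℝ, 0 < a ∧ a < min (min (b * (r₁ - 1) / 2) (b * (r₂ - 1) / 2))
        (min (b * (3 - r₁ - r₂) / 2) (1 - b * (3 + r₁ + r₂) / 2)) := by
      refine exists_between (lt_min (lt_min ?_ ?_) (lt_min ?_ ?_))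
      · exact half_pos (mul_pos hb (by linarith))
      · exact half_pos (mul_pos hb (by linarith))
      · exact half_pos (mul_pos hb (by linarith))
      · linarith
    simp only [lt_min_iff] at a4
    obtain ⟨⟨ha₁, ha₂⟩, ha₃, ha₄⟩ := a4
    have mono : ∀ e e' : ℝ, e ≤ e' → ∀ᶠ S : ℝ in atTop, S ^ e ≤ S ^ e' := fun e e' h =>
      (eventually_ge_atTop 1).mono fun S hS => Real.rpow_le_rpow_of_exponent_le hS h
    have hev := frequently_local_energy_le (sq_nonneg C) hu hB (X := fun S => S ^ b)
      (L := fun S => S ^ (b + 2 * a)) (Y := fun S => S ^ (b * r₁)) (Z := fun S => S ^ (b * r₂))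
      ((eventually_ge_atTop 1).mono fun S hS => Real.one_le_rpow hS hb.le)
      (mono _ _ (by linarith)) (mono _ _ (by linarith)) (mono _ _ (by linarith))
      (tendsto_scale_error hb hr₁ hr₂ a0 ha₃ ha₄) hε
    rw [frequently_atTop]
    intro T
    obtain ⟨S, ⟨t, ht, hle⟩, hS⟩ :=
      (hev.and (eventually_ge_atTop (max 4 (2 * T)))).exists
    have hS4 : 4 ≤ S := (le_max_left _ _).trans hS
    have hST : 2 * T ≤ S := (le_max_right _ _).trans hS
    have ht2 : 2 ≤ t := by linarith [ht.1]
    have S0 : 0 < S := by linarith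
    refine ⟨t, by linarith [ht.1], le_trans ?_ hle⟩
    exact setIntegral_le_localized (hB t ht2) (Real.rpow_pos_of_pos S0 _)
      (Real.rpow_pos_of_pos S0 _) (Real.rpow_pos_of_pos S0 _) (hΩm t)
      (hΩsub t S (by linarith) ht.2.le)
  refine le_antisymm (le_of_forall_pos_le_add fun ε hε => ?_) ?_
  · rw [zero_add]
    exact liminf_le_of_frequently_le (hfreq ε hε)
      (isBoundedUnder_of_eventually_ge (.of_forall hf0))
  · exact le_liminf_of_le (IsCobounded.of_frequently_le (hfreq 1 one_pos)) (.of_forall hf0)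
end
end
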